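/- arXiv:1707.00412 — 2 statements merged into one kernel-verified Lean document; each statement's English description precedes it below -/
import Mathlib

section
/- Let m, a₁, b₁ be pairwise coprime squarefree integers with m·a₁ ≠ 1, m·b₁ ≠ 1 and a₁·b₁ ≠ 1, and let K = ℚ(√(m a₁), √(m b₁)), a biquadratic extension of ℚ. Suppose m ≡ a₁ (mod 4) but b₁ ≢ m (mod 4) (so m and a₁ are odd). Then K fails the Hasse norm principle if and only if all of the following hold: (i) every odd prime p dividing a₁ satisfies legendreSym p (m b₁) = +1; (ii) every odd prime p dividing b₁ satisfies legendreSym p (m a₁) = +1; (iii) every odd prime p dividing m satisfies legendreSym p (a₁ b₁) = +1; (iv) m ≡ a₁ (mod 8). -/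
open scoped TensorProduct

/-- A finite Galois extension `K/ℚ` satisfies the Hasse norm principle if every nonzero
rational that is a local norm everywhere (a norm from `ℚ_p ⊗_ℚ K` for every prime `p`,
and a norm from `ℝ ⊗_ℚ K`) is a global norm from `K`. -/
def HasseNormPrinciple (K : Type*) [Field K] [Algebra ℚ K] : Prop :=
  ∀ x : ℚ, x ≠ 0 →
    ((∀ (p : ℕ) [Fact p.Prime],
        ∃ y : ℚ_[p] ⊗[ℚ] K, IsUnit y ∧ Algebra.norm ℚ_[p] y = (x : ℚ_[p])) ∧
      (∃ y : ℝ ⊗[ℚ] K, IsUnit y ∧ Algebra.norm ℝ y = (x : ℝ))) →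
    ∃ y : K, y ≠ 0 ∧ Algebra.norm ℚ y = x

open scoped NumberTheorySymbols

/-- The Hilbert symbol of `p` and a `p`-adic unit: the Legendre symbol for odd `p`, and `χ₈` for
`p = 2`. -/
def unitChar (p : ℕ) (u : ℤ) : ℤ := if p = 2 then ZMod.χ₈ u else J(u | p)

/-- The Hilbert symbol of two `p`-adic units: it is trivial for odd `p`. -/
def unitPairing (p : ℕ) (u w : ℤ) : ℤ := if p = 2 ∧ u % 4 = 3 ∧ w % 4 = 3 then -1 else 1

/-- The Hilbert symbol of two nonzero integers at a place of `ℚ`: `v = 0` is the real place, a prime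
`v` is the `v`-adic place, and the symbol is `1` when `v` is not a place. -/
def hilbertSym (v : ℕ) (a b : ℤ) : ℤ :=
  if v = 0 then (if a < 0 ∧ b < 0 then -1 else 1)
  else if v.Prime then
    unitPairing v (a / v ^ padicValInt v a) (b / v ^ padicValInt v b)
      * unitChar v (-1) ^ (padicValInt v a * padicValInt v b)
      * unitChar v (a / v ^ padicValInt v a) ^ padicValInt v b
      * unitChar v (b / v ^ padicValInt v b) ^ padicValInt v a
  else 1

theorem unitChar_mul (p : ℕ) (u w : ℤ) : unitChar p (u * w) = unitChar p u * unitChar p w := by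
  unfold unitChar
  split_ifs
  · push_cast
    rw [map_mul]
  · rw [jacobiSym.mul_left]

theorem unitChar_sq {p : ℕ} (hp : p.Prime) {u : ℤ} (hu : ¬ (p : ℤ) ∣ u) : unitChar p u ^ 2 = 1 := by
  unfold unitChar
  split_ifs with h
  · subst h
    have h1 : ((u : ℤ) : ZMod 8) = ((u % 8 : ℤ) : ZMod 8) := by
      rw [ZMod.intCast_eq_intCast_iff]; exact (Int.mod_modEq u 8).symm
    rw [h1]
    have h2 : u % 8 = 1 ∨ u % 8 = 3 ∨ u % 8 = 5 ∨ u % 8 = 7 := by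
      push_cast at hu; omega
    rcases h2 with h2 | h2 | h2 | h2 <;> rw [h2] <;> decide
  · apply jacobiSym.sq_one
    rw [Int.gcd_comm]
    exact (Int.isCoprime_iff_gcd_eq_one.mp
      ((Nat.prime_iff_prime_int.mp hp).coprime_iff_not_dvd.mpr hu))

theorem unitChar_eq {p : ℕ} (hp : p.Prime) {u : ℤ} (hu : ¬ (p : ℤ) ∣ u) :
    unitChar p u = 1 ∨ unitChar p u = -1 := by
  rw [← mul_self_eq_one_iff, ← sq, unitChar_sq hp hu]

theorem unitChar_congr {p : ℕ} {u w : ℤ} (h : (p : ℤ) ^ 3 ∣ u - w) :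
    unitChar p u = unitChar p w := by
  unfold unitChar
  split_ifs with h2
  · subst h2
    congr 1
    rw [eq_comm, ZMod.intCast_eq_intCast_iff_dvd_sub]
    exact_mod_cast h
  · apply jacobiSym.mod_left'
    exact Int.ModEq.symm (Int.modEq_iff_dvd.mpr ((dvd_pow_self _ (by norm_num)).trans h))

theorem unitPairing_comm (p : ℕ) (u w : ℤ) : unitPairing p u w = unitPairing p w u := by
  unfold unitPairing
  congr 1
  simp only [eq_iff_iff]; tauto

theorem unitPairing_mul {p : ℕ} {u u' w : ℤ} (hu : ¬ (p : ℤ) ∣ u) (hu' : ¬ (p : ℤ) ∣ u') :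
    unitPairing p (u * u') w = unitPairing p u w * unitPairing p u' w := by
  unfold unitPairing
  by_cases h2 : p = 2
  · subst h2
    have h1 : u % 4 = 1 ∨ u % 4 = 3 := by push_cast at hu; omega
    have h1' : u' % 4 = 1 ∨ u' % 4 = 3 := by push_cast at hu'; omega
    rw [Int.mul_emod]
    rcases h1 with h | h <;> rcases h1' with h' | h' <;> rw [h, h'] <;> norm_num
    split_ifs <;> norm_num
  · simp [h2]

theorem unitPairing_sq (p : ℕ) (u w : ℤ) : unitPairing p u w ^ 2 = 1 := by
  unfold unitPairing
  split_ifs <;> norm_num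

theorem unitPairing_congr {p : ℕ} {u u' : ℤ} (w : ℤ) (h : (p : ℤ) ^ 3 ∣ u - u') :
    unitPairing p u w = unitPairing p u' w := by
  unfold unitPairing
  by_cases h2 : p = 2
  · subst h2
    have : u % 4 = u' % 4 := by push_cast at h; omega
    rw [this]
  · simp [h2]

theorem exists_eq_pow_mul {p : ℕ} (hp : p.Prime) {a : ℤ} (ha : a ≠ 0) :
    ∃ (α : ℕ) (u : ℤ), ¬ (p : ℤ) ∣ u ∧ a = p ^ α * u := by
  have hf : FiniteMultiplicity (p : ℤ) a := by
    rw [Int.finiteMultiplicity_iff]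
    exact ⟨by simpa using hp.ne_one, ha⟩
  obtain ⟨u, hu, h⟩ := hf.exists_eq_pow_mul_and_not_dvd
  exact ⟨_, u, h, hu⟩

theorem padicValInt_pow_mul {p : ℕ} (hp : p.Prime) (α : ℕ) {u : ℤ} (hu : ¬ (p : ℤ) ∣ u) :
    padicValInt p (p ^ α * u) = α := by
  have := Fact.mk hp
  have hp0 : (p : ℤ) ≠ 0 := by exact_mod_cast hp.ne_zero
  have hu0 : u ≠ 0 := by rintro rfl; simp at hu
  rw [padicValInt.mul (pow_ne_zero _ hp0) hu0, padicValInt.eq_zero_of_not_dvd hu]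
  simp [padicValInt, Int.natAbs_pow]

theorem hilbertSym_eval {p : ℕ} (hp : p.Prime) (α β : ℕ) {u w : ℤ} (hu : ¬ (p : ℤ) ∣ u)
    (hw : ¬ (p : ℤ) ∣ w) :
    hilbertSym p (p ^ α * u) (p ^ β * w) =
      unitPairing p u w * unitChar p (-1) ^ (α * β) * unitChar p u ^ β * unitChar p w ^ α := by
  have hp0 : (p : ℤ) ≠ 0 := by exact_mod_cast hp.ne_zero
  unfold hilbertSym
  rw [if_neg hp.ne_zero, if_pos hp, padicValInt_pow_mul hp α hu, padicValInt_pow_mul hp β hw,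
    Int.mul_ediv_cancel_left _ (pow_ne_zero _ hp0), Int.mul_ediv_cancel_left _ (pow_ne_zero _ hp0)]

theorem hilbertSym_zero (a b : ℤ) : hilbertSym 0 a b = if a < 0 ∧ b < 0 then -1 else 1 := by
  simp [hilbertSym]

theorem hilbertSym_of_not_place {v : ℕ} (h0 : v ≠ 0) (hv : ¬ v.Prime) (a b : ℤ) :
    hilbertSym v a b = 1 := by
  simp [hilbertSym, h0, hv]

theorem hilbertSym_comm (v : ℕ) (a b : ℤ) : hilbertSym v a b = hilbertSym v b a := by
  unfold hilbertSym
  rw [unitPairing_comm, Nat.mul_comm (padicValInt v a)]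
  simp only [and_comm (a := a < 0)]
  split_ifs <;> ring

theorem not_dvd_neg_one {p : ℕ} (hp : p.Prime) : ¬ (p : ℤ) ∣ -1 := by
  rw [dvd_neg]
  exact_mod_cast fun h => hp.one_lt.ne' (Nat.dvd_one.mp h)

theorem not_dvd_mul {p : ℕ} (hp : p.Prime) {u w : ℤ} (hu : ¬ (p : ℤ) ∣ u) (hw : ¬ (p : ℤ) ∣ w) :
    ¬ (p : ℤ) ∣ u * w := by
  rw [(Nat.prime_iff_prime_int.mp hp).dvd_mul]; tauto

theorem hilbertSym_mul_left (v : ℕ) {a a' b : ℤ} (ha : a ≠ 0) (ha' : a' ≠ 0) (hb : b ≠ 0) :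
    hilbertSym v (a * a') b = hilbertSym v a b * hilbertSym v a' b := by
  rcases eq_or_ne v 0 with rfl | h0
  · simp only [hilbertSym_zero, mul_neg_iff]
    rcases ha.lt_or_gt with h | h <;> rcases ha'.lt_or_gt with h' | h' <;>
      rcases hb.lt_or_gt with h'' | h'' <;> simp [h, h', h'', h.not_gt, h'.not_gt, h''.not_gt]
  by_cases hv : v.Prime
  · obtain ⟨α, u, hu, rfl⟩ := exists_eq_pow_mul hv ha
    obtain ⟨α', u', hu', rfl⟩ := exists_eq_pow_mul hv ha'
    obtain ⟨β, w, hw, rfl⟩ := exists_eq_pow_mul hv hb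
    rw [show (v : ℤ) ^ α * u * (v ^ α' * u') = v ^ (α + α') * (u * u') by ring,
      hilbertSym_eval hv _ _ (not_dvd_mul hv hu hu') hw, hilbertSym_eval hv _ _ hu hw,
      hilbertSym_eval hv _ _ hu' hw, unitPairing_mul hu hu', unitChar_mul]
    ring
  · simp [hilbertSym_of_not_place h0 hv]

theorem hilbertSym_mul_right (v : ℕ) {a b b' : ℤ} (ha : a ≠ 0) (hb : b ≠ 0) (hb' : b' ≠ 0) :
    hilbertSym v a (b * b') = hilbertSym v a b * hilbertSym v a b' := by
  rw [hilbertSym_comm, hilbertSym_mul_left v hb hb' ha, hilbertSym_comm v b, hilbertSym_comm v b']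

theorem hilbertSym_sq (v : ℕ) {a b : ℤ} (ha : a ≠ 0) (hb : b ≠ 0) : hilbertSym v a b ^ 2 = 1 := by
  rcases eq_or_ne v 0 with rfl | h0
  · rw [hilbertSym_zero]; split_ifs <;> norm_num
  by_cases hv : v.Prime
  · obtain ⟨α, u, hu, rfl⟩ := exists_eq_pow_mul hv ha
    obtain ⟨β, w, hw, rfl⟩ := exists_eq_pow_mul hv hb
    rw [hilbertSym_eval hv _ _ hu hw]
    simp only [mul_pow, ← pow_mul]
    simp only [mul_comm _ 2, pow_mul, unitPairing_sq, unitChar_sq hv hu, unitChar_sq hv hw,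
      unitChar_sq hv (not_dvd_neg_one hv), one_pow, one_mul]
  · simp [hilbertSym_of_not_place h0 hv]

theorem hilbertSym_eq (v : ℕ) {a b : ℤ} (ha : a ≠ 0) (hb : b ≠ 0) :
    hilbertSym v a b = 1 ∨ hilbertSym v a b = -1 := by
  rw [← mul_self_eq_one_iff, ← sq, hilbertSym_sq v ha hb]

theorem hilbertSym_mul_self (v : ℕ) {a b : ℤ} (ha : a ≠ 0) (hb : b ≠ 0) :
    hilbertSym v a b * hilbertSym v a b = 1 := by rw [← sq, hilbertSym_sq v ha hb]

theorem hilbertSym_sq_left (v : ℕ) {c b : ℤ} (hc : c ≠ 0) (hb : b ≠ 0) :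
    hilbertSym v (c ^ 2) b = 1 := by
  rw [sq, hilbertSym_mul_left v hc hc hb, hilbertSym_mul_self v hc hb]

theorem hilbertSym_mul_sq_left (v : ℕ) {a b c : ℤ} (ha : a ≠ 0) (hb : b ≠ 0) (hc : c ≠ 0) :
    hilbertSym v (a * c ^ 2) b = hilbertSym v a b := by
  rw [hilbertSym_mul_left v ha (pow_ne_zero _ hc) hb, hilbertSym_sq_left v hc hb, mul_one]

/-- At an odd prime two units pair trivially. -/
theorem hilbertSym_unit {p : ℕ} (hp2 : p ≠ 2) {a b : ℤ} (h0 : p ≠ 0) (ha : ¬ (p : ℤ) ∣ a)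
    (hb : ¬ (p : ℤ) ∣ b) : hilbertSym p a b = 1 := by
  by_cases hp : p.Prime
  · have := hilbertSym_eval hp 0 0 ha hb
    simpa [unitPairing, hp2] using this
  · exact hilbertSym_of_not_place h0 hp a b

theorem hilbertSym_congr {p : ℕ} (hp : p.Prime) {α : ℕ} {u u' : ℤ} (hu : ¬ (p : ℤ) ∣ u)
    (h : (p : ℤ) ^ 3 ∣ u - u') {b : ℤ} (hb : b ≠ 0) :
    hilbertSym p (p ^ α * u) b = hilbertSym p (p ^ α * u') b := by
  have hu' : ¬ (p : ℤ) ∣ u' := fun h' => hu <| by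
    simpa using dvd_add ((dvd_pow_self _ (by norm_num)).trans h) h'
  obtain ⟨β, w, hw, rfl⟩ := exists_eq_pow_mul hp hb
  rw [hilbertSym_eval hp _ _ hu hw, hilbertSym_eval hp _ _ hu' hw, unitPairing_congr w h,
    unitChar_congr h]

theorem hilbertSym_mulSupport_subset {a b : ℤ} (ha : a ≠ 0) (hb : b ≠ 0) :
    (Function.mulSupport fun v => hilbertSym v a b) ⊆
      ((insert 0 (insert 2 (a * b).natAbs.primeFactors) : Finset ℕ) : Set ℕ) := by
  intro v hv
  rw [Function.mem_mulSupport] at hv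
  by_contra h
  simp only [Finset.coe_insert, Set.mem_insert_iff, Finset.mem_coe, Nat.mem_primeFactors,
    not_or] at h
  obtain ⟨h0, h2, h⟩ := h
  by_cases hp : v.Prime
  · have hd : ¬ (v : ℤ) ∣ a * b := fun h' => h ⟨hp, Int.natCast_dvd.mp h', by simp [ha, hb]⟩
    exact hv (hilbertSym_unit h2 h0 (fun h' => hd (h'.mul_right _)) fun h' => hd (h'.mul_left _))
  · exact hv (hilbertSym_of_not_place h0 hp a b)

theorem hilbertSym_finite {a b : ℤ} (ha : a ≠ 0) (hb : b ≠ 0) :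
    (Function.mulSupport fun v => hilbertSym v a b).Finite :=
  (Finset.finite_toSet _).subset (hilbertSym_mulSupport_subset ha hb)

theorem finprod_hilbertSym_mul {a a' b : ℤ} (ha : a ≠ 0) (ha' : a' ≠ 0) (hb : b ≠ 0) :
    ∏ᶠ v, hilbertSym v (a * a') b = (∏ᶠ v, hilbertSym v a b) * ∏ᶠ v, hilbertSym v a' b := by
  rw [← finprod_mul_distrib (hilbertSym_finite ha hb) (hilbertSym_finite ha' hb)]
  exact finprod_congr fun v => hilbertSym_mul_left v ha ha' hb

/-- `-1` and the primes generate the nonzero integers. -/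
theorem int_induction_on_primes {P : ℤ → Prop} (h1 : P 1) (hneg : P (-1))
    (hp : ∀ p : ℕ, p.Prime → P p) (hmul : ∀ a b, a ≠ 0 → b ≠ 0 → P a → P b → P (a * b))
    {a : ℤ} (ha : a ≠ 0) : P a := by
  have key : ∀ n : ℕ, n ≠ 0 → P n := by
    intro n
    induction n using induction_on_primes with
    | zero => intro h; exact absurd rfl h
    | one => intro _; exact_mod_cast h1
    | prime_mul p n hpp ih =>
      intro h
      have hn : n ≠ 0 := by rintro rfl; simp at h
      push_cast
      exact hmul _ _ (by exact_mod_cast hpp.ne_zero) (by exact_mod_cast hn) (hp p hpp) (ih hn)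
  rcases Int.natAbs_eq a with h | h <;> rw [h]
  · exact key _ (Int.natAbs_ne_zero.mpr ha)
  · rw [← neg_one_mul]
    exact hmul _ _ (by norm_num) (by simpa using ha) hneg (key _ (Int.natAbs_ne_zero.mpr ha))

theorem finprod_hilbertSym_eq_prod {a b : ℤ} (T : Finset ℕ)
    (hT : ∀ v, v ∉ T → hilbertSym v a b = 1) :
    ∏ᶠ v, hilbertSym v a b = ∏ v ∈ T, hilbertSym v a b :=
  finprod_eq_prod_of_mulSupport_subset _ fun v hv => by
    by_contra h; exact hv (hT v h)

theorem hilbertSym_prime {p : ℕ} (hp : p.Prime) {u w : ℤ} (hu : ¬ (p : ℤ) ∣ u) (β : ℕ)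
    (hw : ¬ (p : ℤ) ∣ w) : hilbertSym p u (p ^ β * w) = unitPairing p u w * unitChar p u ^ β := by
  simpa using hilbertSym_eval hp 0 β hu hw

theorem hilbertSym_prime_left {p : ℕ} (hp : p.Prime) {u : ℤ} (hu : ¬ (p : ℤ) ∣ u) :
    hilbertSym p u p = unitChar p u := by
  have h1 : ¬ (p : ℤ) ∣ 1 := by exact_mod_cast fun h => hp.one_lt.ne' (Nat.dvd_one.mp h)
  have := hilbertSym_prime hp hu 1 h1
  simpa [unitPairing] using this

theorem hilbertSym_two_units {u w : ℤ} (hu : ¬ (2 : ℤ) ∣ u) (hw : ¬ (2 : ℤ) ∣ w) :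
    hilbertSym 2 u w = if u % 4 = 3 ∧ w % 4 = 3 then -1 else 1 := by
  have := hilbertSym_eval Nat.prime_two 0 0 hu hw
  simpa [unitPairing] using this

theorem finprod_hilbertSym_neg_one_neg_one : ∏ᶠ v, hilbertSym v (-1) (-1) = 1 := by
  rw [finprod_hilbertSym_eq_prod {0, 2}]
  · rw [Finset.prod_pair (by norm_num), hilbertSym_zero,
      hilbertSym_two_units (by norm_num) (by norm_num)]
    norm_num
  · intro v hv
    simp only [Finset.mem_insert, Finset.mem_singleton, not_or] at hv
    by_cases hp : v.Prime
    · exact hilbertSym_unit hv.2 hv.1 (not_dvd_neg_one hp) (not_dvd_neg_one hp)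
    · exact hilbertSym_of_not_place hv.1 hp _ _

theorem not_dvd_prime {p q : ℕ} (hp : p.Prime) (hq : q.Prime) (h : p ≠ q) : ¬ (p : ℤ) ∣ q := by
  exact_mod_cast fun h' => h ((Nat.prime_dvd_prime_iff_eq hp hq).mp h')

theorem finprod_hilbertSym_neg_one_prime {p : ℕ} (hp : p.Prime) :
    ∏ᶠ v, hilbertSym v (-1) p = 1 := by
  have hp0 : (p : ℤ) ≠ 0 := by exact_mod_cast hp.ne_zero
  have hout : ∀ v, v ∉ ({2, p} : Finset ℕ) → hilbertSym v (-1) p = 1 := by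
    intro v hv
    simp only [Finset.mem_insert, Finset.mem_singleton, not_or] at hv
    rcases eq_or_ne v 0 with rfl | h0
    · rw [hilbertSym_zero, if_neg]
      rintro ⟨-, h⟩
      linarith [Int.natCast_nonneg p]
    · by_cases hv' : v.Prime
      · exact hilbertSym_unit hv.1 h0 (not_dvd_neg_one hv') (not_dvd_prime hv' hp hv.2)
      · exact hilbertSym_of_not_place h0 hv' _ _
  rw [finprod_hilbertSym_eq_prod _ hout]
  rcases eq_or_ne p 2 with rfl | h2
  · rw [Finset.pair_eq_singleton, Finset.prod_singleton,
      hilbertSym_prime_left hp (not_dvd_neg_one hp), unitChar, if_pos rfl]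
    decide
  · have hodd : Odd p := hp.odd_of_ne_two h2
    rw [Finset.prod_pair h2.symm, hilbertSym_prime_left hp (not_dvd_neg_one hp), unitChar,
      if_neg h2, hilbertSym_two_units (by norm_num) (not_dvd_prime Nat.prime_two hp h2.symm),
      jacobiSym.at_neg_one hodd]
    rcases Nat.odd_mod_four_iff.mp (Nat.odd_iff.mp hodd) with h | h
    · rw [ZMod.χ₄_nat_one_mod_four h, if_neg (by omega)]; norm_num
    · rw [ZMod.χ₄_nat_three_mod_four h, if_pos (by omega)]; norm_num

theorem hilbertSym_neg_self (v : ℕ) {a : ℤ} (ha : a ≠ 0) : hilbertSym v a (-a) = 1 := by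
  rcases eq_or_ne v 0 with rfl | h0
  · rw [hilbertSym_zero, if_neg]; omega
  by_cases hv : v.Prime
  · obtain ⟨α, u, hu, rfl⟩ := exists_eq_pow_mul hv ha
    have hu' : ¬ (v : ℤ) ∣ -u := by rwa [dvd_neg]
    have h1 : unitPairing v u (-u) = 1 := by
      rw [unitPairing, if_neg]; omega
    rw [← mul_neg, hilbertSym_eval hv _ _ hu hu', h1, pow_mul, ← neg_one_mul u, unitChar_mul]
    have e1 := unitChar_eq hv (not_dvd_neg_one hv)
    have e2 := unitChar_eq hv hu
    rcases Nat.even_or_odd α with h | h <;> rcases e1 with e1 | e1 <;> rcases e2 with e2 | e2 <;>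
      rw [e1, e2] <;> simp [h.neg_one_pow]
  · exact hilbertSym_of_not_place h0 hv _ _

theorem hilbertSym_self (v : ℕ) {a : ℤ} (ha : a ≠ 0) :
    hilbertSym v a a = hilbertSym v (-1) a := by
  have h := hilbertSym_neg_self v ha
  rw [← neg_one_mul, hilbertSym_mul_right v ha (by norm_num) ha] at h
  have h' := hilbertSym_mul_self v (a := -1) (by norm_num) ha
  rw [hilbertSym_comm v a (-1)] at h
  linear_combination hilbertSym v (-1) a * h - hilbertSym v a a * h'

theorem finprod_hilbertSym_two_prime {q : ℕ} (hq : q.Prime) (hq2 : q ≠ 2) :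
    ∏ᶠ v, hilbertSym v (2 : ℕ) q = 1 := by
  have hodd : Odd q := hq.odd_of_ne_two hq2
  have hq0 : (q : ℤ) ≠ 0 := by exact_mod_cast hq.ne_zero
  rw [finprod_hilbertSym_eq_prod {2, q}]
  · rw [Finset.prod_pair hq2.symm, hilbertSym_prime_left hq (not_dvd_prime hq Nat.prime_two hq2),
      hilbertSym_comm 2, hilbertSym_prime_left Nat.prime_two
      (not_dvd_prime Nat.prime_two hq hq2.symm), unitChar, unitChar, if_pos rfl, if_neg hq2]
    have := jacobiSym.at_two hodd
    push_cast
    rw [this, ← sq]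
    have := unitChar_sq Nat.prime_two (not_dvd_prime Nat.prime_two hq hq2.symm)
    rw [unitChar, if_pos rfl] at this
    exact_mod_cast this
  · intro v hv
    simp only [Finset.mem_insert, Finset.mem_singleton, not_or] at hv
    rcases eq_or_ne v 0 with rfl | h0
    · rw [hilbertSym_zero, if_neg]; norm_num
    · by_cases hv' : v.Prime
      · exact hilbertSym_unit hv.1 h0 (not_dvd_prime hv' Nat.prime_two hv.1)
          (not_dvd_prime hv' hq hv.2)
      · exact hilbertSym_of_not_place h0 hv' _ _

theorem finprod_hilbertSym_odd_primes {p q : ℕ} (hp : p.Prime) (hq : q.Prime) (hp2 : p ≠ 2)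
    (hq2 : q ≠ 2) (hpq : p ≠ q) : ∏ᶠ v, hilbertSym v p q = 1 := by
  have hpo : Odd p := hp.odd_of_ne_two hp2
  have hqo : Odd q := hq.odd_of_ne_two hq2
  have hq0 : (q : ℤ) ≠ 0 := by exact_mod_cast hq.ne_zero
  have hp0 : (p : ℤ) ≠ 0 := by exact_mod_cast hp.ne_zero
  have hpq' := not_dvd_prime hp hq hpq
  have hqp' := not_dvd_prime hq hp hpq.symm
  rw [finprod_hilbertSym_eq_prod {2, p, q}]
  · rw [Finset.prod_insert (by simp [hp2.symm, hq2.symm]), Finset.prod_pair hpq,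
      hilbertSym_prime_left hq hqp',
      hilbertSym_comm p, hilbertSym_prime_left hp hpq', unitChar, unitChar, if_neg hp2, if_neg hq2,
      hilbertSym_two_units (not_dvd_prime Nat.prime_two hp hp2.symm)
        (not_dvd_prime Nat.prime_two hq hq2.symm)]
    have hsq := unitChar_sq hp hpq'
    rw [unitChar, if_neg hp2] at hsq
    have hr := jacobiSym.quadratic_reciprocity_if (Nat.odd_iff.mp hpo) (Nat.odd_iff.mp hqo)
    rw [← hr]
    have : (((p : ℤ) % 4 = 3 ∧ (q : ℤ) % 4 = 3)) ↔ (p % 4 = 3 ∧ q % 4 = 3) := by omega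
    simp only [this]
    split_ifs <;> linear_combination hsq
  · intro v hv
    simp only [Finset.mem_insert, Finset.mem_singleton, not_or] at hv
    rcases eq_or_ne v 0 with rfl | h0
    · rw [hilbertSym_zero, if_neg]; omega
    · by_cases hv' : v.Prime
      · exact hilbertSym_unit hv.1 h0 (not_dvd_prime hv' hp hv.2.1)
          (not_dvd_prime hv' hq hv.2.2)
      · exact hilbertSym_of_not_place h0 hv' _ _

theorem finprod_hilbertSym_primes {p q : ℕ} (hp : p.Prime) (hq : q.Prime) :
    ∏ᶠ v, hilbertSym v p q = 1 := by
  rcases eq_or_ne p q with rfl | hpq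
  · rw [finprod_congr fun v => hilbertSym_self v (by exact_mod_cast hp.ne_zero)]
    exact finprod_hilbertSym_neg_one_prime hp
  rcases eq_or_ne p 2 with rfl | hp2
  · exact finprod_hilbertSym_two_prime hq hpq.symm
  rcases eq_or_ne q 2 with rfl | hq2
  · rw [finprod_congr fun v => hilbertSym_comm v _ _]
    exact finprod_hilbertSym_two_prime hp hpq
  exact finprod_hilbertSym_odd_primes hp hq hp2 hq2 hpq

/-- **Hilbert reciprocity.** -/
theorem finprod_hilbertSym {a b : ℤ} (ha : a ≠ 0) (hb : b ≠ 0) : ∏ᶠ v, hilbertSym v a b = 1 := by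
  have h1 : ∀ v : ℕ, ∀ c : ℤ, c ≠ 0 → hilbertSym v 1 c = 1 := fun v c hc => by
    simpa using hilbertSym_sq_left v (c := 1) (by norm_num) hc
  have hcomm : ∀ a b : ℤ, ∏ᶠ v, hilbertSym v a b = ∏ᶠ v, hilbertSym v b a :=
    fun a b => finprod_congr fun v => hilbertSym_comm v a b
  have hgen : ∀ c : ℤ, c ≠ 0 → ∏ᶠ v, hilbertSym v (-1) c = 1 := by
    intro c hc
    rw [hcomm]
    refine int_induction_on_primes (P := fun c => ∏ᶠ v, hilbertSym v c (-1) = 1) ?_ ?_ ?_ ?_ hc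
    · rw [finprod_congr fun v => h1 v _ (by norm_num), finprod_one]
    · exact finprod_hilbertSym_neg_one_neg_one
    · intro p hp
      rw [hcomm]; exact finprod_hilbertSym_neg_one_prime hp
    · intro a b ha hb iha ihb
      rw [finprod_hilbertSym_mul ha hb (by norm_num), iha, ihb, one_mul]
  refine int_induction_on_primes (P := fun a => ∏ᶠ v, hilbertSym v a b = 1) ?_ (hgen b hb) ?_ ?_ ha
  · rw [finprod_congr fun v => h1 v _ hb, finprod_one]
  · intro p hp
    have hp0 : (p : ℤ) ≠ 0 := by exact_mod_cast hp.ne_zero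
    rw [hcomm]
    refine int_induction_on_primes (P := fun b => ∏ᶠ v, hilbertSym v b p = 1) ?_ (hgen _ hp0) ?_ ?_
      hb
    · rw [finprod_congr fun v => h1 v _ hp0, finprod_one]
    · exact fun q hq => finprod_hilbertSym_primes hq hp
    · intro a b ha hb iha ihb
      rw [finprod_hilbertSym_mul ha hb hp0, iha, ihb, one_mul]
  · intro a a' ha ha' iha ihb
    rw [finprod_hilbertSym_mul ha ha' hb, iha, ihb, one_mul]

theorem prod_hilbertSym {a b : ℤ} (ha : a ≠ 0) (hb : b ≠ 0) {T : Finset ℕ}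
    (hT : ∀ v, v ∉ T → hilbertSym v a b = 1) : ∏ v ∈ T, hilbertSym v a b = 1 := by
  rw [← finprod_hilbertSym_eq_prod T hT, finprod_hilbertSym ha hb]

/-- A Hilbert symbol that is trivial at all places but one is trivial there as well. -/
theorem hilbertSym_eq_one_of_ne {a b : ℤ} (ha : a ≠ 0) (hb : b ≠ 0) (w : ℕ)
    (h : ∀ v, v ≠ w → hilbertSym v a b = 1) (v : ℕ) : hilbertSym v a b = 1 := by
  rcases eq_or_ne v w with rfl | hv
  · have := prod_hilbertSym ha hb (T := {v}) fun u hu => h u (by simpa using hu)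
    simpa using this
  · exact h v hv

theorem unitChar_congr_odd {p : ℕ} (hp2 : p ≠ 2) {u w : ℤ} (h : (p : ℤ) ∣ u - w) :
    unitChar p u = unitChar p w := by
  unfold unitChar
  rw [if_neg hp2, if_neg hp2]
  exact jacobiSym.mod_left' (Int.ModEq.symm (Int.modEq_iff_dvd.mpr h))

theorem unitChar_mul_self {p : ℕ} (hp : p.Prime) {c : ℤ} (hc : ¬ (p : ℤ) ∣ c) :
    unitChar p (c ^ 2) = 1 := by
  rw [sq, unitChar_mul, ← sq, unitChar_sq hp hc]

theorem hilbertSym_odd {p : ℕ} (hp : p.Prime) (hp2 : p ≠ 2) (α β : ℕ) {u w : ℤ}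
    (hu : ¬ (p : ℤ) ∣ u) (hw : ¬ (p : ℤ) ∣ w) :
    hilbertSym p (p ^ α * u) (p ^ β * w) =
      unitChar p (-1) ^ (α * β) * unitChar p u ^ β * unitChar p w ^ α := by
  rw [hilbertSym_eval hp α β hu hw, unitPairing, if_neg (by tauto), one_mul]

theorem unitChar_pow_even {p : ℕ} (hp : p.Prime) {c : ℤ} (hc : ¬ (p : ℤ) ∣ c) {n : ℕ}
    (hn : Even n) : unitChar p c ^ n = 1 := by
  obtain ⟨k, rfl⟩ := hn
  rw [← two_mul, pow_mul, unitChar_sq hp hc, one_pow]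

theorem eq_of_pow_mul_eq {p : ℕ} (hp : p.Prime) {α β : ℕ} {u w : ℤ} (hu : ¬ (p : ℤ) ∣ u)
    (hw : ¬ (p : ℤ) ∣ w) (h : (p : ℤ) ^ α * u = p ^ β * w) : α = β ∧ u = w := by
  have h1 : α = β := by
    rw [← padicValInt_pow_mul hp α hu, h, padicValInt_pow_mul hp β hw]
  subst h1
  exact ⟨rfl, mul_left_cancel₀ (pow_ne_zero _ (by exact_mod_cast hp.ne_zero)) h⟩

theorem hilbertSym_odd_of_add_eq_sq {p : ℕ} (hp : p.Prime) (hp2 : p ≠ 2) {A B C : ℤ} (hA : A ≠ 0)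
    (hB : B ≠ 0) (hC : C ≠ 0) (h : A + B = C ^ 2) : hilbertSym p A B = 1 := by
  obtain ⟨α, u, hu, rfl⟩ := exists_eq_pow_mul hp hA
  obtain ⟨β, w, hw, rfl⟩ := exists_eq_pow_mul hp hB
  obtain ⟨γ, c, hc, rfl⟩ := exists_eq_pow_mul hp hC
  have hc2 : ¬ (p : ℤ) ∣ c ^ 2 := by rw [sq]; exact not_dvd_mul hp hc hc
  wlog hαβ : α ≤ β generalizing α β u w
  · rw [hilbertSym_comm]
    exact this β w hw hB α u hu hA (by rw [← h]; ring) (by omega)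
  obtain ⟨k, rfl⟩ := Nat.exists_eq_add_of_le hαβ
  have h' : (p : ℤ) ^ α * (u + p ^ k * w) = p ^ (2 * γ) * c ^ 2 := by
    linear_combination h
  rw [hilbertSym_odd hp hp2 _ _ hu hw]
  rcases Nat.eq_zero_or_pos k with rfl | hk
  · rw [pow_zero, one_mul] at h'
    rw [add_zero]
    rcases Nat.even_or_odd α with he | ho
    · rw [unitChar_pow_even hp hu he, unitChar_pow_even hp hw he,
        unitChar_pow_even hp (not_dvd_neg_one hp) (he.mul_left _)]
      norm_num
    · have hd : (p : ℤ) ∣ w - (-u) := by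
        by_contra hd
        rw [sub_neg_eq_add, add_comm] at hd
        have := (eq_of_pow_mul_eq hp hd hc2 h').1
        rw [this] at ho
        exact (Nat.not_odd_iff_even.mpr (even_two_mul γ)) ho
      rw [unitChar_congr_odd hp2 hd, pow_mul, ← mul_pow, ← mul_pow]
      have h1 : ((unitChar p (-1)) ^ α) = unitChar p (-1) := by
        obtain ⟨j, rfl⟩ := ho
        rw [pow_succ, unitChar_pow_even hp (not_dvd_neg_one hp) (even_two_mul j), one_mul]
      rw [h1, ← unitChar_mul, ← unitChar_mul, show -1 * u * -u = u ^ 2 by ring,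
        unitChar_mul_self hp hu, one_pow]
  · have hd : ¬ (p : ℤ) ∣ u + p ^ k * w := fun h1 => hu <|
      (dvd_add_left ((dvd_pow_self _ hk.ne').mul_right w)).mp h1
    obtain ⟨rfl, h2⟩ := eq_of_pow_mul_eq hp hd hc2 h'
    have h3 : unitChar p u = 1 := by
      rw [unitChar_congr_odd hp2 (w := c ^ 2), unitChar_mul_self hp hc]
      rw [← h2]
      simpa using (dvd_pow_self (p : ℤ) hk.ne').mul_right w
    rw [h3, one_pow, unitChar_pow_even hp hw (even_two_mul γ), mul_assoc,
      unitChar_pow_even hp (not_dvd_neg_one hp) ((even_two_mul γ).mul_right _)]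
    norm_num

theorem hilbertSym_of_add_eq_sq {A B C : ℤ} (hA : A ≠ 0) (hB : B ≠ 0) (h : A + B = C ^ 2) (v : ℕ) :
    hilbertSym v A B = 1 := by
  rcases eq_or_ne C 0 with rfl | hC
  · have : B = -A := by linear_combination h
    rw [this]; exact hilbertSym_neg_self v hA
  refine hilbertSym_eq_one_of_ne hA hB 2 (fun v hv => ?_) v
  rcases eq_or_ne v 0 with rfl | h0
  · rw [hilbertSym_zero, if_neg]
    rintro ⟨h1, h2⟩
    nlinarith [sq_nonneg C]
  · by_cases hp : v.Prime
    · exact hilbertSym_odd_of_add_eq_sq hp hv hA hB hC h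
    · exact hilbertSym_of_not_place h0 hp _ _

/-- If `a X² + b Y² = Z²` has a nontrivial solution then the symbol of `a` and `b` is trivial. -/
theorem hilbertSym_of_form {a b X Y Z : ℤ} (ha : a ≠ 0) (hb : b ≠ 0)
    (hXY : X ≠ 0 ∨ Y ≠ 0) (h : a * X ^ 2 + b * Y ^ 2 = Z ^ 2) (v : ℕ) : hilbertSym v a b = 1 := by
  rcases eq_or_ne X 0 with rfl | hX
  · have hY : Y ≠ 0 := by tauto
    have hZ : Z ≠ 0 := by
      rintro rfl
      simp_all
    rw [hilbertSym_comm, ← hilbertSym_mul_sq_left v hb ha hY,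
      show b * Y ^ 2 = Z ^ 2 by linear_combination h, hilbertSym_sq_left v hZ ha]
  rcases eq_or_ne Y 0 with rfl | hY
  · have hZ : Z ≠ 0 := by
      rintro rfl
      simp_all
    rw [← hilbertSym_mul_sq_left v ha hb hX,
      show a * X ^ 2 = Z ^ 2 by linear_combination h, hilbertSym_sq_left v hZ hb]
  rw [← hilbertSym_mul_sq_left v ha hb hX, hilbertSym_comm,
    ← hilbertSym_mul_sq_left v hb (mul_ne_zero ha (pow_ne_zero _ hX)) hY, hilbertSym_comm]
  exact hilbertSym_of_add_eq_sq (by positivity) (by positivity) h v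

/-- Norms from `ℚ(√a)` are orthogonal to `a`. -/
theorem hilbertSym_of_norm {x a u w : ℤ} (hx : x ≠ 0) (ha : a ≠ 0) (h : x = u ^ 2 - a * w ^ 2)
    (v : ℕ) : hilbertSym v x a = 1 :=
  hilbertSym_of_form (X := 1) (Y := w) (Z := u) hx ha (by norm_num) (by rw [h]; ring) v

theorem isSquare_zmod_of_forall_prime {b : ℕ} (hb : Squarefree b) (a : ℤ)
    (h : ∀ p : ℕ, p.Prime → p ∣ b → IsSquare (a : ZMod p)) : IsSquare (a : ZMod b) := by
  induction b using induction_on_primes with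
  | zero => simp at hb
  | one => exact ⟨0, Subsingleton.elim _ _⟩
  | prime_mul p n hp ih =>
    have hc : p.Coprime n := Nat.coprime_of_squarefree_mul hb
    obtain ⟨r, hr⟩ := h p hp (dvd_mul_right _ _)
    obtain ⟨s, hs⟩ := ih (hb.of_mul_right) fun q hq hqn => h q hq (hqn.mul_left p)
    refine ⟨(ZMod.chineseRemainder hc).symm (r, s), ?_⟩
    apply (ZMod.chineseRemainder hc).injective
    rw [map_mul, RingEquiv.apply_symm_apply, map_intCast, Prod.mk_mul_mk, ← hr, ← hs]
    rfl

theorem exists_sq_sub_eq_mul {a b : ℤ} (hb : Squarefree b)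
    (h : ∀ p : ℕ, p.Prime → (p : ℤ) ∣ b → IsSquare (a : ZMod p)) :
    ∃ t b' : ℤ, 2 * |t| ≤ |b| ∧ t ^ 2 - a = b * b' := by
  have hb0 : b ≠ 0 := hb.ne_zero
  have : NeZero b.natAbs := ⟨Int.natAbs_ne_zero.mpr hb0⟩
  obtain ⟨r, hr⟩ := isSquare_zmod_of_forall_prime (Int.squarefree_natAbs.mpr hb) a
    fun p hp hpb => h p hp (Int.natCast_dvd.mpr hpb)
  refine ⟨r.valMinAbs, ?_⟩
  have h1 : b ∣ r.valMinAbs ^ 2 - a := by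
    rw [← Int.natAbs_dvd, ← ZMod.intCast_zmod_eq_zero_iff_dvd]
    push_cast
    rw [hr]; ring
  obtain ⟨b', hb'⟩ := h1
  refine ⟨b', ?_, hb'⟩
  have := ZMod.natAbs_valMinAbs_le r
  rw [Int.abs_eq_natAbs, Int.abs_eq_natAbs]
  omega

theorem isSquare_zmod_of_hilbertSym {a b : ℤ} (hb : Squarefree b) {p : ℕ} (hp : p.Prime)
    (hpb : (p : ℤ) ∣ b) (h : hilbertSym p a b = 1) : IsSquare (a : ZMod p) := by
  rcases eq_or_ne p 2 with rfl | hp2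
  · generalize (a : ZMod 2) = c
    revert c; decide
  by_cases hpa : (p : ℤ) ∣ a
  · rw [(ZMod.intCast_zmod_eq_zero_iff_dvd a p).mpr hpa]
    exact ⟨0, by ring⟩
  obtain ⟨w, rfl⟩ := hpb
  have hw : ¬ (p : ℤ) ∣ w := by
    rintro ⟨w', rfl⟩
    exact (Nat.prime_iff_prime_int.mp hp).not_isUnit (hb p ⟨w', by ring⟩)
  have h1 := hilbertSym_odd hp hp2 0 1 hpa hw
  simp only [pow_zero, one_mul, pow_one, mul_one] at h1
  rw [h1, unitChar, if_neg hp2] at h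
  have := Fact.mk hp
  exact ZMod.isSquare_of_jacobiSym_eq_one h

/-- **Legendre's theorem**: a binary form `a X² + b Y²` all of whose Hilbert symbols are trivial
represents a square. -/
theorem exists_form_of_hilbertSym {a b : ℤ} (ha : a ≠ 0) (hb : b ≠ 0)
    (h : ∀ v, hilbertSym v a b = 1) :
    ∃ X Y Z : ℤ, (X ≠ 0 ∨ Y ≠ 0) ∧ a * X ^ 2 + b * Y ^ 2 = Z ^ 2 := by
  induction hn : a.natAbs + b.natAbs using Nat.strong_induction_on generalizing a b with
  | _ n ih =>
  subst hn
  wlog hab : a.natAbs ≤ b.natAbs generalizing a b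
  · obtain ⟨X, Y, Z, h0, h1⟩ := this hb ha (fun v => by rw [hilbertSym_comm, h v])
      (fun m hm a' b' ha' hb' h' hm' => ih m (by omega) ha' hb' h' hm') (by omega)
    exact ⟨Y, X, Z, h0.symm, by rw [← h1]; ring⟩
  by_cases hsq : Squarefree b
  swap
  · obtain ⟨c, hcb, hc⟩ : ∃ c, c * c ∣ b ∧ ¬ IsUnit c := by
      simpa [Squarefree] using hsq
    obtain ⟨b', rfl⟩ := hcb
    have hc0 : c ≠ 0 := by rintro rfl; simp at hb
    have hb' : b' ≠ 0 := by rintro rfl; simp at hb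
    have hlt : b'.natAbs < (c * c * b').natAbs := by
      rw [Int.natAbs_mul, Int.natAbs_mul]
      have h1 : 2 ≤ c.natAbs := by
        have : c.natAbs ≠ 1 := fun h => hc (Int.isUnit_iff_natAbs_eq.mpr h)
        have : c.natAbs ≠ 0 := Int.natAbs_ne_zero.mpr hc0
        omega
      have : 0 < b'.natAbs := Int.natAbs_pos.mpr hb'
      nlinarith [Nat.mul_le_mul h1 h1]
    obtain ⟨X, Y, Z, h0, h1⟩ := ih _ (by omega) ha hb' (fun v => by
      rw [← h v, hilbertSym_comm, hilbertSym_comm v a, ← hilbertSym_mul_sq_left v hb' ha hc0]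
      congr 1; ring) rfl
    refine ⟨c * X, Y, c * Z, ?_, ?_⟩
    · rcases h0 with h0 | h0
      · exact Or.inl (mul_ne_zero hc0 h0)
      · exact Or.inr h0
    · linear_combination c ^ 2 * h1
  rcases Nat.lt_or_ge b.natAbs 2 with hb1 | hb2
  · have hb' : b = 1 ∨ b = -1 := by omega
    have ha' : a = 1 ∨ a = -1 := by omega
    rcases ha' with rfl | rfl
    · exact ⟨1, 0, 1, by norm_num⟩
    rcases hb' with rfl | rfl
    · exact ⟨0, 1, 1, by norm_num⟩
    have := h 0
    rw [hilbertSym_zero] at this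
    norm_num at this
  obtain ⟨t, b', ht, hb'⟩ := exists_sq_sub_eq_mul hsq fun p hp hpb =>
    isSquare_zmod_of_hilbertSym hsq hp hpb (h p)
  rcases eq_or_ne b' 0 with rfl | hb0
  · exact ⟨1, 0, t, by norm_num, by linear_combination -hb'⟩
  have hlt : b'.natAbs < b.natAbs := by
    zify
    have hB : (2 : ℤ) ≤ |b| := by rw [Int.abs_eq_natAbs]; exact_mod_cast hb2
    have hA : |a| ≤ |b| := by rw [Int.abs_eq_natAbs, Int.abs_eq_natAbs]; exact_mod_cast hab
    have h1 : |b| * |b'| ≤ |t| ^ 2 + |a| := by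
      rw [← abs_mul, ← hb', sq_abs]
      calc |t ^ 2 - a| ≤ |t ^ 2| + |a| := abs_sub _ _
        _ = t ^ 2 + |a| := by rw [abs_of_nonneg (sq_nonneg t)]
    by_contra hge
    push Not at hge
    nlinarith [abs_nonneg t, abs_nonneg b, mul_le_mul_of_nonneg_left hge (abs_nonneg b)]
  obtain ⟨X, Y, Z, h0, h1⟩ := ih _ (by omega) ha hb0 (fun v => by
    have h2 : hilbertSym v (b * b') a = 1 :=
      hilbertSym_of_norm (u := t) (w := 1) (mul_ne_zero hb hb0) ha (by rw [← hb']; ring) v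
    rw [hilbertSym_mul_left v hb hb0 ha, hilbertSym_comm, h v, one_mul] at h2
    rw [hilbertSym_comm, h2]) rfl
  rcases eq_or_ne Y 0 with rfl | hY
  · exact ⟨X, 0, Z, h0, by linear_combination h1⟩
  · exact ⟨t * X + Z, b' * Y, t * Z + a * X, Or.inr (mul_ne_zero hb0 hY), by
      linear_combination b * b' * h1 - (Z ^ 2 - a * X ^ 2) * hb'⟩

/-- An integer all of whose Hilbert symbols with a nonsquare `a` are trivial is a norm from
`ℚ(√a)`. -/
theorem exists_norm_of_hilbertSym {x a : ℤ} (hx : x ≠ 0) (ha : ¬ IsSquare a)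
    (h : ∀ v, hilbertSym v x a = 1) : ∃ u w : ℚ, (x : ℚ) = u ^ 2 - a * w ^ 2 := by
  have ha0 : a ≠ 0 := by rintro rfl; exact ha ⟨0, by ring⟩
  obtain ⟨X, Y, Z, h0, h1⟩ := exists_form_of_hilbertSym hx ha0 h
  have hX : X ≠ 0 := by
    rintro rfl
    have hY : Y ≠ 0 := by tauto
    have h2 : Y ^ 2 ∣ Z ^ 2 := ⟨a, by linear_combination -h1⟩
    obtain ⟨c, rfl⟩ := (Int.pow_dvd_pow_iff (by norm_num)).mp h2
    exact ha ⟨c, mul_right_cancel₀ (pow_ne_zero 2 hY) (by linear_combination h1)⟩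
  have hXq : (X : ℚ) ≠ 0 := by exact_mod_cast hX
  refine ⟨Z / X, Y / X, ?_⟩
  have h1' : (x : ℚ) * X ^ 2 + a * Y ^ 2 = Z ^ 2 := by exact_mod_cast h1
  field_simp
  linear_combination h1'

theorem hilbertSym_congr_odd {p : ℕ} (hp : p.Prime) (hp2 : p ≠ 2) {α : ℕ} {u u' : ℤ}
    (hu : ¬ (p : ℤ) ∣ u) (h : (p : ℤ) ∣ u - u') {b : ℤ} (hb : b ≠ 0) :
    hilbertSym p (p ^ α * u) b = hilbertSym p (p ^ α * u') b := by
  have hu' : ¬ (p : ℤ) ∣ u' := fun h' => hu <| by simpa using dvd_add h h'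
  obtain ⟨β, w, hw, rfl⟩ := exists_eq_pow_mul hp hb
  rw [hilbertSym_odd hp hp2 _ _ hu hw, hilbertSym_odd hp hp2 _ _ hu' hw, unitChar_congr_odd hp2 h]

theorem exists_padicInt_eq_pow_mul (p : ℕ) [hp : Fact p.Prime] (U W : ℚ_[p]) :
    ∃ (k : ℕ) (u w : ℤ_[p]), (u : ℚ_[p]) = p ^ k * U ∧ (w : ℚ_[p]) = p ^ k * W := by
  have hp1 : (1 : ℝ) < p := by exact_mod_cast hp.out.one_lt
  obtain ⟨k, hk⟩ := pow_unbounded_of_one_lt (max ‖U‖ ‖W‖) hp1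
  have key : ∀ V : ℚ_[p], ‖V‖ ≤ max ‖U‖ ‖W‖ → ‖(p : ℚ_[p]) ^ k * V‖ ≤ 1 := by
    intro V hV
    rw [norm_mul, norm_pow, Padic.norm_p, inv_pow, inv_mul_le_iff₀ (by positivity), mul_one]
    exact hV.trans hk.le
  exact ⟨k, ⟨_, key U (le_max_left _ _)⟩, ⟨_, key W (le_max_right _ _)⟩, rfl, rfl⟩

theorem hilbertSym_of_padic_norm {p : ℕ} [hp : Fact p.Prime] (hp2 : p ≠ 2) {x a : ℤ} (hx : x ≠ 0)
    (ha : a ≠ 0) {U W : ℚ_[p]} (h : (x : ℚ_[p]) = U ^ 2 - a * W ^ 2) : hilbertSym p x a = 1 := by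
  obtain ⟨k, u, w, hu, hw⟩ := exists_padicInt_eq_pow_mul p U W
  obtain ⟨α, x, hx', rfl⟩ := exists_eq_pow_mul hp.out hx
  have hp0 : (p : ℤ) ≠ 0 := by exact_mod_cast hp.out.ne_zero
  obtain ⟨e, he⟩ := Ideal.mem_span_singleton'.mp (PadicInt.appr_spec (2 * k + α + 1) u)
  obtain ⟨f, hf⟩ := Ideal.mem_span_singleton'.mp (PadicInt.appr_spec (2 * k + α + 1) w)
  set u₀ := u.appr (2 * k + α + 1)
  set w₀ := w.appr (2 * k + α + 1)
  have h1 : ((p ^ α * x : ℤ) : ℤ_[p]) * p ^ (2 * k) = u ^ 2 - a * w ^ 2 := by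
    apply Subtype.coe_injective
    push_cast at h ⊢
    rw [hu, hw, h]
    ring
  have h2 : ((p : ℤ_[p])) ^ (2 * k + α + 1) ∣
      (((u₀ : ℤ) ^ 2 - a * w₀ ^ 2 - p ^ α * x * p ^ (2 * k) : ℤ) : ℤ_[p]) := by
    push_cast at h1 ⊢
    refine ⟨-(e * (u + u₀)) + a * f * (w + w₀), ?_⟩
    linear_combination -h1 + (u + u₀) * he - a * (w + w₀) * hf
  rw [PadicInt.pow_p_dvd_int_iff] at h2
  obtain ⟨c, hc⟩ := h2
  have h3 : (u₀ : ℤ) ^ 2 - a * w₀ ^ 2 = p ^ (2 * k + α) * (x + p * c) := by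
    linear_combination hc
  have hx'' : ¬ (p : ℤ) ∣ x + p * c := fun hd => hx' ((dvd_add_left (dvd_mul_right _ _)).mp hd)
  have hne : (p : ℤ) ^ (2 * k + α) * (x + p * c) ≠ 0 :=
    mul_ne_zero (pow_ne_zero _ hp0) fun h0 => hx'' (by rw [h0]; exact dvd_zero _)
  have h4 := hilbertSym_of_norm hne ha h3.symm p
  rw [hilbertSym_congr_odd hp.out hp2 (u' := x) hx'' (by simp) ha] at h4
  rw [← hilbertSym_mul_sq_left p hx ha (pow_ne_zero k hp0), ← h4]
  congr 1
  ring

theorem hilbertSym_of_real_norm {x a : ℤ} {U W : ℝ} (h : (x : ℝ) = U ^ 2 - a * W ^ 2) :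
    hilbertSym 0 x a = 1 := by
  rw [hilbertSym_zero, if_neg]
  rintro ⟨h1, h2⟩
  have h1' : (x : ℝ) < 0 := by exact_mod_cast h1
  have h2' : (a : ℝ) < 0 := by exact_mod_cast h2
  nlinarith [sq_nonneg U, mul_nonneg (neg_nonneg.mpr h2'.le) (sq_nonneg W)]

/-- The **Hasse norm theorem** for quadratic fields. -/
theorem exists_norm_of_local_norms {x a : ℤ} (hx : x ≠ 0) (ha : ¬ IsSquare a)
    (hloc : ∀ (p : ℕ) [Fact p.Prime], ∃ U W : ℚ_[p], (x : ℚ_[p]) = U ^ 2 - a * W ^ 2)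
    (hreal : ∃ U W : ℝ, (x : ℝ) = U ^ 2 - a * W ^ 2) :
    ∃ u w : ℚ, (x : ℚ) = u ^ 2 - a * w ^ 2 := by
  have ha0 : a ≠ 0 := by rintro rfl; exact ha ⟨0, by ring⟩
  refine exists_norm_of_hilbertSym hx ha (hilbertSym_eq_one_of_ne hx ha0 2 fun v hv => ?_)
  rcases eq_or_ne v 0 with rfl | h0
  · obtain ⟨U, W, h⟩ := hreal
    exact hilbertSym_of_real_norm h
  · by_cases hp : v.Prime
    · have := Fact.mk hp
      obtain ⟨U, W, h⟩ := hloc v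
      exact hilbertSym_of_padic_norm hv hx ha0 h
    · exact hilbertSym_of_not_place h0 hp _ _

/-- Existence of an integer with prescribed square classes at the real place and at finitely many
primes `S`, whose Hilbert symbols at the remaining places are unramified outside one prime `r`. -/
theorem exists_int_hilbertSym_eq {S : Finset ℕ} (hS : ∀ p ∈ S, p.Prime) (g : ℕ → ℤ)
    (hg : ∀ v, g v ≠ 0) :
    ∃ (n : ℤ) (r : ℕ), n ≠ 0 ∧ r.Prime ∧ r ∉ S ∧
      (∀ v ∈ insert 0 S, ∀ c : ℤ, c ≠ 0 → hilbertSym v n c = hilbertSym v (g v) c) ∧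
      ∀ v : ℕ, v.Prime → v ∉ S → v ≠ r → ¬ (v : ℤ) ∣ n := by
  classical
  have hex : ∀ p : ℕ, ∃ (α : ℕ) (u : ℤ), p.Prime → ¬ (p : ℤ) ∣ u ∧ g p = p ^ α * u := by
    intro p
    by_cases hp : p.Prime
    · obtain ⟨α, u, h⟩ := exists_eq_pow_mul hp (hg p)
      exact ⟨α, u, fun _ => h⟩
    · exact ⟨0, 0, fun h => absurd h hp⟩
  choose α u hαu using hex
  set M : ℕ → ℤ := fun p => (g 0).sign * ∏ q ∈ S.erase p, (q : ℤ) ^ α q with hM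
  have hMu : ∀ p ∈ S, ¬ (p : ℤ) ∣ M p := by
    intro p hp hd
    have hpp := Nat.prime_iff_prime_int.mp (hS p hp)
    rcases hpp.dvd_or_dvd hd with h | h
    · rcases Int.sign_trichotomy (g 0) with h1 | h1 | h1
      · rw [h1] at h; exact hpp.not_dvd_one h
      · exact hg 0 (Int.sign_eq_zero_iff_zero.mp h1)
      · rw [h1] at h; exact not_dvd_neg_one (hS p hp) h
    · obtain ⟨q, hq, h2⟩ := hpp.exists_mem_finset_dvd h
      rw [Finset.mem_erase] at hq
      exact not_dvd_prime (hS p hp) (hS q hq.2) hq.1.symm (hpp.dvd_of_dvd_pow h2)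
  have hres : ∀ p : ℕ, ∃ c : ℕ, p ∈ S → (p : ℤ) ^ 3 ∣ M p * c - u p := by
    intro p
    by_cases hp : p ∈ S
    · have hco : IsCoprime (M p) ((p : ℤ) ^ 3) :=
        (((Nat.prime_iff_prime_int.mp (hS p hp)).coprime_iff_not_dvd.mpr (hMu p hp)).symm).pow_right
      obtain ⟨s, t, hst⟩ := hco
      have hpos : (0 : ℤ) < (p : ℤ) ^ 3 := by
        have := (hS p hp).pos
        positivity
      refine ⟨((s * u p) % (p : ℤ) ^ 3).toNat, fun _ => ?_⟩
      rw [Int.toNat_of_nonneg (Int.emod_nonneg _ hpos.ne')]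
      obtain ⟨d, hd⟩ := Int.dvd_self_sub_emod (x := s * u p) (m := (p : ℤ) ^ 3)
      exact ⟨-(t * u p) - M p * d, by linear_combination -M p * hd + u p * hst⟩
    · exact ⟨0, fun h => absurd h hp⟩
  choose c hc using hres
  have hpair : Set.Pairwise (S : Set ℕ) (Function.onFun Nat.Coprime fun p => p ^ 3) :=
    fun p hp q hq hpq => Nat.Coprime.pow _ _ ((Nat.coprime_primes (hS p hp) (hS q hq)).mpr hpq)
  obtain ⟨k, hk⟩ := Nat.chineseRemainderOfFinset c (fun p => p ^ 3) S
    (fun p hp => pow_ne_zero _ (hS p hp).ne_zero) hpair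
  have hcu : ∀ p ∈ S, ¬ (p : ℤ) ∣ M p * k := by
    intro p hp hd
    apply (hαu p (hS p hp)).1
    have h1 : ((p : ℤ) ^ 3) ∣ c p - k := by
      have := (Nat.modEq_iff_dvd.mp (hk p hp)); exact_mod_cast this
    have h2 : (p : ℤ) ∣ M p * c p - u p := (dvd_pow_self _ (by norm_num)).trans (hc p hp)
    have h3 : (p : ℤ) ∣ c p - k := (dvd_pow_self _ (by norm_num)).trans h1
    have h4 := dvd_sub (dvd_add (h3.mul_left (M p)) hd) h2
    rwa [show M p * (c p - k) + M p * k - (M p * c p - u p) = u p by ring] at h4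
  have hQ : (∏ p ∈ S, p ^ 3) ≠ 0 := Finset.prod_ne_zero_iff.mpr fun p hp =>
    pow_ne_zero _ (hS p hp).ne_zero
  have hcop : k.Coprime (∏ p ∈ S, p ^ 3) := by
    refine Nat.Coprime.prod_right fun p hp => Nat.Coprime.pow_right _ ?_
    rw [Nat.coprime_comm, (hS p hp).coprime_iff_not_dvd]
    exact fun h => hcu p hp ((Int.natCast_dvd_natCast.mpr h).mul_left _)
  obtain ⟨r, hrgt, hr, hrk⟩ := Nat.forall_exists_prime_gt_and_modEq (S.sup id) hQ hcop
  have hrS : r ∉ S := fun h => absurd (Finset.le_sup (f := id) h) (not_le.mpr hrgt)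
  have hr0 : (r : ℤ) ≠ 0 := by exact_mod_cast hr.ne_zero
  refine ⟨(g 0).sign * (∏ q ∈ S, (q : ℤ) ^ α q) * r, r, ?_, hr, hrS, ?_, ?_⟩
  · refine mul_ne_zero (mul_ne_zero ?_ ?_) hr0
    · exact fun h => hg 0 (Int.sign_eq_zero_iff_zero.mp h)
    · exact Finset.prod_ne_zero_iff.mpr fun q hq =>
        pow_ne_zero _ (by exact_mod_cast (hS q hq).ne_zero)
  · intro v hv b hb
    rcases Finset.mem_insert.mp hv with rfl | hvS
    · have hpos : (0 : ℤ) < (∏ q ∈ S, (q : ℤ) ^ α q) * r :=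
        mul_pos (Finset.prod_pos fun q hq => pow_pos (by exact_mod_cast (hS q hq).pos) _)
          (by exact_mod_cast hr.pos)
      have hiff : (g 0).sign * (∏ q ∈ S, (q : ℤ) ^ α q) * r < 0 ↔ g 0 < 0 := by
        rw [mul_assoc, ← Int.sign_eq_neg_one_iff_neg, Int.sign_mul, Int.sign_eq_one_of_pos hpos,
          mul_one, Int.sign_sign, Int.sign_eq_neg_one_iff_neg]
      simp only [hilbertSym_zero, hiff]
    · have hv' := hS v hvS
      have h1 : (g 0).sign * (∏ q ∈ S, (q : ℤ) ^ α q) * r = v ^ α v * (M v * r) := by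
        rw [← Finset.mul_prod_erase S _ hvS, hM]
        ring
      have hk3 : ((v : ℤ) ^ 3) ∣ c v - k := by
        have := (Nat.modEq_iff_dvd.mp (hk v hvS)); exact_mod_cast this
      have hr3 : ((v : ℤ) ^ 3) ∣ k - r := by
        have := Nat.modEq_iff_dvd.mp (hrk.of_dvd (Finset.dvd_prod_of_mem (fun p => p ^ 3) hvS))
        exact_mod_cast this
      have h2 : ((v : ℤ) ^ 3) ∣ u v - M v * r := by
        have := dvd_sub ((dvd_add hk3 hr3).mul_left (M v)) (hc v hvS)
        rwa [show M v * (c v - k + (k - r)) - (M v * c v - u v) = u v - M v * r by ring] at this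
      rw [h1, (hαu v hv').2, hilbertSym_congr hv' (hαu v hv').1 h2 hb]
  · intro v hv hvS hvr hd
    have hpp := Nat.prime_iff_prime_int.mp hv
    rcases hpp.dvd_or_dvd hd with h | h
    · rcases hpp.dvd_or_dvd h with h | h
      · rcases Int.sign_trichotomy (g 0) with h1 | h1 | h1
        · rw [h1] at h; exact hpp.not_dvd_one h
        · exact hg 0 (Int.sign_eq_zero_iff_zero.mp h1)
        · rw [h1] at h; exact not_dvd_neg_one hv h
      · obtain ⟨q, hq, h2⟩ := hpp.exists_mem_finset_dvd h
        exact not_dvd_prime hv (hS q hq) (fun h => hvS (h ▸ hq)) (hpp.dvd_of_dvd_pow h2)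
    · exact not_dvd_prime hv hr hvr h

/-- If the biquadratic algebra of `a` and `b` is a field at some prime `p₀`, then every nonzero
integer is, up to squares, a product of norms from `ℚ(√a)`, `ℚ(√b)` and `ℚ(√(ab))`. -/
theorem exists_norm_decomposition {a b t : ℤ} (ha : a ≠ 0) (hb : b ≠ 0) (ht : t ≠ 0) {p₀ : ℕ}
    (hp₀ : p₀.Prime) {u s : ℤ} (hu : u ≠ 0) (hs : s ≠ 0) (hua : hilbertSym p₀ u a = 1)
    (hub : hilbertSym p₀ u b = -1) (hsa : hilbertSym p₀ s a = -1) (hsb : hilbertSym p₀ s b = 1) :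
    ∃ n₁ n₂ : ℤ, n₁ ≠ 0 ∧ n₂ ≠ 0 ∧ (∀ v, hilbertSym v n₁ a = 1) ∧ (∀ v, hilbertSym v n₂ b = 1) ∧
      ∀ v, hilbertSym v (t * n₁ * n₂) (a * b) = 1 := by
  classical
  have hab : a * b ≠ 0 := mul_ne_zero ha hb
  set S : Finset ℕ := insert p₀ (insert 2 (a * b * t).natAbs.primeFactors) with hSdef
  have hS : ∀ p ∈ S, p.Prime := by
    intro p hp
    simp only [hSdef, Finset.mem_insert] at hp
    rcases hp with rfl | rfl | hp
    · exact hp₀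
    · exact Nat.prime_two
    · exact Nat.prime_of_mem_primeFactors hp
  have hSout : ∀ v, v.Prime → v ∉ S → v ≠ 2 ∧ ¬ (v : ℤ) ∣ a ∧ ¬ (v : ℤ) ∣ b ∧ ¬ (v : ℤ) ∣ t := by
    intro v hv hvS
    simp only [hSdef, Finset.mem_insert, not_or, Nat.mem_primeFactors, not_and] at hvS
    have hd : ¬ (v : ℤ) ∣ a * b * t := fun h =>
      hvS.2.2 hv (Int.natCast_dvd.mp h) (Int.natAbs_ne_zero.mpr (mul_ne_zero hab ht))
    exact ⟨hvS.2.1, fun h => hd ((h.mul_right b).mul_right t),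
      fun h => hd ((h.mul_left a).mul_right t), fun h => hd (h.mul_left _)⟩
  have h0S : 0 ∉ S := fun h => Nat.not_prime_zero (hS 0 h)
  set g₁ : ℕ → ℤ := fun v => if hilbertSym v t a = 1 then t else 1 with hg₁
  set g₂ : ℕ → ℤ := fun v => if hilbertSym v t a ≠ 1 ∧ hilbertSym v t b = 1 then t else 1 with hg₂
  have hg₁0 : ∀ v, g₁ v ≠ 0 := fun v => by simp only [hg₁]; split_ifs <;> simp [ht]
  have hg₂0 : ∀ v, g₂ v ≠ 0 := fun v => by simp only [hg₂]; split_ifs <;> simp [ht]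
  have hone : ∀ v : ℕ, ∀ c : ℤ, c ≠ 0 → hilbertSym v 1 c = 1 := fun v c hc => by
    simpa using hilbertSym_sq_left v (c := 1) (by norm_num) hc
  have hg₁a : ∀ v, hilbertSym v (g₁ v) a = 1 := fun v => by
    simp only [hg₁]; split_ifs with h
    · exact h
    · exact hone v a ha
  have hg₂b : ∀ v, hilbertSym v (g₂ v) b = 1 := fun v => by
    simp only [hg₂]; split_ifs with h
    · exact h.2
    · exact hone v b hb
  have hg₃ : ∀ v, hilbertSym v (t * g₁ v * g₂ v) (a * b) = 1 := fun v => by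
    have h3 : hilbertSym v t (a * b) = hilbertSym v t a * hilbertSym v t b :=
      hilbertSym_mul_right v ht ha hb
    have htt : hilbertSym v (t * t) (a * b) = 1 := by
      rw [← sq]; exact hilbertSym_sq_left v ht hab
    simp only [hg₁, hg₂]
    rcases hilbertSym_eq v ht ha with h | h <;> rcases hilbertSym_eq v ht hb with h' | h' <;>
      simp [h, h', htt, h3]
  set σ₀ : ℤ := ∏ v ∈ insert 0 S, hilbertSym v (g₁ v) b with hσ
  have hσ2 : σ₀ ^ 2 = 1 := by
    rw [hσ, ← Finset.prod_pow]
    exact Finset.prod_eq_one fun v _ => hilbertSym_sq v (hg₁0 v) hb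
  obtain ⟨u', s', hu', hs', hua', hub', hsa', hsb'⟩ : ∃ u' s' : ℤ, u' ≠ 0 ∧ s' ≠ 0 ∧
      hilbertSym p₀ u' a = 1 ∧ hilbertSym p₀ u' b = σ₀ ∧ hilbertSym p₀ s' a = σ₀ ∧
      hilbertSym p₀ s' b = 1 := by
    have : σ₀ = 1 ∨ σ₀ = -1 := by rwa [← mul_self_eq_one_iff, ← sq]
    rcases this with h | h
    · exact ⟨1, 1, one_ne_zero, one_ne_zero, hone _ _ ha, by rw [h, hone _ _ hb],
        by rw [h, hone _ _ ha], hone _ _ hb⟩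
    · exact ⟨u, s, hu, hs, hua, by rw [hub, h], by rw [hsa, h], hsb⟩
  have hus : hilbertSym p₀ (u' * s') (a * b) = 1 := by
    rw [hilbertSym_mul_left _ hu' hs' hab, hilbertSym_mul_right _ hu' ha hb,
      hilbertSym_mul_right _ hs' ha hb, hua', hub', hsa', hsb']
    linear_combination hσ2
  set e₁ : ℕ → ℤ := fun v => if v = p₀ then u' else 1 with he₁
  set e₂ : ℕ → ℤ := fun v => if v = p₀ then s' else 1 with he₂
  have he₁0 : ∀ v, e₁ v ≠ 0 := fun v => by simp only [he₁]; split_ifs <;> simp [hu']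
  have he₂0 : ∀ v, e₂ v ≠ 0 := fun v => by simp only [he₂]; split_ifs <;> simp [hs']
  obtain ⟨n₁, r₁, hn₁, hr₁, hr₁S, hin₁, hout₁⟩ := exists_int_hilbertSym_eq hS
    (fun v => g₁ v * e₁ v) fun v => mul_ne_zero (hg₁0 v) (he₁0 v)
  obtain ⟨n₂, r₂, hn₂, hr₂, hr₂S, hin₂, hout₂⟩ := exists_int_hilbertSym_eq hS
    (fun v => g₂ v * e₂ v) fun v => mul_ne_zero (hg₂0 v) (he₂0 v)
  have hout₁' : ∀ c : ℤ, (∀ v, v.Prime → v ∉ S → ¬ (v : ℤ) ∣ c) → ∀ v, v ∉ insert 0 S → v ≠ r₁ →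
      hilbertSym v n₁ c = 1 := by
    intro c hc v hv hvr
    simp only [Finset.mem_insert, not_or] at hv
    by_cases hp : v.Prime
    · exact hilbertSym_unit (hSout v hp hv.2).1 hv.1 (hout₁ v hp hv.2 hvr) (hc v hp hv.2)
    · exact hilbertSym_of_not_place hv.1 hp _ _
  have hout₂' : ∀ c : ℤ, (∀ v, v.Prime → v ∉ S → ¬ (v : ℤ) ∣ c) → ∀ v, v ∉ insert 0 S → v ≠ r₂ →
      hilbertSym v n₂ c = 1 := by
    intro c hc v hv hvr
    simp only [Finset.mem_insert, not_or] at hv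
    by_cases hp : v.Prime
    · exact hilbertSym_unit (hSout v hp hv.2).1 hv.1 (hout₂ v hp hv.2 hvr) (hc v hp hv.2)
    · exact hilbertSym_of_not_place hv.1 hp _ _
  have hSa : ∀ v, v.Prime → v ∉ S → ¬ (v : ℤ) ∣ a := fun v hv h => (hSout v hv h).2.1
  have hSb : ∀ v, v.Prime → v ∉ S → ¬ (v : ℤ) ∣ b := fun v hv h => (hSout v hv h).2.2.1
  have hN₁ : ∀ v, hilbertSym v n₁ a = 1 := by
    refine hilbertSym_eq_one_of_ne hn₁ ha r₁ fun v hvr => ?_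
    by_cases hv : v ∈ insert 0 S
    · rw [hin₁ v hv a ha, hilbertSym_mul_left v (hg₁0 v) (he₁0 v) ha, hg₁a, one_mul]
      simp only [he₁]; split_ifs with h
      · rw [h, hua']
      · exact hone v a ha
    · exact hout₁' a hSa v hv hvr
  have hN₂ : ∀ v, hilbertSym v n₂ b = 1 := by
    refine hilbertSym_eq_one_of_ne hn₂ hb r₂ fun v hvr => ?_
    by_cases hv : v ∈ insert 0 S
    · rw [hin₂ v hv b hb, hilbertSym_mul_left v (hg₂0 v) (he₂0 v) hb, hg₂b, one_mul]
      simp only [he₂]; split_ifs with h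
      · rw [h, hsb']
      · exact hone v b hb
    · exact hout₂' b hSb v hv hvr
  have hr₁0 : r₁ ∉ insert 0 S := by
    simp [hr₁S, hr₁.ne_zero]
  have hNb : hilbertSym r₁ n₁ b = 1 := by
    have hprod := prod_hilbertSym hn₁ hb (T := insert r₁ (insert 0 S)) fun v hv => by
      rw [Finset.mem_insert, not_or] at hv
      exact hout₁' b hSb v hv.2 hv.1
    rw [Finset.prod_insert hr₁0, Finset.prod_congr rfl fun v hv => hin₁ v hv b hb,
      Finset.prod_congr rfl fun v _ => hilbertSym_mul_left v (hg₁0 v) (he₁0 v) hb,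
      Finset.prod_mul_distrib, ← hσ, Finset.prod_eq_single_of_mem p₀ (by simp [hSdef])] at hprod
    · simp only [he₁, if_true, hub'] at hprod
      rwa [← sq, hσ2, mul_one] at hprod
    · intro v _ hv
      simp only [he₁, if_neg hv]
      exact hone v b hb
  refine ⟨n₁, n₂, hn₁, hn₂, hN₁, hN₂, ?_⟩
  have htn : t * n₁ ≠ 0 := mul_ne_zero ht hn₁
  refine hilbertSym_eq_one_of_ne (mul_ne_zero htn hn₂) hab r₂ fun v hvr => ?_
  rw [hilbertSym_mul_left v htn hn₂ hab, hilbertSym_mul_left v ht hn₁ hab]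
  by_cases hv : v ∈ insert 0 S
  · rw [hin₁ v hv _ hab, hin₂ v hv _ hab]
    have h1 := hg₃ v
    rw [hilbertSym_mul_left v (mul_ne_zero ht (hg₁0 v)) (hg₂0 v) hab,
      hilbertSym_mul_left v ht (hg₁0 v) hab] at h1
    have h2 : hilbertSym v (e₁ v) (a * b) * hilbertSym v (e₂ v) (a * b) = 1 := by
      rw [← hilbertSym_mul_left v (he₁0 v) (he₂0 v) hab]
      simp only [he₁, he₂]; split_ifs with h
      · rw [h, hus]
      · rw [one_mul]; exact hone v _ hab
    rw [hilbertSym_mul_left v (hg₁0 v) (he₁0 v) hab, hilbertSym_mul_left v (hg₂0 v) (he₂0 v) hab]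
    linear_combination h2 + (hilbertSym v (e₁ v) (a * b) * hilbertSym v (e₂ v) (a * b)) * h1
  · have hn₁v : hilbertSym v n₁ (a * b) = 1 := by
      rw [hilbertSym_mul_right v hn₁ ha hb, hN₁, one_mul]
      rcases eq_or_ne v r₁ with rfl | h
      · exact hNb
      · exact hout₁' b hSb v hv h
    have hSab : ∀ v, v.Prime → v ∉ S → ¬ (v : ℤ) ∣ a * b := fun v hv h =>
      not_dvd_mul hv (hSa v hv h) (hSb v hv h)
    rw [hn₁v, hout₂' _ hSab v hv hvr, mul_one, mul_one]
    simp only [Finset.mem_insert, not_or] at hv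
    by_cases hp : v.Prime
    · exact hilbertSym_unit (hSout v hp hv.2).1 hv.1 (hSout v hp hv.2).2.2.2 (hSab v hp hv.2)
    · exact hilbertSym_of_not_place hv.1 hp _ _

/-- The norm form of the biquadratic algebra `R[√a, √b]` in the basis `1, √a, √b, √a√b`. -/
def biquadraticNorm {R : Type*} [CommRing R] (a b c₀ c₁ c₂ c₃ : R) : R :=
  (c₀ ^ 2 + a * c₁ ^ 2 - b * c₂ ^ 2 - a * b * c₃ ^ 2) ^ 2 - a * (2 * (c₀ * c₁ - b * c₂ * c₃)) ^ 2

/-- An integer which is a relative norm from `ℚ(√a, √b)` to `ℚ(√a)` has trivial symbol with `b`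
at the places where `a` is a local square. -/
theorem hilbertSym_of_relative_norm {a b t e₀ e₁ e₂ e₃ : ℤ} (ha : a ≠ 0) (hb : b ≠ 0) (ht : t ≠ 0)
    (h : t = e₀ ^ 2 + a * e₁ ^ 2 - b * e₂ ^ 2 - a * b * e₃ ^ 2) (h' : e₀ * e₁ = b * e₂ * e₃)
    {v : ℕ} (hv : ∀ c : ℤ, c ≠ 0 → hilbertSym v c a = 1) : hilbertSym v t b = 1 := by
  have hab : a * b ≠ 0 := mul_ne_zero ha hb
  have htab : ∀ s : ℤ, s ≠ 0 → hilbertSym v s (a * b) = 1 → hilbertSym v s b = 1 := by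
    intro s hs hsab
    rwa [hilbertSym_mul_right v hs ha hb, hv s hs, one_mul] at hsab
  by_cases he₁ : e₁ = 0
  · subst he₁
    have : e₂ = 0 ∨ e₃ = 0 := by simpa [hb] using h'.symm
    rcases this with rfl | rfl
    · exact htab t ht (hilbertSym_of_norm ht hab (u := e₀) (w := e₃) (by rw [h]; ring) v)
    · exact hilbertSym_of_norm ht hb (u := e₀) (w := e₂) (by rw [h]; ring) v
  · have hfac : t * e₁ ^ 2 = (e₁ ^ 2 - b * e₃ ^ 2) * (a * e₁ ^ 2 - b * e₂ ^ 2) := by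
      rw [h]; linear_combination (e₀ * e₁ + b * e₂ * e₃) * h'
    have hne : (e₁ ^ 2 - b * e₃ ^ 2) * (a * e₁ ^ 2 - b * e₂ ^ 2) ≠ 0 := by
      rw [← hfac]; exact mul_ne_zero ht (pow_ne_zero 2 he₁)
    have h₁ := left_ne_zero_of_mul hne
    have h₂ := right_ne_zero_of_mul hne
    have h₃ := htab _ (mul_ne_zero ha h₂) (hilbertSym_of_norm (mul_ne_zero ha h₂) hab
      (u := a * e₁) (w := e₂) (by ring) v)
    rw [hilbertSym_mul_left v ha h₂ hb, hilbertSym_comm v a b, hv b hb, one_mul] at h₃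
    rw [← hilbertSym_mul_sq_left v ht hb he₁, hfac, hilbertSym_mul_left v h₁ h₂ hb, h₃,
      hilbertSym_of_norm h₁ hb rfl v, one_mul]

/-- If `n ^ 2` is a norm from `ℚ(√a, √b)`, then `n * t` is a norm from `ℚ(√a)` for some relative
norm `t` that is rational. -/
theorem exists_relative_norm_of_sq_eq {a b n c₀ c₁ c₂ c₃ : ℤ} (ha : a ≠ 0) (hn : n ≠ 0)
    (h : n ^ 2 = biquadraticNorm a b c₀ c₁ c₂ c₃) :
    ∃ t e₀ e₁ e₂ e₃ u w : ℤ, t ≠ 0 ∧ t = e₀ ^ 2 + a * e₁ ^ 2 - b * e₂ ^ 2 - a * b * e₃ ^ 2 ∧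
      e₀ * e₁ = b * e₂ * e₃ ∧ n * t = u ^ 2 - a * w ^ 2 := by
  unfold biquadraticNorm at h
  generalize hU : c₀ ^ 2 + a * c₁ ^ 2 - b * c₂ ^ 2 - a * b * c₃ ^ 2 = U at h
  generalize hW : 2 * (c₀ * c₁ - b * c₂ * c₃) = W at h
  by_cases hnU : n + U = 0
  · have hUn : U = -n := by linarith
    have hW0 : W = 0 := by
      have : a * W ^ 2 = 0 := by rw [hUn] at h; linarith
      simpa [ha] using this
    refine ⟨-(a * n), a * c₁, c₀, a * c₃, c₂, 0, n, by simp [ha, hn], ?_, ?_, by ring⟩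
    · linear_combination -a * hUn - a * hU
    · linear_combination a * (by linarith : c₀ * c₁ = b * c₂ * c₃)
  · refine ⟨2 * n ^ 2 * (n + U), (n + U) * c₀ - a * W * c₁, (n + U) * c₁ - W * c₀,
      (n + U) * c₂ - a * W * c₃, (n + U) * c₃ - W * c₂, n * (n + U), n * W, by simp [hn, hnU], ?_,
      ?_, ?_⟩
    · subst hU hW
      linear_combination
        (2 * n + (c₀ ^ 2 + a * c₁ ^ 2 - b * c₂ ^ 2 - a * b * c₃ ^ 2)) * h
    · subst hU hW
      linear_combination (c₀ * c₁ - b * c₂ * c₃) * h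
    · linear_combination (n ^ 2) * h

/-- If at every place one of `a`, `b`, `a * b` has only trivial symbols, while `a` and `b` satisfy
two local nontriviality conditions, then some square is not a norm from `ℚ(√a, √b)`. -/
theorem exists_sq_ne_biquadraticNorm {a b : ℤ} (ha : a ≠ 0) (hb : b ≠ 0)
    (hcov : ∀ v, (∀ c : ℤ, c ≠ 0 → hilbertSym v c a = 1) ∨
      (∀ c : ℤ, c ≠ 0 → hilbertSym v c b = 1) ∨ (∀ c : ℤ, c ≠ 0 → hilbertSym v c (a * b) = 1))
    {p₁ p₂ : ℕ} (hp₁ : p₁.Prime) (hp₂ : p₂.Prime) {g₁ g₂ : ℤ} (hg₁ : g₁ ≠ 0) (hg₂ : g₂ ≠ 0)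
    (h₁ : hilbertSym p₁ g₁ a = -1) (h₂ : hilbertSym p₂ g₂ b = -1)
    (h₂a : ∀ c : ℤ, c ≠ 0 → hilbertSym p₂ c a = 1) :
    ∃ n : ℤ, n ≠ 0 ∧ ∀ c₀ c₁ c₂ c₃ : ℚ,
      biquadraticNorm (a : ℚ) (b : ℚ) c₀ c₁ c₂ c₃ ≠ (n : ℚ) ^ 2 := by
  classical
  have hab : a * b ≠ 0 := mul_ne_zero ha hb
  have hne : p₁ ≠ p₂ := by
    rintro rfl
    rw [h₂a g₁ hg₁] at h₁
    norm_num at h₁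
  set S : Finset ℕ := insert p₁ (insert p₂ (insert 2 (a * b).natAbs.primeFactors)) with hSdef
  have hS : ∀ p ∈ S, p.Prime := by
    intro p hp
    simp only [hSdef, Finset.mem_insert] at hp
    rcases hp with rfl | rfl | rfl | hp
    · exact hp₁
    · exact hp₂
    · exact Nat.prime_two
    · exact Nat.prime_of_mem_primeFactors hp
  have hp₁S : p₁ ∈ S := by simp [hSdef]
  have hp₂S : p₂ ∈ S := by simp [hSdef]
  have hSout : ∀ v, v.Prime → v ∉ S → v ≠ 2 ∧ ¬ (v : ℤ) ∣ a ∧ ¬ (v : ℤ) ∣ b := by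
    intro v hv hvS
    simp only [hSdef, Finset.mem_insert, not_or, Nat.mem_primeFactors, not_and] at hvS
    have hd : ¬ (v : ℤ) ∣ a * b := fun h =>
      hvS.2.2.2 hv (Int.natCast_dvd.mp h) (Int.natAbs_ne_zero.mpr hab)
    exact ⟨hvS.2.2.1, fun h => hd (h.mul_right b), fun h => hd (h.mul_left a)⟩
  have hone : ∀ v : ℕ, ∀ c : ℤ, c ≠ 0 → hilbertSym v 1 c = 1 := fun v c hc => by
    simpa using hilbertSym_sq_left v (c := 1) (by norm_num) hc
  set g : ℕ → ℤ := fun v => if v = p₁ then g₁ else if v = p₂ then g₂ else 1 with hg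
  have hg0 : ∀ v, g v ≠ 0 := fun v => by simp only [hg]; split_ifs <;> simp [hg₁, hg₂]
  obtain ⟨n, r, hn, hr, hrS, hin, hout⟩ := exists_int_hilbertSym_eq hS g hg0
  have houtc : ∀ c : ℤ, (∀ v, v.Prime → v ∉ S → ¬ (v : ℤ) ∣ c) → ∀ v, v ∉ insert 0 S → v ≠ r →
      hilbertSym v n c = 1 := by
    intro c hc v hv hvr
    simp only [Finset.mem_insert, not_or] at hv
    by_cases hp : v.Prime
    · exact hilbertSym_unit (hSout v hp hv.2).1 hv.1 (hout v hp hv.2 hvr) (hc v hp hv.2)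
    · exact hilbertSym_of_not_place hv.1 hp _ _
  have hSa : ∀ v, v.Prime → v ∉ S → ¬ (v : ℤ) ∣ a := fun v hv h => (hSout v hv h).2.1
  have hSb : ∀ v, v.Prime → v ∉ S → ¬ (v : ℤ) ∣ b := fun v hv h => (hSout v hv h).2.2
  have hinne : ∀ v ∈ insert 0 S, ∀ c : ℤ, c ≠ 0 → v ≠ p₁ → v ≠ p₂ → hilbertSym v n c = 1 := by
    intro v hv c hc hv₁ hv₂
    rw [hin v hv c hc]
    simp only [hg, if_neg hv₁, if_neg hv₂]
    exact hone v c hc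
  have hnp₁ : hilbertSym p₁ n a = -1 := by
    rw [hin p₁ (by simp [hp₁S]) a ha]; simpa [hg] using h₁
  have hnp₂ : hilbertSym p₂ n b = -1 := by
    rw [hin p₂ (by simp [hp₂S]) b hb]; simpa [hg, hne.symm] using h₂
  have hra : hilbertSym r n a ≠ 1 := by
    intro hr1
    have := hilbertSym_eq_one_of_ne hn ha p₁ (fun v hv₁ => by
      rcases eq_or_ne v r with rfl | hvr
      · exact hr1
      rcases eq_or_ne v p₂ with rfl | hv₂
      · exact h₂a n hn
      by_cases hv : v ∈ insert 0 S
      · exact hinne v hv a ha hv₁ hv₂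
      · exact houtc a hSa v hv hvr) p₁
    rw [hnp₁] at this
    norm_num at this
  refine ⟨n, hn, fun q₀ q₁ q₂ q₃ hq => ?_⟩
  obtain ⟨d, hd, c₀, c₁, c₂, c₃, hc₀, hc₁, hc₂, hc₃⟩ : ∃ d : ℤ, d ≠ 0 ∧ ∃ c₀ c₁ c₂ c₃ : ℤ,
      (c₀ : ℚ) = d * q₀ ∧ (c₁ : ℚ) = d * q₁ ∧ (c₂ : ℚ) = d * q₂ ∧ (c₃ : ℚ) = d * q₃ := by
    refine ⟨q₀.den * q₁.den * q₂.den * q₃.den, by simp, q₀.num * q₁.den * q₂.den * q₃.den,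
      q₀.den * q₁.num * q₂.den * q₃.den, q₀.den * q₁.den * q₂.num * q₃.den,
      q₀.den * q₁.den * q₂.den * q₃.num, ?_, ?_, ?_, ?_⟩ <;> push_cast
    · rw [← Rat.mul_den_eq_num q₀]; ring
    · rw [← Rat.mul_den_eq_num q₁]; ring
    · rw [← Rat.mul_den_eq_num q₂]; ring
    · rw [← Rat.mul_den_eq_num q₃]; ring
  have hint : (n * d ^ 2) ^ 2 = biquadraticNorm a b c₀ c₁ c₂ c₃ := by
    have : ((n * d ^ 2 : ℤ) : ℚ) ^ 2 = (biquadraticNorm a b c₀ c₁ c₂ c₃ : ℤ) := by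
      unfold biquadraticNorm at hq ⊢
      push_cast
      rw [hc₀, hc₁, hc₂, hc₃]
      linear_combination -(d : ℚ) ^ 4 * hq
    exact_mod_cast this
  have hnd : n * d ^ 2 ≠ 0 := mul_ne_zero hn (pow_ne_zero 2 hd)
  obtain ⟨t, e₀, e₁, e₂, e₃, u, w, ht, hte, he, hnt⟩ := exists_relative_norm_of_sq_eq ha hnd hint
  have hk : n * d ^ 2 * t ≠ 0 := mul_ne_zero hnd ht
  have hka : ∀ v, hilbertSym v (n * d ^ 2 * t) a = 1 := fun v => hilbertSym_of_norm hk ha hnt v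
  have hkb : ∀ v, (∀ c : ℤ, c ≠ 0 → hilbertSym v c a = 1) →
      hilbertSym v (n * d ^ 2 * t) b = hilbertSym v n b := fun v hv => by
    rw [hilbertSym_mul_left v hnd ht hb, hilbertSym_mul_sq_left v hn hb hd,
      hilbertSym_of_relative_norm ha hb ht hte he hv, mul_one]
  have hkb' : ∀ v, ¬ (∀ c : ℤ, c ≠ 0 → hilbertSym v c a = 1) →
      hilbertSym v (n * d ^ 2 * t) b = 1 := fun v hv => by
    rcases (hcov v).resolve_left hv with h | h
    · exact h _ hk
    · have := h _ hk
      rwa [hilbertSym_mul_right v hk ha hb, hka, one_mul] at this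
  have := hilbertSym_eq_one_of_ne hk hb p₂ (fun v hv₂ => by
    by_cases hva : ∀ c : ℤ, c ≠ 0 → hilbertSym v c a = 1
    · rw [hkb v hva]
      have hv₁ : v ≠ p₁ := by
        rintro rfl
        rw [hva g₁ hg₁] at h₁
        norm_num at h₁
      have hvr : v ≠ r := by
        rintro rfl
        exact hra (hva n hn)
      by_cases hv : v ∈ insert 0 S
      · exact hinne v hv b hb hv₁ hv₂
      · exact houtc b hSb v hv hvr
    · exact hkb' v hva) p₂
  rw [hkb p₂ h₂a, hnp₂] at this
  norm_num at this

/-- The norm of an element of a free algebra with basis `1, α, β, αβ`, where `α ^ 2 = a` and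
`β ^ 2 = b`. -/
theorem norm_eq_biquadraticNorm {R A : Type*} [CommRing R] [CommRing A] [Algebra R A]
    (B : Module.Basis (Fin 4) R A) {α β : A} {a b : R} (hα : α ^ 2 = algebraMap R A a)
    (hβ : β ^ 2 = algebraMap R A b) (hB : ⇑B = ![1, α, β, α * β]) (c : Fin 4 → R) :
    Algebra.norm R (∑ i, c i • B i) = biquadraticNorm a b (c 0) (c 1) (c 2) (c 3) := by
  classical
  have hM : Algebra.leftMulMatrix B (∑ i, c i • B i) =
      !![c 0, a * c 1, b * c 2, a * b * c 3; c 1, c 0, b * c 3, b * c 2;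
        c 2, a * c 3, c 0, a * c 1; c 3, c 2, c 1, c 0] := by
    ext i j
    rw [Algebra.leftMulMatrix_eq_repr_mul]
    suffices h : (∑ i, c i • B i) * B j =
        ∑ i, (!![c 0, a * c 1, b * c 2, a * b * c 3; c 1, c 0, b * c 3, b * c 2;
          c 2, a * c 3, c 0, a * c 1; c 3, c 2, c 1, c 0] : Matrix _ _ R) i j • B i by
      rw [h, B.repr_sum_self]
    simp only [hB, Fin.sum_univ_four, Algebra.smul_def]
    fin_cases j <;> simp
    · linear_combination (algebraMap R A (c 1) + β * algebraMap R A (c 3)) * hα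
    · linear_combination (algebraMap R A (c 2) + α * algebraMap R A (c 3)) * hβ
    · linear_combination (algebraMap R A (c 1) * β + algebraMap R A (c 3) * β ^ 2) * hα +
        (algebraMap R A (c 2) * α + algebraMap R A (c 3) * algebraMap R A a) * hβ
  rw [Algebra.norm_eq_matrix_det B, hM, Matrix.det_succ_row_zero]
  simp [Fin.sum_univ_succ, Matrix.det_fin_three, Fin.succAbove, biquadraticNorm]
  ring

theorem exists_isUnit_norm_eq_iff {L A : Type*} [Field L] [CommRing A] [Algebra L A]
    (B : Module.Basis (Fin 4) L A) {α β : A} {a b x : L} (hx : x ≠ 0)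
    (hα : α ^ 2 = algebraMap L A a) (hβ : β ^ 2 = algebraMap L A b)
    (hB : ⇑B = ![1, α, β, α * β]) :
    (∃ y : A, IsUnit y ∧ Algebra.norm L y = x) ↔
      ∃ c₀ c₁ c₂ c₃ : L, biquadraticNorm a b c₀ c₁ c₂ c₃ = x := by
  constructor
  · rintro ⟨y, -, rfl⟩
    refine ⟨B.repr y 0, B.repr y 1, B.repr y 2, B.repr y 3, ?_⟩
    rw [← norm_eq_biquadraticNorm B hα hβ hB, B.sum_repr]
  · rintro ⟨c₀, c₁, c₂, c₃, hc⟩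
    have hy : Algebra.norm L (∑ i, ![c₀, c₁, c₂, c₃] i • B i) = x := by
      rw [norm_eq_biquadraticNorm B hα hβ hB]; exact hc
    refine ⟨_, ?_, hy⟩
    generalize ∑ i, ![c₀, c₁, c₂, c₃] i • B i = y at hy
    have : Module.Finite L A := Module.Finite.of_basis B
    have : Module.Free L A := Module.Free.of_basis B
    have hdet : IsUnit (LinearMap.det (Algebra.lmul L A y)) := by
      rw [← Algebra.norm_apply, hy]; exact hx.isUnit
    obtain ⟨z, hz⟩ := ((Module.End.isUnit_iff _).mp
      ((LinearMap.isUnit_iff_isUnit_det _).mpr hdet)).surjective 1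
    exact IsUnit.of_mul_eq_one z hz

/-- The Hasse norm principle for a biquadratic field, in terms of its norm form. -/
theorem hasseNormPrinciple_iff {K : Type*} [Field K] [Algebra ℚ K]
    (B : Module.Basis (Fin 4) ℚ K) {α β : K} {a b : ℚ}
    (hα : α ^ 2 = algebraMap ℚ K a) (hβ : β ^ 2 = algebraMap ℚ K b)
    (hB : ⇑B = ![1, α, β, α * β]) :
    HasseNormPrinciple K ↔ ∀ x : ℚ, x ≠ 0 →
      ((∀ (p : ℕ) [Fact p.Prime],
        ∃ c₀ c₁ c₂ c₃ : ℚ_[p], biquadraticNorm (a : ℚ_[p]) b c₀ c₁ c₂ c₃ = x) ∧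
        ∃ c₀ c₁ c₂ c₃ : ℝ, biquadraticNorm (a : ℝ) b c₀ c₁ c₂ c₃ = x) →
      ∃ c₀ c₁ c₂ c₃ : ℚ, biquadraticNorm a b c₀ c₁ c₂ c₃ = x := by
  have hloc : ∀ (L : Type) [Field L] [Algebra ℚ L] (x : ℚ), x ≠ 0 →
      ((∃ y : L ⊗[ℚ] K, IsUnit y ∧ Algebra.norm L y = algebraMap ℚ L x) ↔
        ∃ c₀ c₁ c₂ c₃ : L, biquadraticNorm (algebraMap ℚ L a) (algebraMap ℚ L b) c₀ c₁ c₂ c₃ =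
          algebraMap ℚ L x) := by
    intro L _ _ x hx
    have hsq : ∀ (γ : K) (c : ℚ), γ ^ 2 = algebraMap ℚ K c →
        ((1 : L) ⊗ₜ[ℚ] γ) ^ 2 = algebraMap L (L ⊗[ℚ] K) (algebraMap ℚ L c) := by
      intro γ c h
      rw [Algebra.TensorProduct.tmul_pow, h, one_pow, Algebra.TensorProduct.algebraMap_apply,
        Algebra.algebraMap_eq_smul_one, Algebra.algebraMap_eq_smul_one, TensorProduct.tmul_smul,
        Algebra.smul_def, Algebra.TensorProduct.algebraMap_apply, Algebra.smul_def]
      simp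
    refine exists_isUnit_norm_eq_iff (Algebra.TensorProduct.basis L B)
      ((map_ne_zero _).mpr hx) (hsq α a hα) (hsq β b hβ) ?_
    ext i
    rw [Algebra.TensorProduct.basis_apply, hB]
    fin_cases i <;> simp [Algebra.TensorProduct.one_def]
  unfold HasseNormPrinciple
  refine forall_congr' fun x => forall_congr' fun hx => ?_
  refine imp_congr (and_congr (forall_congr' fun p => forall_congr' fun _ => ?_) ?_) ?_
  · simpa using hloc ℚ_[p] x hx
  · simpa using hloc ℝ x hx
  · simpa using exists_isUnit_norm_eq_iff B hx hα hβ hB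

theorem eq_zero_of_sq_eq_mul_sq {F : Type*} [Field F] {a u w : F} (ha : ¬ IsSquare a)
    (h : u ^ 2 = a * w ^ 2) : u = 0 ∧ w = 0 := by
  have hw : w = 0 := by
    by_contra hw
    refine ha ⟨u / w, ?_⟩
    field_simp
    linear_combination -h
  subst hw
  simpa using h

theorem eq_zero_of_relative_norm_eq_zero {F : Type*} [Field F] [CharZero F] {a b c₀ c₁ c₂ c₃ : F}
    (hb : ¬ IsSquare b) (hab : ¬ IsSquare (a * b))
    (hU : c₀ ^ 2 + a * c₁ ^ 2 - b * c₂ ^ 2 - a * b * c₃ ^ 2 = 0)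
    (hW : c₀ * c₁ - b * c₂ * c₃ = 0) : c₀ = 0 ∧ c₁ = 0 ∧ c₂ = 0 ∧ c₃ = 0 := by
  have hfac : (c₁ ^ 2 - b * c₃ ^ 2) * (a * c₁ ^ 2 - b * c₂ ^ 2) = 0 := by
    linear_combination c₁ ^ 2 * hU - (c₀ * c₁ + b * c₂ * c₃) * hW
  rcases mul_eq_zero.mp hfac with h | h
  · obtain ⟨rfl, rfl⟩ := eq_zero_of_sq_eq_mul_sq hb (sub_eq_zero.mp h)
    obtain ⟨rfl, rfl⟩ := eq_zero_of_sq_eq_mul_sq (u := c₀) (w := c₂) hb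
      (by linear_combination hU)
    simp
  · have ha0 : a ≠ 0 := by rintro rfl; simp at hab
    obtain ⟨h1, rfl⟩ := eq_zero_of_sq_eq_mul_sq (u := a * c₁) (w := c₂) hab
      (by linear_combination a * h)
    obtain rfl : c₁ = 0 := by simpa [ha0] using h1
    obtain ⟨rfl, rfl⟩ := eq_zero_of_sq_eq_mul_sq (u := c₀) (w := c₃) hab
      (by linear_combination hU)
    simp

/-- If `a`, `b` and `a * b` are not squares, then `1, √a, √b, √a√b` is a basis of
`ℚ(√a, √b)`. -/
theorem exists_basis_adjoin_pair {E : Type*} [Field E] [Algebra ℚ E] {a b : ℚ} {x y : E}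
    (ha : ¬ IsSquare a) (hb : ¬ IsSquare b) (hab : ¬ IsSquare (a * b))
    (hx : x ^ 2 = algebraMap ℚ E a) (hy : y ^ 2 = algebraMap ℚ E b) :
    ∃ (α β : IntermediateField.adjoin ℚ {x, y})
      (B : Module.Basis (Fin 4) ℚ (IntermediateField.adjoin ℚ {x, y})),
      α ^ 2 = algebraMap ℚ _ a ∧ β ^ 2 = algebraMap ℚ _ b ∧ ⇑B = ![1, α, β, α * β] := by
  set K := IntermediateField.adjoin ℚ {x, y} with hK
  have hxK : x ∈ K := IntermediateField.subset_adjoin _ _ (by simp)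
  have hyK : y ∈ K := IntermediateField.subset_adjoin _ _ (by simp)
  obtain ⟨α, hαx⟩ : ∃ α : K, (α : E) = x := ⟨⟨x, hxK⟩, rfl⟩
  obtain ⟨β, hβy⟩ : ∃ β : K, (β : E) = y := ⟨⟨y, hyK⟩, rfl⟩
  have hα : α ^ 2 = algebraMap ℚ K a := Subtype.ext (by simp [hαx, hx])
  have hβ : β ^ 2 = algebraMap ℚ K b := Subtype.ext (by simp [hβy, hy])
  have hli : LinearIndependent ℚ ![1, α, β, α * β] := by
    rw [Fintype.linearIndependent_iff]
    intro c hc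
    have hc' : algebraMap ℚ E (c 0) + algebraMap ℚ E (c 1) * x + algebraMap ℚ E (c 2) * y +
        algebraMap ℚ E (c 3) * (x * y) = 0 := by
      simpa [Fin.sum_univ_four, Algebra.smul_def, hαx, hβy] using congrArg (algebraMap K E) hc
    have hrel : algebraMap ℚ E (c 0 ^ 2 + a * c 1 ^ 2 - b * c 2 ^ 2 - a * b * c 3 ^ 2) +
        algebraMap ℚ E (2 * (c 0 * c 1 - b * c 2 * c 3)) * x = 0 := by
      simp only [map_sub, map_add, map_mul, map_pow, ← hx, ← hy, map_ofNat]
      linear_combination (algebraMap ℚ E (c 0) + algebraMap ℚ E (c 1) * x -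
        algebraMap ℚ E (c 2) * y - algebraMap ℚ E (c 3) * (x * y)) * hc'
    have hsq := eq_zero_of_sq_eq_mul_sq ha (u := c 0 ^ 2 + a * c 1 ^ 2 - b * c 2 ^ 2 -
      a * b * c 3 ^ 2) (w := 2 * (c 0 * c 1 - b * c 2 * c 3)) ((algebraMap ℚ E).injective (by
        rw [map_mul, map_pow, map_pow, ← hx, eq_neg_of_add_eq_zero_left hrel]; ring))
    obtain ⟨h0, h1, h2, h3⟩ := eq_zero_of_relative_norm_eq_zero hb hab hsq.1 (by linarith [hsq.2])
    intro i
    fin_cases i <;> assumption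
  have hsp : ∀ z ∈ Algebra.adjoin ℚ {x, y}, ∃ c : Fin 4 → ℚ,
      z = algebraMap ℚ E (c 0) + algebraMap ℚ E (c 1) * x + algebraMap ℚ E (c 2) * y +
        algebraMap ℚ E (c 3) * (x * y) := by
    intro z hz
    induction hz using Algebra.adjoin_induction with
    | mem z hz =>
      rcases hz with rfl | rfl
      · exact ⟨![0, 1, 0, 0], by simp⟩
      · exact ⟨![0, 0, 1, 0], by simp⟩
    | algebraMap r => exact ⟨![r, 0, 0, 0], by simp⟩
    | add z w _ _ hz hw =>
      obtain ⟨c, rfl⟩ := hz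
      obtain ⟨d, rfl⟩ := hw
      exact ⟨c + d, by simp only [Pi.add_apply, map_add]; ring⟩
    | mul z w _ _ hz hw =>
      obtain ⟨c, rfl⟩ := hz
      obtain ⟨d, rfl⟩ := hw
      refine ⟨![c 0 * d 0 + a * (c 1 * d 1) + b * (c 2 * d 2) + a * b * (c 3 * d 3),
        c 0 * d 1 + c 1 * d 0 + b * (c 2 * d 3 + c 3 * d 2),
        c 0 * d 2 + c 2 * d 0 + a * (c 1 * d 3 + c 3 * d 1),
        c 0 * d 3 + c 3 * d 0 + c 1 * d 2 + c 2 * d 1], ?_⟩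
      simp only [Matrix.cons_val, map_add, map_mul, ← hx, ← hy]
      ring
  have hint : ∀ (γ : E) (c : ℚ), γ ^ 2 = algebraMap ℚ E c → IsAlgebraic ℚ γ := fun γ c h =>
    (IsIntegral.of_pow two_pos (h ▸ isIntegral_algebraMap)).isAlgebraic
  have hspan : ⊤ ≤ Submodule.span ℚ (Set.range ![1, α, β, α * β]) := by
    rintro ⟨z, hz⟩ -
    have hz' : z ∈ Algebra.adjoin ℚ {x, y} := by
      rw [← IntermediateField.adjoin_toSubalgebra_of_isAlgebraic ]
      · exact hz
      · rintro γ (rfl | rfl)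
        · exact hint _ _ hx
        · exact hint _ _ hy
    obtain ⟨c, rfl⟩ := hsp z hz'
    rw [Submodule.mem_span_range_iff_exists_fun]
    refine ⟨c, Subtype.ext ?_⟩
    simp [Fin.sum_univ_four, Algebra.smul_def, hαx, hβy]
  exact ⟨α, β, Module.Basis.mk hli hspan, hα, hβ, Module.Basis.coe_mk _ _⟩

theorem biquadraticNorm_mul {R : Type*} [CommRing R] (a b c₀ c₁ c₂ c₃ d₀ d₁ d₂ d₃ : R) :
    biquadraticNorm a b c₀ c₁ c₂ c₃ * biquadraticNorm a b d₀ d₁ d₂ d₃ =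
      biquadraticNorm a b (c₀ * d₀ + a * (c₁ * d₁) + b * (c₂ * d₂) + a * b * (c₃ * d₃))
        (c₀ * d₁ + c₁ * d₀ + b * (c₂ * d₃ + c₃ * d₂))
        (c₀ * d₂ + c₂ * d₀ + a * (c₁ * d₃ + c₃ * d₁))
        (c₀ * d₃ + c₃ * d₀ + c₁ * d₂ + c₂ * d₁) := by
  unfold biquadraticNorm
  have h : ∀ u w u' w' : R, (u ^ 2 - a * w ^ 2) * (u' ^ 2 - a * w' ^ 2) =
      (u * u' + a * (w * w')) ^ 2 - a * (u * w' + w * u') ^ 2 := fun u w u' w' => by ring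
  rw [h]
  congr 2 <;> ring

/-- If `ℚ(√a, √b)` has local degree four at some place, witnessed by `u` and `s`, then every
rational square is a norm. -/
theorem exists_biquadraticNorm_eq_sq {a b : ℤ} (ha : ¬ IsSquare a) (hb : ¬ IsSquare b)
    (hab : ¬ IsSquare (a * b)) {p₀ : ℕ} (hp₀ : p₀.Prime) {u s : ℤ} (hu : u ≠ 0) (hs : s ≠ 0)
    (hua : hilbertSym p₀ u a = 1) (hub : hilbertSym p₀ u b = -1) (hsa : hilbertSym p₀ s a = -1)
    (hsb : hilbertSym p₀ s b = 1) {q : ℚ} (hq : q ≠ 0) :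
    ∃ c₀ c₁ c₂ c₃ : ℚ, biquadraticNorm (a : ℚ) b c₀ c₁ c₂ c₃ = q ^ 2 := by
  have ha0 : a ≠ 0 := by rintro rfl; exact ha ⟨0, by ring⟩
  have hb0 : b ≠ 0 := by rintro rfl; exact hb ⟨0, by ring⟩
  have ht : q.num * q.den ≠ 0 := mul_ne_zero (Rat.num_ne_zero.mpr hq) (by simp)
  obtain ⟨n₁, n₂, hn₁, hn₂, h₁, h₂, h₃⟩ :=
    exists_norm_decomposition ha0 hb0 ht hp₀ hu hs hua hub hsa hsb
  obtain ⟨u₁, w₁, e₁⟩ := exists_norm_of_hilbertSym hn₁ ha h₁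
  obtain ⟨u₂, w₂, e₂⟩ := exists_norm_of_hilbertSym hn₂ hb h₂
  obtain ⟨u₃, w₃, e₃⟩ := exists_norm_of_hilbertSym (mul_ne_zero (mul_ne_zero ht hn₁) hn₂) hab h₃
  set k : ℚ := (q.den * n₁ * n₂)⁻¹ with hk
  have hk0 : (q.den : ℚ) * n₁ * n₂ ≠ 0 := by simp [hn₁, hn₂]
  have key : q ^ 2 = biquadraticNorm (a : ℚ) b u₁ w₁ 0 0 * biquadraticNorm (a : ℚ) b u₂ 0 w₂ 0 *
      biquadraticNorm (a : ℚ) b u₃ 0 0 w₃ * biquadraticNorm (a : ℚ) b k 0 0 0 := by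
    have h1 : biquadraticNorm (a : ℚ) b u₁ w₁ 0 0 = n₁ ^ 2 := by
      rw [e₁]; unfold biquadraticNorm; ring
    have h2 : biquadraticNorm (a : ℚ) b u₂ 0 w₂ 0 = n₂ ^ 2 := by
      rw [e₂]; unfold biquadraticNorm; ring
    have h3 : biquadraticNorm (a : ℚ) b u₃ 0 0 w₃ = (q.num * q.den * n₁ * n₂) ^ 2 := by
      push_cast at e₃
      rw [e₃]; unfold biquadraticNorm; ring
    have h4 : biquadraticNorm (a : ℚ) b k 0 0 0 = k ^ 4 := by
      unfold biquadraticNorm; ring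
    have h5 : k * (q.den * n₁ * n₂) = 1 := inv_mul_cancel₀ hk0
    rw [h1, h2, h3, h4, ← Rat.mul_den_eq_num q]
    generalize hD : (q.den : ℚ) * n₁ * n₂ = D at h5
    have : (n₁ : ℚ) ^ 2 * n₂ ^ 2 * (q * q.den * q.den * n₁ * n₂) ^ 2 * k ^ 4 =
        q ^ 2 * (k * D) ^ 4 := by
      rw [← hD]; ring
    rw [this, h5]; ring
  rw [key]
  simp only [biquadraticNorm_mul]
  exact ⟨_, _, _, _, rfl⟩

/-- If `ℚ(√a, √b)` has local degree four at some place, then its norm form satisfies the Hasse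
principle. -/
theorem exists_biquadraticNorm_eq_of_local {a b : ℤ} (ha : ¬ IsSquare a) (hb : ¬ IsSquare b)
    (hab : ¬ IsSquare (a * b)) {p₀ : ℕ} (hp₀ : p₀.Prime) {u s : ℤ} (hu : u ≠ 0) (hs : s ≠ 0)
    (hua : hilbertSym p₀ u a = 1) (hub : hilbertSym p₀ u b = -1) (hsa : hilbertSym p₀ s a = -1)
    (hsb : hilbertSym p₀ s b = 1) {x : ℚ} (hx : x ≠ 0)
    (hloc : ∀ (p : ℕ) [Fact p.Prime],
      ∃ c₀ c₁ c₂ c₃ : ℚ_[p], biquadraticNorm (a : ℚ_[p]) b c₀ c₁ c₂ c₃ = x)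
    (hreal : ∃ c₀ c₁ c₂ c₃ : ℝ, biquadraticNorm (a : ℝ) b c₀ c₁ c₂ c₃ = x) :
    ∃ c₀ c₁ c₂ c₃ : ℚ, biquadraticNorm (a : ℚ) b c₀ c₁ c₂ c₃ = x := by
  have hX : x.num * x.den ≠ 0 := mul_ne_zero (Rat.num_ne_zero.mpr hx) (by simp)
  have hXx : ((x.num * x.den : ℤ) : ℚ) = x * x.den ^ 2 := by
    push_cast; rw [← Rat.mul_den_eq_num x]; ring
  have hsplit : ∀ (F : Type) [Field F] [CharZero F],
      (∃ c₀ c₁ c₂ c₃ : F, biquadraticNorm (a : F) b c₀ c₁ c₂ c₃ = x) →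
      (∃ U W : F, ((x.num * x.den : ℤ) : F) = U ^ 2 - a * W ^ 2) ∧
        ∃ U W : F, ((x.num * x.den : ℤ) : F) = U ^ 2 - b * W ^ 2 := by
    rintro F _ _ ⟨c₀, c₁, c₂, c₃, h⟩
    have hF : ((x.num * x.den : ℤ) : F) = x * x.den ^ 2 := by
      have := congrArg (Rat.cast : ℚ → F) hXx
      push_cast at this ⊢
      exact this
    unfold biquadraticNorm at h
    rw [hF, ← h]
    exact ⟨⟨x.den * (c₀ ^ 2 + a * c₁ ^ 2 - b * c₂ ^ 2 - a * b * c₃ ^ 2),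
      x.den * (2 * (c₀ * c₁ - b * c₂ * c₃)), by ring⟩,
      ⟨x.den * (c₀ ^ 2 + b * c₂ ^ 2 - a * c₁ ^ 2 - b * a * c₃ ^ 2),
      x.den * (2 * (c₀ * c₂ - a * c₁ * c₃)), by ring⟩⟩
  obtain ⟨z₀, z₁, hz⟩ := exists_norm_of_local_norms hX ha (fun p _ => (hsplit _ (hloc p)).1)
    (hsplit _ hreal).1
  obtain ⟨v₀, v₁, hv, hzv⟩ : ∃ v₀ v₁ : ℚ, ((x.num * x.den : ℤ) : ℚ) = v₀ ^ 2 - b * v₁ ^ 2 ∧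
      z₀ + v₀ ≠ 0 := by
    obtain ⟨v₀, v₁, hv⟩ := exists_norm_of_local_norms hX hb (fun p _ => (hsplit _ (hloc p)).2)
      (hsplit _ hreal).2
    by_cases h1 : z₀ + v₀ = 0
    · refine ⟨-v₀, v₁, by rw [hv]; ring, fun h2 => ?_⟩
      have hz0 : z₀ = 0 := by linarith
      have hv0 : v₀ = 0 := by linarith
      subst hz0 hv0
      have hab' : ¬ IsSquare ((a : ℚ) * b) := by
        rwa [← Int.cast_mul, Rat.isSquare_intCast_iff]
      have h3 := eq_zero_of_sq_eq_mul_sq (u := a * z₁) (w := v₁) hab'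
        (by linear_combination (a : ℚ) * (hz - hv))
      rw [h3.2] at hv
      exact hX (by exact_mod_cast (by simpa using hv : ((x.num * x.den : ℤ) : ℚ) = 0))
    · exact ⟨v₀, v₁, hv, h1⟩
  have hden : (x.den : ℚ) ≠ 0 := by simp
  have ht : 2 * (z₀ + v₀) * x.den ≠ 0 := mul_ne_zero (mul_ne_zero two_ne_zero hzv) hden
  obtain ⟨d₀, d₁, d₂, d₃, hd⟩ := exists_biquadraticNorm_eq_sq ha hb hab hp₀ hu hs hua hub hsa hsb
    (inv_ne_zero ht)
  have h1 : biquadraticNorm (a : ℚ) b (z₀ + v₀) z₁ v₁ 0 = x * (2 * (z₀ + v₀) * x.den) ^ 2 := by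
    rw [hXx] at hz hv
    have hU : (z₀ + v₀) ^ 2 + a * z₁ ^ 2 - b * v₁ ^ 2 - a * b * 0 ^ 2 = 2 * z₀ * (z₀ + v₀) := by
      linear_combination hz - hv
    unfold biquadraticNorm
    rw [hU]
    linear_combination (-4 * (z₀ + v₀) ^ 2) * hz
  have key : x = biquadraticNorm (a : ℚ) b (z₀ + v₀) z₁ v₁ 0 *
      biquadraticNorm (a : ℚ) b d₀ d₁ d₂ d₃ := by
    rw [h1, hd, mul_assoc, ← mul_pow, mul_inv_cancel₀ ht, one_pow, mul_one]
  rw [key, biquadraticNorm_mul]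
  exact ⟨_, _, _, _, rfl⟩

theorem isSquare_padic_of_isSquare_zmod {p : ℕ} [hp : Fact p.Prime] (hp2 : p ≠ 2) {d : ℤ}
    (hd : ¬ (p : ℤ) ∣ d) (h : IsSquare (d : ZMod p)) : IsSquare (d : ℚ_[p]) := by
  obtain ⟨r, hr⟩ := h
  obtain ⟨r, rfl⟩ := ZMod.intCast_surjective r
  have hdvd : (p : ℤ) ∣ r ^ 2 - d := by
    rw [← ZMod.intCast_zmod_eq_zero_iff_dvd]
    push_cast; rw [hr]; ring
  have hr0 : ¬ (p : ℤ) ∣ 2 * r := by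
    intro h2
    rcases (Nat.prime_iff_prime_int.mp hp.out).dvd_or_dvd h2 with h2 | h2
    · exact hp2 ((Nat.prime_dvd_prime_iff_eq hp.out Nat.prime_two).mp (by exact_mod_cast h2))
    · refine hd ?_
      have := dvd_sub (h2.trans (dvd_pow_self r two_ne_zero)) hdvd
      simpa using this
  obtain ⟨z, hz, -⟩ := hensels_lemma (p := p) (R := ℤ_[p])
    (F := Polynomial.X ^ 2 - Polynomial.C (d : ℤ_[p])) (a := (r : ℤ_[p])) (by
      have h1 : ‖((2 * r : ℤ) : ℤ_[p])‖ = 1 := by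
        refine le_antisymm (PadicInt.norm_le_one _) (not_lt.mp fun h => hr0 ?_)
        rwa [PadicInt.norm_int_lt_one_iff_dvd] at h
      have h2 : ‖((r ^ 2 - d : ℤ) : ℤ_[p])‖ < 1 := by
        rwa [PadicInt.norm_int_lt_one_iff_dvd]
      push_cast at h1 h2
      rw [norm_mul] at h1
      simpa [one_add_one_eq_two, h1] using h2)
  refine ⟨(z : ℚ_[p]), ?_⟩
  have : z ^ 2 = d := by simpa [sub_eq_zero] using hz
  rw [← sq, ← PadicInt.coe_pow, this]
  simp

theorem isSquare_padic_two {d : ℤ} (hd : d % 8 = 1) : IsSquare (d : ℚ_[2]) := by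
  obtain ⟨z, hz, -⟩ := hensels_lemma (p := 2) (R := ℤ_[2])
    (F := Polynomial.X ^ 2 - Polynomial.C (d : ℤ_[2])) (a := 1) (by
      have h1 : ‖(2 : ℤ_[2])‖ = 2⁻¹ := by simpa using PadicInt.norm_p (p := 2)
      have h2 : ‖((1 - d : ℤ) : ℤ_[2])‖ ≤ (2 : ℝ) ^ (-(3 : ℕ) : ℤ) := by
        have := (PadicInt.norm_int_le_pow_iff_dvd (p := 2) (k := 1 - d) (n := 3)).mpr
          (by norm_num; omega)
        exact_mod_cast this
      push_cast at h2
      simp only [map_sub, map_pow, Polynomial.aeval_X, Polynomial.aeval_C, one_pow,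
        Algebra.algebraMap_self_apply, Polynomial.derivative_X_pow, Polynomial.derivative_C]
      norm_num [h1] at h2 ⊢
      linarith)
  refine ⟨(z : ℚ_[2]), ?_⟩
  have : z ^ 2 = d := by simpa [sub_eq_zero] using hz
  rw [← sq, ← PadicInt.coe_pow, this]
  simp

/-- If one of `a`, `b`, `a * b` is a square in `F`, then every square is a value of the norm form
of `F[√a, √b]`. -/
theorem exists_biquadraticNorm_eq_sq_of_isSquare {F : Type*} [Field F] [CharZero F] {a b : F}
    (ha : a ≠ 0) (hb : b ≠ 0) (h : IsSquare a ∨ IsSquare b ∨ IsSquare (a * b)) (n : F) :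
    ∃ c₀ c₁ c₂ c₃ : F, biquadraticNorm a b c₀ c₁ c₂ c₃ = n ^ 2 := by
  have key : ∀ d : F, d ≠ 0 → IsSquare d → ∃ u w : F, u ^ 2 - d * w ^ 2 = n := by
    rintro _ hd ⟨s, rfl⟩
    have hs : s ≠ 0 := left_ne_zero_of_mul hd
    exact ⟨(n + 1) / 2, (n - 1) / (2 * s), by field_simp; ring⟩
  unfold biquadraticNorm
  rcases h with h | h | h
  · obtain ⟨u, w, h⟩ := key a ha h
    exact ⟨u, w, 0, 0, by rw [← h]; ring⟩
  · obtain ⟨u, w, h⟩ := key b hb h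
    exact ⟨u, 0, w, 0, by rw [← h]; ring⟩
  · obtain ⟨u, w, h⟩ := key _ (mul_ne_zero ha hb) h
    exact ⟨u, 0, 0, w, by rw [← h]; ring⟩

theorem hilbertSym_of_isSquare_padic {p : ℕ} [hp : Fact p.Prime] (hp2 : p ≠ 2) {d : ℤ} (hd : d ≠ 0)
    (h : IsSquare (d : ℚ_[p])) {c : ℤ} (hc : c ≠ 0) : hilbertSym p c d = 1 := by
  obtain ⟨s, hs⟩ := h
  have hs0 : s ≠ 0 := by rintro rfl; simp [hd] at hs
  exact hilbertSym_of_padic_norm hp2 hc hd (U := (c + 1) / 2) (W := (c - 1) / (2 * s))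
    (by rw [hs]; field_simp; ring)

theorem hilbertSym_two_of_mod_eight {d : ℤ} (hd : d % 8 = 1) {c : ℤ} (hc : c ≠ 0) :
    hilbertSym 2 c d = 1 := by
  have h := hilbertSym_congr Nat.prime_two (α := 0) (u := d) (u' := 1) (by norm_num; omega)
    (by norm_num; omega) hc
  have h1 := hilbertSym_sq_left 2 (c := 1) one_ne_zero hc
  rw [one_pow] at h1
  rw [hilbertSym_comm]
  simpa [h1] using h

/-- The symbol of a unit and an element of valuation one at an odd prime. -/
theorem hilbertSym_eq_legendreSym {p : ℕ} [hp : Fact p.Prime] (hp2 : p ≠ 2) {u a : ℤ}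
    (hu : ¬ (p : ℤ) ∣ u) (ha : Squarefree a) (hpa : (p : ℤ) ∣ a) :
    hilbertSym p u a = legendreSym p u := by
  obtain ⟨w, rfl⟩ := hpa
  have hw : ¬ (p : ℤ) ∣ w := fun h => by
    have := ha p (mul_dvd_mul_left _ h)
    exact (Nat.prime_iff_prime_int.mp hp.out).not_isUnit this
  have := hilbertSym_odd hp.out hp2 0 1 hu hw
  simpa [unitChar, hp2, jacobiSym.legendreSym.to_jacobiSym] using this

/-- The symbol of `5` and an element of valuation one at the prime `2`. -/
theorem hilbertSym_two_eq_neg_one {u b : ℤ} (hu : u % 8 = 5) (hb : b % 4 = 2) :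
    hilbertSym 2 u b = -1 := by
  obtain ⟨w, rfl⟩ : (2 : ℤ) ∣ b := by omega
  have := hilbertSym_eval Nat.prime_two 0 1 (u := u) (w := w) (by norm_num; omega)
    (by norm_num; omega)
  have h8 : (u : ZMod 8) = 5 := by
    rw [← ZMod.intCast_mod u 8]; norm_num [hu]
  have h5 : ZMod.χ₈ 5 = -1 := by decide
  have h4 : ¬ (u % 4 = 3 ∧ w % 4 = 3) := by omega
  simpa [unitChar, unitPairing, h8, h5, h4] using this

theorem not_isSquare_of_squarefree {d : ℤ} (hd : Squarefree d) (h1 : d ≠ 1) : ¬ IsSquare d := by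
  rintro ⟨r, rfl⟩
  rcases Int.isUnit_iff.mp (hd r dvd_rfl) with rfl | rfl <;> simp at h1

theorem squarefree_mul_of_isCoprime {m n : ℤ} (hm : Squarefree m) (hn : Squarefree n)
    (h : IsCoprime m n) : Squarefree (m * n) :=
  (squarefree_mul_iff).mpr ⟨h.isRelPrime, hm, hn⟩

theorem exists_legendreSym_eq_neg_one {p : ℕ} [hp : Fact p.Prime] (hp2 : p ≠ 2) :
    ∃ g : ℤ, legendreSym p g = -1 := by
  obtain ⟨x, hx⟩ := FiniteField.exists_nonsquare (F := ZMod p) (by rwa [ZMod.ringChar_zmod_n])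
  obtain ⟨g, rfl⟩ := ZMod.intCast_surjective x
  exact ⟨g, (legendreSym.eq_neg_one_iff p).mpr hx⟩

theorem isSquare_padic_of_legendreSym {d : ℤ} {p : ℕ} [Fact p.Prime] (hp2 : p ≠ 2)
    (hd : ¬ (p : ℤ) ∣ d) (h : legendreSym p d = 1) : IsSquare (d : ℚ_[p]) :=
  isSquare_padic_of_isSquare_zmod hp2 hd ((legendreSym.eq_one_iff p fun h0 =>
    hd ((ZMod.intCast_zmod_eq_zero_iff_dvd d p).mp h0)).mp h)

/-- At an odd prime dividing neither `a` nor `b`, one of `a`, `b`, `a * b` is a local square. -/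
theorem isSquare_padic_or {a b : ℤ} {p : ℕ} [hp : Fact p.Prime] (hp2 : p ≠ 2)
    (ha : ¬ (p : ℤ) ∣ a) (hb : ¬ (p : ℤ) ∣ b) :
    IsSquare (a : ℚ_[p]) ∨ IsSquare (b : ℚ_[p]) ∨ IsSquare ((a * b : ℤ) : ℚ_[p]) := by
  have hz : ∀ d : ℤ, ¬ (p : ℤ) ∣ d → (d : ZMod p) ≠ 0 := fun d hd h =>
    hd ((ZMod.intCast_zmod_eq_zero_iff_dvd d p).mp h)
  rcases legendreSym.eq_one_or_neg_one p (hz a ha) with h | h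
  · exact Or.inl (isSquare_padic_of_legendreSym hp2 ha h)
  rcases legendreSym.eq_one_or_neg_one p (hz b hb) with h' | h'
  · exact Or.inr (Or.inl (isSquare_padic_of_legendreSym hp2 hb h'))
  · exact Or.inr (Or.inr (isSquare_padic_of_legendreSym hp2 (not_dvd_mul hp.out ha hb)
      (by rw [legendreSym.mul, h, h']; rfl)))

/-- Failure of the local-global principle when every decomposition group is cyclic. -/
theorem exists_sq_local_norm_not_norm {a b : ℤ} (ha : Squarefree a) (ha1 : a ≠ 1) (hb : b ≠ 0)
    (ha8 : a % 8 = 1) (hb4 : b % 4 = 3 ∨ b % 4 = 2)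
    (hP : ∀ (p : ℕ) [Fact p.Prime], p ≠ 2 →
      IsSquare (a : ℚ_[p]) ∨ IsSquare (b : ℚ_[p]) ∨ IsSquare ((a * b : ℤ) : ℚ_[p])) :
    ∃ n : ℤ, n ≠ 0 ∧
      (∀ (p : ℕ) [Fact p.Prime],
        ∃ c₀ c₁ c₂ c₃ : ℚ_[p], biquadraticNorm (a : ℚ_[p]) b c₀ c₁ c₂ c₃ = n ^ 2) ∧
      (∃ c₀ c₁ c₂ c₃ : ℝ, biquadraticNorm (a : ℝ) b c₀ c₁ c₂ c₃ = n ^ 2) ∧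
      ∀ c₀ c₁ c₂ c₃ : ℚ, biquadraticNorm (a : ℚ) b c₀ c₁ c₂ c₃ ≠ n ^ 2 := by
  have ha0 : a ≠ 0 := ha.ne_zero
  have hpos : 0 < a ∨ 0 < b ∨ 0 < a * b := by
    by_contra! h
    exact absurd (mul_pos_of_neg_of_neg (lt_of_le_of_ne h.1 ha0) (lt_of_le_of_ne h.2.1 hb))
      (not_lt.mpr h.2.2)
  have hcov : ∀ v, (∀ c : ℤ, c ≠ 0 → hilbertSym v c a = 1) ∨
      (∀ c : ℤ, c ≠ 0 → hilbertSym v c b = 1) ∨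
      (∀ c : ℤ, c ≠ 0 → hilbertSym v c (a * b) = 1) := by
    intro v
    rcases eq_or_ne v 0 with rfl | hv0
    · have : ∀ d : ℤ, 0 < d → ∀ c : ℤ, c ≠ 0 → hilbertSym 0 c d = 1 := fun d hd c _ => by
        rw [hilbertSym_zero, if_neg fun h => absurd h.2 hd.le.not_gt]
      exact hpos.imp (this a) (Or.imp (this b) (this _))
    rcases eq_or_ne v 2 with rfl | hv2
    · exact Or.inl fun c hc => hilbertSym_two_of_mod_eight ha8 hc
    by_cases hv : v.Prime
    · have : Fact v.Prime := ⟨hv⟩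
      exact (hP v hv2).imp (fun h c hc => hilbertSym_of_isSquare_padic hv2 ha0 h hc)
        (Or.imp (fun h c hc => hilbertSym_of_isSquare_padic hv2 hb h hc)
          fun h c hc => hilbertSym_of_isSquare_padic hv2 (mul_ne_zero ha0 hb) h hc)
    · exact Or.inl fun c _ => hilbertSym_of_not_place hv0 hv c a
  obtain ⟨p₁, hp₁, hp₁a⟩ : ∃ p : ℕ, p.Prime ∧ (p : ℤ) ∣ a := by
    obtain ⟨p, hp, h⟩ := Nat.exists_prime_and_dvd (n := a.natAbs) (by omega)
    exact ⟨p, hp, Int.natCast_dvd.mpr h⟩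
  have hp₁2 : p₁ ≠ 2 := by
    rintro rfl
    push_cast at hp₁a
    omega
  have : Fact p₁.Prime := ⟨hp₁⟩
  obtain ⟨g₁, hg₁⟩ := exists_legendreSym_eq_neg_one hp₁2
  have hg₁p : ¬ (p₁ : ℤ) ∣ g₁ := fun h => by
    rw [(legendreSym.eq_zero_iff p₁ g₁).mpr ((ZMod.intCast_zmod_eq_zero_iff_dvd _ _).mpr h)] at hg₁
    norm_num at hg₁
  have hg₁0 : g₁ ≠ 0 := by
    rintro rfl
    exact hg₁p (dvd_zero _)
  obtain ⟨g₂, hg₂0, hg₂⟩ : ∃ g₂ : ℤ, g₂ ≠ 0 ∧ hilbertSym 2 g₂ b = -1 := by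
    rcases hb4 with h | h
    · exact ⟨3, by norm_num, by
        rw [hilbertSym_two_units (by norm_num) (by omega), if_pos ⟨by norm_num, h⟩]⟩
    · exact ⟨5, by norm_num, hilbertSym_two_eq_neg_one (by norm_num) h⟩
  obtain ⟨n, hn, hN⟩ := exists_sq_ne_biquadraticNorm ha0 hb hcov hp₁ Nat.prime_two
    hg₁0 hg₂0 (by rw [hilbertSym_eq_legendreSym hp₁2 hg₁p ha hp₁a, hg₁])
    hg₂ (fun c hc => hilbertSym_two_of_mod_eight ha8 hc)
  refine ⟨n, hn, fun p hp => ?_, ?_, hN⟩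
  · refine exists_biquadraticNorm_eq_sq_of_isSquare (by exact_mod_cast ha0) (by exact_mod_cast hb)
      ?_ _
    rcases eq_or_ne p 2 with rfl | hp2
    · exact Or.inl (isSquare_padic_two ha8)
    · simpa using hP p hp2
  · refine exists_biquadraticNorm_eq_sq_of_isSquare (by exact_mod_cast ha0) (by exact_mod_cast hb)
      ?_ _
    have : ∀ d : ℤ, 0 < d → IsSquare (d : ℝ) := fun d hd =>
      ⟨√d, (Real.mul_self_sqrt (by exact_mod_cast hd.le)).symm⟩
    simpa using hpos.imp (this a) (Or.imp (this b) (this _))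

theorem hilbertSym_neg_self_left (v : ℕ) {a : ℤ} (ha : a ≠ 0) : hilbertSym v (-a) a = 1 := by
  rw [hilbertSym_comm, hilbertSym_neg_self v ha]

/-- A nontrivial residue symbol at an odd prime makes the local degree four. -/
theorem exists_hilbertSym_of_dvd_left {a b : ℤ} (ha : Squarefree a) (hb : b ≠ 0) {p : ℕ}
    [hp : Fact p.Prime] (hp2 : p ≠ 2) (hpa : (p : ℤ) ∣ a) (hpb : ¬ (p : ℤ) ∣ b)
    (h : legendreSym p b ≠ 1) :
    ∃ u s : ℤ, u ≠ 0 ∧ s ≠ 0 ∧ hilbertSym p u a = 1 ∧ hilbertSym p u b = -1 ∧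
      hilbertSym p s a = -1 ∧ hilbertSym p s b = 1 := by
  have h1 : legendreSym p b = -1 := (legendreSym.eq_one_or_neg_one p fun h =>
    hpb ((ZMod.intCast_zmod_eq_zero_iff_dvd b p).mp h)).resolve_left h
  have hna : Squarefree (-a) := ha.squarefree_of_dvd (neg_dvd.mpr dvd_rfl)
  refine ⟨-a, b, neg_ne_zero.mpr ha.ne_zero, hb, hilbertSym_neg_self_left p ha.ne_zero, ?_, ?_,
    hilbertSym_unit hp2 hp.out.ne_zero hpb hpb⟩
  · rw [hilbertSym_comm, hilbertSym_eq_legendreSym hp2 hpb hna (dvd_neg.mpr hpa), h1]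
  · rw [hilbertSym_eq_legendreSym hp2 hpb ha hpa, h1]

/-- The case of `exists_hilbertSym_of_dvd_left` where the prime divides both radicands. -/
theorem exists_hilbertSym_of_dvd_both {m c d : ℤ} (ha : Squarefree (m * c))
    (hb : Squarefree (m * d)) {p : ℕ} [hp : Fact p.Prime] (hp2 : p ≠ 2) (hpm : (p : ℤ) ∣ m)
    (hpcd : ¬ (p : ℤ) ∣ c * d) (h : legendreSym p (c * d) ≠ 1) :
    ∃ u s : ℤ, u ≠ 0 ∧ s ≠ 0 ∧ hilbertSym p u (m * c) = 1 ∧ hilbertSym p u (m * d) = -1 ∧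
      hilbertSym p s (m * c) = -1 ∧ hilbertSym p s (m * d) = 1 := by
  have h1 : legendreSym p (c * d) = -1 := (legendreSym.eq_one_or_neg_one p fun h =>
    hpcd ((ZMod.intCast_zmod_eq_zero_iff_dvd _ p).mp h)).resolve_left h
  have hm0 : m ≠ 0 := left_ne_zero_of_mul ha.ne_zero
  have hcd0 : c * d ≠ 0 := mul_ne_zero (right_ne_zero_of_mul ha.ne_zero)
    (right_ne_zero_of_mul hb.ne_zero)
  have key : ∀ e f : ℤ, Squarefree (m * e) → m * f ≠ 0 → e * f = c * d →
      hilbertSym p (-(m * e)) (m * f) = -1 := by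
    intro e f he hf hef
    have hne : -(m * e) ≠ 0 := neg_ne_zero.mpr he.ne_zero
    have h2 : hilbertSym p (-(m * e)) (m * e * (m * f)) = hilbertSym p (-(m * e)) (c * d) := by
      rw [show m * e * (m * f) = c * d * m ^ 2 by rw [← hef]; ring, hilbertSym_comm,
        hilbertSym_mul_sq_left p hcd0 hne hm0, hilbertSym_comm]
    rw [hilbertSym_mul_right p hne he.ne_zero hf, hilbertSym_neg_self_left p he.ne_zero,
      one_mul] at h2
    rw [h2, hilbertSym_comm, hilbertSym_eq_legendreSym hp2 hpcd
      (he.squarefree_of_dvd (neg_dvd.mpr dvd_rfl)) (dvd_neg.mpr (hpm.mul_right e)), h1]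
  exact ⟨-(m * c), -(m * d), neg_ne_zero.mpr ha.ne_zero, neg_ne_zero.mpr hb.ne_zero,
    hilbertSym_neg_self_left p ha.ne_zero, key c d ha hb.ne_zero rfl,
    key d c hb ha.ne_zero (mul_comm _ _), hilbertSym_neg_self_left p hb.ne_zero⟩

/-- The prime `2` is inert in `ℚ(√a)` and ramified in `ℚ(√b)`. -/
theorem exists_hilbertSym_two {a b : ℤ} (ha8 : a % 8 = 5) (hb4 : b % 4 = 3 ∨ b % 4 = 2) :
    ∃ u s : ℤ, u ≠ 0 ∧ s ≠ 0 ∧ hilbertSym 2 u a = 1 ∧ hilbertSym 2 u b = -1 ∧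
      hilbertSym 2 s a = -1 ∧ hilbertSym 2 s b = 1 := by
  have hs : ∀ s : ℤ, s % 4 = 2 → hilbertSym 2 s a = -1 := fun s h => by
    rw [hilbertSym_comm]; exact hilbertSym_two_eq_neg_one ha8 h
  have hu : ∀ u : ℤ, ¬ (2 : ℤ) ∣ u → hilbertSym 2 u a = 1 := fun u h => by
    rw [hilbertSym_two_units h (by omega), if_neg (by omega)]
  rcases hb4 with h | h
  · exact ⟨3, 1 - b, by norm_num, by omega, hu 3 (by norm_num), by
      rw [hilbertSym_two_units (by norm_num) (by omega), if_pos ⟨by norm_num, h⟩],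
      hs _ (by omega), hilbertSym_of_add_eq_sq (C := 1) (by omega) (by omega) (by ring) 2⟩
  · exact ⟨5, -b, by norm_num, by omega, hu 5 (by norm_num),
      hilbertSym_two_eq_neg_one (by norm_num) h, hs _ (by omega),
      hilbertSym_neg_self_left 2 (by omega)⟩

theorem not_dvd_of_isCoprime {p : ℕ} (hp : p.Prime) {m n : ℤ} (h : IsCoprime m n)
    (hm : (p : ℤ) ∣ m) : ¬ (p : ℤ) ∣ n := fun hn =>
  (Nat.prime_iff_prime_int.mp hp).not_isUnit (h.isUnit_of_dvd' hm hn)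

/-- for pairwise coprime squarefree integers `m, a₁, b₁` (with the three
products `≠ 1`) satisfying `m ≡ a₁ (mod 4)` and `b₁ ≢ m (mod 4)`, the biquadratic field
`K = ℚ(√(m a₁), √(m b₁))` fails the Hasse norm principle iff
(i) every odd prime `p ∣ a₁` has `(m b₁ / p) = 1`, (ii) every odd prime `p ∣ b₁` has
`(m a₁ / p) = 1`, (iii) every odd prime `p ∣ m` has `(a₁ b₁ / p) = 1`, and
(iv) `m ≡ a₁ (mod 8)`. -/
theorem stmt_3 (m a₁ b₁ : ℤ)
    (hm : Squarefree m) (ha : Squarefree a₁) (hb : Squarefree b₁)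
    (hma : IsCoprime m a₁) (hmb : IsCoprime m b₁) (hab : IsCoprime a₁ b₁)
    (h₁ : m * a₁ ≠ 1) (h₂ : m * b₁ ≠ 1) (h₃ : a₁ * b₁ ≠ 1)
    (hmod : m % 4 = a₁ % 4) (hmod' : b₁ % 4 ≠ m % 4)
    (x y : AlgebraicClosure ℚ)
    (hx : x ^ 2 = ((m * a₁ : ℤ) : AlgebraicClosure ℚ))
    (hy : y ^ 2 = ((m * b₁ : ℤ) : AlgebraicClosure ℚ)) :
    ¬HasseNormPrinciple (IntermediateField.adjoin ℚ {x, y}) ↔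
      ((∀ (p : ℕ) [Fact p.Prime], p ≠ 2 → (p : ℤ) ∣ a₁ → legendreSym p (m * b₁) = 1) ∧
       (∀ (p : ℕ) [Fact p.Prime], p ≠ 2 → (p : ℤ) ∣ b₁ → legendreSym p (m * a₁) = 1) ∧
       (∀ (p : ℕ) [Fact p.Prime], p ≠ 2 → (p : ℤ) ∣ m → legendreSym p (a₁ * b₁) = 1) ∧
       m % 8 = a₁ % 8) := by
  have hsa := squarefree_mul_of_isCoprime hm ha hma
  have hsb := squarefree_mul_of_isCoprime hm hb hmb
  have hna := not_isSquare_of_squarefree hsa h₁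
  have hnb := not_isSquare_of_squarefree hsb h₂
  have hnab : ¬ IsSquare (m * a₁ * (m * b₁)) := by
    rw [← Rat.isSquare_intCast_iff]
    rintro ⟨r, hr⟩
    refine not_isSquare_of_squarefree (squarefree_mul_of_isCoprime ha hb hab) h₃
      (Rat.isSquare_intCast_iff.mp ⟨r / m, ?_⟩)
    have hm0 : (m : ℚ) ≠ 0 := by exact_mod_cast hm.ne_zero
    push_cast at hr ⊢
    field_simp
    linear_combination hr
  have hm2 : m % 2 = 1 := by
    by_contra h
    have := not_dvd_of_isCoprime Nat.prime_two hma (by push_cast; omega)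
    push_cast at this
    omega
  have hb4 : b₁ % 4 ≠ 0 := fun h => by
    have := hb 2 (by omega)
    rw [Int.isUnit_iff] at this
    omega
  have hmod8 : (m * a₁) % 8 = 1 ∧ m % 8 = a₁ % 8 ∨ (m * a₁) % 8 = 5 ∧ m % 8 ≠ a₁ % 8 := by
    have h1 : m % 8 = 1 ∨ m % 8 = 3 ∨ m % 8 = 5 ∨ m % 8 = 7 := by omega
    have h2 : a₁ % 8 = m % 8 ∨ a₁ % 8 = (m + 4) % 8 := by omega
    rw [Int.mul_emod]
    rcases h1 with h1 | h1 | h1 | h1 <;> rcases h2 with h2 | h2 <;>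
      simp [h2, h1, Int.add_emod]
  have hbmod : (m * b₁) % 4 = 3 ∨ (m * b₁) % 4 = 2 := by
    have h1 : m % 4 = 1 ∨ m % 4 = 3 := by omega
    have h2 : b₁ % 4 = 1 ∨ b₁ % 4 = 2 ∨ b₁ % 4 = 3 := by omega
    rw [Int.mul_emod]
    rcases h1 with h1 | h1 <;> rcases h2 with h2 | h2 | h2 <;> first
      | exact absurd (h2.trans h1.symm) hmod'
      | norm_num [h1, h2]
  have hratsq : ∀ d : ℤ, ¬ IsSquare d → ¬ IsSquare (d : ℚ) := fun d hd h =>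
    hd (Rat.isSquare_intCast_iff.mp h)
  obtain ⟨α, β, B, hα, hβ, hB⟩ := exists_basis_adjoin_pair (hratsq _ hna) (hratsq _ hnb)
    (by rw [← Int.cast_mul]; exact hratsq _ hnab) (x := x) (y := y) (by rw [hx]; simp)
    (by rw [hy]; simp)
  rw [hasseNormPrinciple_iff B hα hβ hB]
  constructor
  · intro hfail
    by_contra hcond
    refine hfail fun q hq ⟨hloc, hreal⟩ => ?_
    obtain ⟨p₀, hp₀, u, s, hu, hs, hua, hub, hsa', hsb'⟩ : ∃ p : ℕ, p.Prime ∧ ∃ u s : ℤ,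
        u ≠ 0 ∧ s ≠ 0 ∧ hilbertSym p u (m * a₁) = 1 ∧ hilbertSym p u (m * b₁) = -1 ∧
        hilbertSym p s (m * a₁) = -1 ∧ hilbertSym p s (m * b₁) = 1 := by
      contrapose! hcond with hno
      have hno' : ∀ p : ℕ, p.Prime → ¬ ∃ u s : ℤ,
          u ≠ 0 ∧ s ≠ 0 ∧ hilbertSym p u (m * a₁) = 1 ∧ hilbertSym p u (m * b₁) = -1 ∧
          hilbertSym p s (m * a₁) = -1 ∧ hilbertSym p s (m * b₁) = 1 := by
        rintro p hp ⟨u, s, h1, h2, h3, h4, h5, h6⟩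
        exact hno p hp u s h1 h2 h3 h4 h5 h6
      refine ⟨fun p hp hp2 hpa => ?_, fun p hp hp2 hpb => ?_, fun p hp hp2 hpm => ?_, ?_⟩
      · by_contra h
        exact hno' p hp.out (exists_hilbertSym_of_dvd_left hsa hsb.ne_zero hp2 (hpa.mul_left m)
          (not_dvd_mul hp.out (not_dvd_of_isCoprime hp.out hma.symm hpa)
            (not_dvd_of_isCoprime hp.out hab hpa)) h)
      · by_contra h
        obtain ⟨u, s, h1, h2, h3, h4, h5, h6⟩ := exists_hilbertSym_of_dvd_left hsb hsa.ne_zero hp2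
          (hpb.mul_left m) (not_dvd_mul hp.out (not_dvd_of_isCoprime hp.out hmb.symm hpb)
            (not_dvd_of_isCoprime hp.out hab.symm hpb)) h
        exact hno' p hp.out ⟨s, u, h2, h1, h6, h5, h4, h3⟩
      · by_contra h
        exact hno' p hp.out (exists_hilbertSym_of_dvd_both hsa hsb hp2 hpm
          (not_dvd_mul hp.out (not_dvd_of_isCoprime hp.out hma hpm)
            (not_dvd_of_isCoprime hp.out hmb hpm)) h)
      · rcases hmod8 with h | h
        · exact h.2
        · exact absurd (exists_hilbertSym_two h.1 hbmod) (hno' 2 Nat.prime_two)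
    exact exists_biquadraticNorm_eq_of_local hna hnb hnab hp₀ hu hs hua hub hsa' hsb' hq
      (by simpa using hloc) (by simpa using hreal)
  · rintro ⟨hi, hii, hiii, hiv⟩ hH
    have ha8 : (m * a₁) % 8 = 1 := by
      rcases hmod8 with h | h
      · exact h.1
      · exact absurd hiv h.2
    obtain ⟨n, hn, hloc, hreal, hglob⟩ := exists_sq_local_norm_not_norm hsa h₁ hsb.ne_zero ha8 hbmod
      (fun p hp hp2 => by
        by_cases hpm : (p : ℤ) ∣ m
        · refine Or.inr (Or.inr ?_)
          obtain ⟨r, hr⟩ := isSquare_padic_of_legendreSym hp2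
            (not_dvd_mul hp.out (not_dvd_of_isCoprime hp.out hma hpm)
            (not_dvd_of_isCoprime hp.out hmb hpm)) (hiii p hp2 hpm)
          refine ⟨m * r, ?_⟩
          push_cast at hr ⊢
          linear_combination (m : ℚ_[p]) ^ 2 * hr
        by_cases hpa : (p : ℤ) ∣ a₁
        · exact Or.inr (Or.inl (isSquare_padic_of_legendreSym hp2 (not_dvd_mul hp.out hpm
            (not_dvd_of_isCoprime hp.out hab hpa)) (hi p hp2 hpa)))
        by_cases hpb : (p : ℤ) ∣ b₁
        · exact Or.inl (isSquare_padic_of_legendreSym hp2 (not_dvd_mul hp.out hpm hpa)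
            (hii p hp2 hpb))
        exact isSquare_padic_or hp2 (not_dvd_mul hp.out hpm hpa) (not_dvd_mul hp.out hpm hpb))
    obtain ⟨c₀, c₁, c₂, c₃, hc⟩ := hH (n ^ 2) (pow_ne_zero 2 (by exact_mod_cast hn))
      ⟨by simpa using hloc, by simpa using hreal⟩
    exact hglob c₀ c₁ c₂ c₃ hc
end

section
/- Let m, a₁, b₁ be pairwise coprime squarefree integers with m·a₁ ≠ 1, m·b₁ ≠ 1 and a₁·b₁ ≠ 1, and let K = ℚ(√(m a₁), √(m b₁)), a biquadratic extension of ℚ. If the residues of m, a₁ and b₁ modulo 4 are pairwise distinct, then K satisfies the Hasse norm principle. -/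
open scoped TensorProduct

/-- The ternary form `X² - a Y² - b Z²` has a nontrivial zero over `F`. -/
def TernaryIsotropic {F : Type*} [Field F] (a b : F) : Prop :=
  ∃ x y z : F, (x ≠ 0 ∨ y ≠ 0 ∨ z ≠ 0) ∧ x ^ 2 = a * y ^ 2 + b * z ^ 2

namespace TernaryIsotropic

variable {F : Type*} [Field F] {a b : F}

theorem symm (h : TernaryIsotropic a b) : TernaryIsotropic b a := by
  obtain ⟨x, y, z, h0, h⟩ := h
  exact ⟨x, z, y, by tauto, by rw [h]; ring⟩

theorem of_isSquare_left (h : IsSquare a) : TernaryIsotropic a b := by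
  obtain ⟨t, rfl⟩ := h
  exact ⟨t, 1, 0, by simp, by ring⟩

theorem of_isSquare_right (h : IsSquare b) : TernaryIsotropic a b :=
  (of_isSquare_left h).symm

theorem mul_sq (h : TernaryIsotropic a b) {e : F} (he : e ≠ 0) :
    TernaryIsotropic a (b * e ^ 2) := by
  obtain ⟨x, y, z, h0, h⟩ := h
  refine ⟨x * e, y * e, z, by simpa [he] using h0, ?_⟩
  linear_combination e ^ 2 * h

theorem of_mul_sq {e : F} (h : TernaryIsotropic a (b * e ^ 2)) (he : e ≠ 0) :
    TernaryIsotropic a b := by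
  obtain ⟨x, y, z, h0, h⟩ := h
  exact ⟨x, y, z * e, by simpa [he] using h0, by rw [h]; ring⟩

/-- If `b * b'` is a norm `t² - a`, then isotropy for `b` implies isotropy for `b'`. -/
theorem of_mul_eq_sq_sub {b' t : F} (h : TernaryIsotropic a b) (hb : b ≠ 0)
    (ht : b * b' = t ^ 2 - a) : TernaryIsotropic a b' := by
  obtain ⟨x, y, z, h0, h⟩ := h
  rcases eq_or_ne z 0 with rfl | hz
  · exact ⟨x, y, 0, h0, by rw [h]; ring⟩
  · refine ⟨x * t + a * y, x + t * y, b * z, by simp [hb, hz], ?_⟩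
    linear_combination (t ^ 2 - a) * h - b * z ^ 2 * ht

/-- An isotropic form yields a representation of `b` by the norm form of `F(√a)`. -/
theorem exists_eq_sq_sub (h : TernaryIsotropic a b) (ha : ¬ IsSquare a) :
    ∃ x y : F, b = x ^ 2 - a * y ^ 2 := by
  obtain ⟨x, y, z, h0, h⟩ := h
  have hz : z ≠ 0 := by
    rintro rfl
    rcases eq_or_ne y 0 with rfl | hy
    · simp at h0 h
      exact h0 h
    · refine ha ⟨x / y, ?_⟩
      field_simp
      linear_combination -h
  refine ⟨x / z, y / z, ?_⟩
  field_simp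
  linear_combination -h

end TernaryIsotropic

/-- Scale a `p`-adic zero to a primitive integral one. -/
theorem TernaryIsotropic.exists_padicInt {p : ℕ} [Fact p.Prime] {a b : ℤ}
    (h : TernaryIsotropic (a : ℚ_[p]) b) :
    ∃ x y z : ℤ_[p], (x = 1 ∨ y = 1 ∨ z = 1) ∧ x ^ 2 = a * y ^ 2 + b * z ^ 2 := by
  obtain ⟨x, y, z, h0, h⟩ := h
  have key : ∀ m : ℚ_[p], m ≠ 0 → ‖x‖ ≤ ‖m‖ → ‖y‖ ≤ ‖m‖ → ‖z‖ ≤ ‖m‖ →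
      (x = m ∨ y = m ∨ z = m) →
      ∃ x y z : ℤ_[p], (x = 1 ∨ y = 1 ∨ z = 1) ∧ x ^ 2 = a * y ^ 2 + b * z ^ 2 := by
    intro m hm hx hy hz hor
    have hle : ∀ u : ℚ_[p], ‖u‖ ≤ ‖m‖ → ‖u / m‖ ≤ 1 := fun u hu => by
      rw [norm_div]
      exact div_le_one_of_le₀ hu (norm_nonneg _)
    refine ⟨⟨x / m, hle x hx⟩, ⟨y / m, hle y hy⟩, ⟨z / m, hle z hz⟩, ?_, ?_⟩
    · rcases hor with rfl | rfl | rfl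
      · left; apply PadicInt.ext; simp [hm]
      · right; left; apply PadicInt.ext; simp [hm]
      · right; right; apply PadicInt.ext; simp [hm]
    · apply PadicInt.ext
      push_cast
      change (x / m) ^ 2 = (a : ℚ_[p]) * (y / m) ^ 2 + b * (z / m) ^ 2
      field_simp
      exact h
  have hne : ∀ u v : ℚ_[p], u ≠ 0 → ‖u‖ ≤ ‖v‖ → v ≠ 0 := by
    rintro u v hu huv rfl
    simp at huv
    exact hu huv
  rcases le_total ‖x‖ ‖y‖ with h1 | h1 <;> rcases le_total ‖y‖ ‖z‖ with h2 | h2 <;>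
    rcases le_total ‖x‖ ‖z‖ with h3 | h3
  · exact key z (by rcases h0 with h | h | h; exacts [hne _ _ h h3, hne _ _ h h2, h]) h3 h2 le_rfl
      (by tauto)
  · exact key z (by rcases h0 with h | h | h
                    exacts [hne _ _ h (h1.trans h2), hne _ _ h h2, h]) (h1.trans h2) h2 le_rfl
      (by tauto)
  · exact key y (by rcases h0 with h | h | h; exacts [hne _ _ h h1, h, hne _ _ h h2]) h1 le_rfl h2
      (by tauto)
  · exact key y (by rcases h0 with h | h | h; exacts [hne _ _ h h1, h, hne _ _ h h2]) h1 le_rfl h2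
      (by tauto)
  · exact key z (by rcases h0 with h | h | h; exacts [hne _ _ h h3, hne _ _ h h2, h]) h3 h2 le_rfl
      (by tauto)
  · exact key x (by rcases h0 with h | h | h; exacts [h, hne _ _ h h1, hne _ _ h h3]) le_rfl h1 h3
      (by tauto)
  · exact key x (by rcases h0 with h | h | h
                    exacts [h, hne _ _ h h1, hne _ _ h (h2.trans h1)]) le_rfl h1 (h2.trans h1)
      (by tauto)
  · exact key x (by rcases h0 with h | h | h; exacts [h, hne _ _ h h1, hne _ _ h h3]) le_rfl h1 h3
      (by tauto)

theorem TernaryIsotropic.isSquare_zmod {p : ℕ} [Fact p.Prime] {a b : ℤ}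
    (h : TernaryIsotropic (a : ℚ_[p]) b) (hpb : (p : ℤ) ∣ b) (hsq : ¬ (p : ℤ) ^ 2 ∣ b) :
    IsSquare (a : ZMod p) := by
  obtain ⟨x, y, z, h0, h⟩ := h.exists_padicInt
  obtain ⟨c, rfl⟩ := hpb
  have hmod : (PadicInt.toZMod x) ^ 2 = (a : ZMod p) * (PadicInt.toZMod y) ^ 2 := by
    have := congrArg (PadicInt.toZMod (p := p)) h
    simpa using this
  rcases eq_or_ne (PadicInt.toZMod y) 0 with hy | hy
  · exfalso
    have hx : PadicInt.toZMod x = 0 := by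
      rw [hy] at hmod
      simpa using hmod
    have hdvd : ∀ u : ℤ_[p], PadicInt.toZMod u = 0 → (p : ℤ_[p]) ∣ u := fun u hu => by
      rw [← RingHom.mem_ker, PadicInt.ker_toZMod, PadicInt.maximalIdeal_eq_span_p,
        Ideal.mem_span_singleton] at hu
      exact hu
    have hz : z = 1 := by
      rcases h0 with rfl | rfl | h
      · simp at hx
      · simp at hy
      · exact h
    obtain ⟨x', rfl⟩ := hdvd x hx
    obtain ⟨y', rfl⟩ := hdvd y hy
    have hp : (p : ℤ_[p]) ≠ 0 := by exact_mod_cast (Fact.out : p.Prime).ne_zero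
    have hc : (c : ℤ_[p]) = p * (x' ^ 2 - a * y' ^ 2) := by
      apply mul_left_cancel₀ hp
      rw [hz] at h
      push_cast at h
      linear_combination -h
    have hc0 : (c : ZMod p) = 0 := by
      have := congrArg (PadicInt.toZMod (p := p)) hc
      simpa using this
    rw [ZMod.intCast_zmod_eq_zero_iff_dvd] at hc0
    exact hsq (by rw [pow_two]; exact mul_dvd_mul_left _ hc0)
  · refine ⟨PadicInt.toZMod x / PadicInt.toZMod y, ?_⟩
    field_simp
    rw [hmod]

/-- A square modulo every prime factor of a squarefree number is a square modulo that number. -/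
theorem exists_dvd_sq_sub_of_squarefree (a : ℤ) :
    ∀ n : ℕ, Squarefree n → (∀ p : ℕ, p.Prime → p ∣ n → IsSquare (a : ZMod p)) →
      ∃ t : ℤ, (n : ℤ) ∣ t ^ 2 - a := by
  intro n
  induction n using Nat.recOnPosPrimePosCoprime with
  | prime_pow p k hp hk =>
    intro hsq h
    obtain rfl : k = 1 := by
      rcases (Nat.squarefree_pow_iff hp.ne_one hk.ne').1 hsq with ⟨_, h⟩
      exact h
    obtain ⟨t, ht⟩ := h p hp (by simp)
    have : NeZero p := ⟨hp.ne_zero⟩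
    refine ⟨t.val, ?_⟩
    rw [pow_one, ← ZMod.intCast_zmod_eq_zero_iff_dvd]
    push_cast
    rw [ZMod.natCast_zmod_val, ht]
    ring
  | zero => intro h; simp at h
  | one => intro _ _; exact ⟨0, by simp⟩
  | coprime m n hm hn hco ihm ihn =>
    intro hsq h
    obtain ⟨s, hs⟩ := ihm (hsq.of_mul_left) fun p hp hd => h p hp (hd.mul_right _)
    obtain ⟨t, ht⟩ := ihn (hsq.of_mul_right) fun p hp hd => h p hp (hd.mul_left _)
    have hco' : IsCoprime (m : ℤ) n := Nat.isCoprime_iff_coprime.2 hco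
    obtain ⟨u, v, huv⟩ := hco'
    refine ⟨t * (u * m) + s * (v * n), ?_⟩
    push_cast
    apply IsCoprime.mul_dvd (Nat.isCoprime_iff_coprime.2 hco)
    · rw [show (t * (u * m) + s * (v * n)) ^ 2 - a = (s ^ 2 - a) +
        m * (u * (t - s) * (2 * s + u * m * (t - s))) by
          rw [show v * n = 1 - u * m by linear_combination huv]; ring]
      exact dvd_add hs (dvd_mul_right _ _)
    · rw [show (t * (u * m) + s * (v * n)) ^ 2 - a = (t ^ 2 - a) +
        n * (v * (s - t) * (2 * t + v * n * (s - t))) by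
          rw [show u * m = 1 - v * n by linear_combination huv]; ring]
      exact dvd_add ht (dvd_mul_right _ _)

/-- The Hasse-Minkowski theorem for `X² - a Y² - b Z²`, where the place `2` may be ignored. -/
theorem ternaryIsotropic_rat_of_local (a b : ℤ) (ha : a ≠ 0) (hb : b ≠ 0)
    (hp : ∀ (p : ℕ) [Fact p.Prime], p ≠ 2 → TernaryIsotropic (a : ℚ_[p]) b)
    (hr : TernaryIsotropic (a : ℝ) b) : TernaryIsotropic (a : ℚ) b := by
  induction hn : a.natAbs + b.natAbs using Nat.strong_induction_on generalizing a b with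
  | _ n ih =>
  wlog hab : a.natAbs ≤ b.natAbs generalizing a b
  · exact (this b a hb ha (fun p _ h2 => (hp p h2).symm) hr.symm (by omega) (by omega)).symm
  by_cases hsq : Squarefree b
  · rcases eq_or_ne b.natAbs 1 with hb1 | hb1
    · have ha1 : a.natAbs = 1 := by
        have := Int.natAbs_pos.2 ha
        omega
      rcases Int.natAbs_eq_iff.1 ha1 with rfl | rfl
      · exact .of_isSquare_left ⟨1, by simp⟩
      rcases Int.natAbs_eq_iff.1 hb1 with rfl | rfl
      · exact .of_isSquare_right ⟨1, by simp⟩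
      exfalso
      obtain ⟨x, y, z, h0, h⟩ := hr
      push_cast at h
      have hx : x = 0 := by nlinarith [sq_nonneg x, sq_nonneg y, sq_nonneg z]
      have hy : y = 0 := by nlinarith [sq_nonneg x, sq_nonneg y, sq_nonneg z]
      have hz : z = 0 := by nlinarith [sq_nonneg x, sq_nonneg y, sq_nonneg z]
      simp [hx, hy, hz] at h0
    · have hb2 : 2 ≤ b.natAbs := by
        have := Int.natAbs_pos.2 hb
        omega
      have hsqp : ∀ p : ℕ, p.Prime → p ∣ b.natAbs → IsSquare (a : ZMod p) := by
        intro p hpp hd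
        have : Fact p.Prime := ⟨hpp⟩
        rcases eq_or_ne p 2 with rfl | h2
        · generalize (a : ZMod 2) = c
          revert c
          decide
        · refine (hp p h2).isSquare_zmod (Int.natCast_dvd.2 hd) fun h => ?_
          rw [pow_two] at h
          have := hsq _ h
          rw [Int.isUnit_iff_natAbs_eq] at this
          exact hpp.one_lt.ne' (by simpa using this)
      obtain ⟨s, hs⟩ := exists_dvd_sq_sub_of_squarefree a b.natAbs
        (Int.squarefree_natAbs.2 hsq) hsqp
      obtain ⟨t, ht, hdt⟩ : ∃ t : ℤ, 2 * t.natAbs ≤ b.natAbs ∧ b ∣ t ^ 2 - a := by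
        refine ⟨s.bmod b.natAbs, ?_, ?_⟩
        · have h1 := Int.le_bmod (x := s) (m := b.natAbs) (by omega)
          have h2 := Int.bmod_le (x := s) (m := b.natAbs) (by omega)
          omega
        · rw [← Int.natAbs_dvd]
          have : (b.natAbs : ℤ) ∣ s.bmod b.natAbs - s := by
            exact Int.dvd_bmod_sub_self
          have h3 : (s.bmod b.natAbs) ^ 2 - a =
            (s ^ 2 - a) + (s.bmod b.natAbs - s) * (s.bmod b.natAbs + s) := by ring
          rw [h3]
          exact dvd_add hs (this.mul_right _)
      obtain ⟨b', hb'⟩ := hdt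
      rcases eq_or_ne b' 0 with rfl | hb0
      · exact .of_isSquare_left ⟨t, by
          have : a = t * t := by linear_combination -hb'
          rw [this]; push_cast; rfl⟩
      have hlt : b'.natAbs < b.natAbs := by
        have h1 : |b| * |b'| ≤ t ^ 2 + |a| := by
          rw [← abs_mul, ← hb']
          calc |t ^ 2 - a| ≤ |t ^ 2| + |a| := abs_sub _ _
            _ = t ^ 2 + |a| := by rw [abs_sq]
        have h2 : 2 * |t| ≤ |b| := by simp only [Int.abs_eq_natAbs]; omega
        have h3 : |a| ≤ |b| := by simp only [Int.abs_eq_natAbs]; omega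
        have h4 : 2 ≤ |b| := by simp only [Int.abs_eq_natAbs]; omega
        have h5 : 4 * t ^ 2 ≤ |b| ^ 2 := by
          rw [← sq_abs t]
          nlinarith [abs_nonneg t]
        have h6 : |b'| < |b| := by
          by_contra hcon
          push Not at hcon
          nlinarith
        simp only [Int.abs_eq_natAbs] at h6
        omega
      have hcast : ∀ {F : Type} [Field F], (b : F) * (b' : F) = (t : F) ^ 2 - (a : F) := by
        intro F _
        exact_mod_cast congrArg (Int.cast : ℤ → F) hb'.symm
      refine TernaryIsotropic.of_mul_eq_sq_sub (b := (b' : ℚ)) (t := t) ?_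
        (by exact_mod_cast hb0) (by rw [mul_comm]; exact hcast)
      refine ih (a.natAbs + b'.natAbs) (by omega) a b' ha hb0 (fun p _ h2 => ?_) ?_ rfl
      · exact (hp p h2).of_mul_eq_sq_sub (by exact_mod_cast hb) hcast
      · exact hr.of_mul_eq_sq_sub (by exact_mod_cast hb) hcast
  · obtain ⟨e, c, rfl, he⟩ : ∃ e c : ℤ, b = c * e ^ 2 ∧ ¬ IsUnit e := by
      unfold Squarefree at hsq
      push Not at hsq
      obtain ⟨e, ⟨c, hc⟩, he⟩ := hsq
      exact ⟨e, c, by rw [hc]; ring, he⟩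
    have hc0 : c ≠ 0 := left_ne_zero_of_mul hb
    have he0 : e ≠ 0 := by rintro rfl; simp at hb
    have hlt : c.natAbs < (c * e ^ 2).natAbs := by
      rw [Int.natAbs_mul, Int.natAbs_pow]
      have h1 : 2 ≤ e.natAbs := by
        have := Int.natAbs_pos.2 he0
        rw [Int.isUnit_iff_natAbs_eq] at he
        omega
      have := Int.natAbs_pos.2 hc0
      nlinarith [Nat.mul_le_mul_left c.natAbs (Nat.pow_le_pow_left h1 2)]
    push_cast at hp hr ⊢
    refine TernaryIsotropic.mul_sq ?_ (by exact_mod_cast he0)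
    exact ih (a.natAbs + c.natAbs) (by omega) a c ha hc0
      (fun p _ h2 => (hp p h2).of_mul_sq (by exact_mod_cast he0))
      (hr.of_mul_sq (by exact_mod_cast he0)) rfl

/-- Hensel's lemma: a `p`-adic unit that is a square modulo the odd prime `p` is a square. -/
theorem padic_isSquare_of_zmod {p : ℕ} [Fact p.Prime] (hp : p ≠ 2) {u : ℤ}
    (hu : (u : ZMod p) ≠ 0) (hsq : IsSquare (u : ZMod p)) : IsSquare (u : ℚ_[p]) := by
  obtain ⟨t, ht⟩ := hsq
  obtain ⟨s, rfl⟩ := ZMod.intCast_surjective t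
  have hs : (s : ZMod p) ≠ 0 := by
    intro h
    rw [h] at ht
    simp [ht] at hu
  have h2 : ((2 * s : ℤ) : ZMod p) ≠ 0 := by
    push_cast
    refine mul_ne_zero (fun h => hp ?_) hs
    have h2 : ((2 : ℕ) : ZMod p) = 0 := by exact_mod_cast h
    rw [ZMod.natCast_eq_zero_iff] at h2
    exact (Nat.prime_dvd_prime_iff_eq Fact.out Nat.prime_two).1 h2
  have hunit : ‖((2 * s : ℤ) : ℤ_[p])‖ = 1 := by
    refine le_antisymm (PadicInt.norm_le_one _) (not_lt.1 fun h => h2 ?_)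
    rw [PadicInt.norm_intCast_lt_one_iff] at h
    rwa [ZMod.intCast_zmod_eq_zero_iff_dvd]
  have hsmall : ‖((s ^ 2 - u : ℤ) : ℤ_[p])‖ < 1 := by
    rw [PadicInt.norm_intCast_lt_one_iff, ← ZMod.intCast_zmod_eq_zero_iff_dvd]
    push_cast
    rw [ht]
    ring
  obtain ⟨z, hz, -⟩ := hensels_lemma (p := p) (R := ℤ_[p])
    (F := (Polynomial.X ^ 2 - Polynomial.C (u : ℤ_[p]))) (a := (s : ℤ_[p])) (by
      simp only [Polynomial.derivative_X_pow, Polynomial.derivative_C,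
        map_sub, map_pow, Polynomial.aeval_X, Polynomial.aeval_C]
      push_cast at hunit hsmall
      simpa [hunit] using hsmall)
  refine ⟨(z : ℚ_[p]), ?_⟩
  have : z ^ 2 - (u : ℤ_[p]) = 0 := by simpa using hz
  have h3 : ((z ^ 2 : ℤ_[p]) : ℚ_[p]) = ((u : ℤ_[p]) : ℚ_[p]) := by rw [sub_eq_zero.1 this]
  push_cast at h3
  rw [← h3, sq]

/-- Ternary forms with unit coefficients are isotropic at odd primes. -/
theorem ternaryIsotropic_padic_of_units {p : ℕ} [Fact p.Prime] (hp : p ≠ 2) {a b : ℤ}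
    (ha : (a : ZMod p) ≠ 0) (hb : (b : ZMod p) ≠ 0) : TernaryIsotropic (a : ℚ_[p]) b := by
  obtain ⟨y, z, h⟩ : ∃ y z : ZMod p, z ^ 2 = a * y ^ 2 + b := by
    obtain ⟨x, y, h⟩ := FiniteField.exists_root_sum_quadratic (R := ZMod p)
      (f := Polynomial.C 1 * Polynomial.X ^ 2 + Polynomial.C 0 * Polynomial.X + Polynomial.C 0)
      (g := Polynomial.C (-a : ZMod p) * Polynomial.X ^ 2 + Polynomial.C 0 * Polynomial.X
        + Polynomial.C (-b : ZMod p))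
      (Polynomial.degree_quadratic one_ne_zero)
      (Polynomial.degree_quadratic (neg_ne_zero.2 ha))
      (by rw [ZMod.card]; exact (Fact.out : p.Prime).mod_two_eq_one_iff_ne_two.2 hp)
    refine ⟨y, x, ?_⟩
    simp at h
    linear_combination h
  obtain ⟨y, rfl⟩ := ZMod.intCast_surjective y
  rcases eq_or_ne z 0 with rfl | hz
  · have hy : (y : ZMod p) ≠ 0 := by
      intro hy
      rw [hy] at h
      simp at h
      exact hb h.symm
    obtain ⟨s, hs⟩ := padic_isSquare_of_zmod (u := -a * b) hp
      (by push_cast; exact mul_ne_zero (neg_ne_zero.2 ha) hb)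
      ⟨a * y, by push_cast; linear_combination (a : ZMod p) * h⟩
    push_cast at hs
    refine ⟨0, s, a, Or.inr (Or.inr ?_), ?_⟩
    · intro h0
      have : (a : ℤ) = 0 := by exact_mod_cast h0
      simp [this] at ha
    · linear_combination (a : ℚ_[p]) * hs
  · obtain ⟨s, hs⟩ := padic_isSquare_of_zmod (u := a * y ^ 2 + b) hp
      (by push_cast; rw [← h]; exact pow_ne_zero 2 hz)
      ⟨z, by push_cast; rw [← h]; ring⟩
    push_cast at hs
    exact ⟨s, y, 1, by simp, by linear_combination -hs⟩

/-- A version of Legendre's theorem: no condition is needed at the prime `2`. -/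
theorem ternaryIsotropic_of_legendre {d n : ℤ} (hd : d ≠ 0) (hn : 0 < n)
    (h1 : ∀ p : ℕ, p.Prime → p ≠ 2 → (p : ℤ) ∣ n →
      (d : ZMod p) ≠ 0 ∧ IsSquare (d : ZMod p))
    (h2 : ∀ p : ℕ, p.Prime → p ≠ 2 → (p : ℤ) ∣ d →
      (n : ZMod p) ≠ 0 ∧ IsSquare (n : ZMod p)) :
    TernaryIsotropic (d : ℚ) n := by
  refine ternaryIsotropic_rat_of_local d n hd hn.ne' (fun p hp hp2 => ?_)
    (.of_isSquare_right ⟨√n, (Real.mul_self_sqrt (by exact_mod_cast hn.le)).symm⟩)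
  by_cases hpn : (p : ℤ) ∣ n
  · obtain ⟨h, h'⟩ := h1 p hp.out hp2 hpn
    exact .of_isSquare_left (padic_isSquare_of_zmod hp2 h h')
  by_cases hpd : (p : ℤ) ∣ d
  · obtain ⟨h, h'⟩ := h2 p hp.out hp2 hpd
    exact .of_isSquare_right (padic_isSquare_of_zmod hp2 h h')
  rw [← ZMod.intCast_zmod_eq_zero_iff_dvd] at hpn hpd
  exact ternaryIsotropic_padic_of_units hp2 hpd hpn

/-- `c` is a value of the norm form of `ℚ(√d)`. -/
def IsQuadNorm (d c : ℚ) : Prop := ∃ x y : ℚ, c = x ^ 2 - d * y ^ 2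

namespace IsQuadNorm

variable {d c c' : ℚ}

theorem sq (d t : ℚ) : IsQuadNorm d (t ^ 2) := ⟨t, 0, by ring⟩

theorem mul (h : IsQuadNorm d c) (h' : IsQuadNorm d c') : IsQuadNorm d (c * c') := by
  obtain ⟨x, y, rfl⟩ := h
  obtain ⟨z, w, rfl⟩ := h'
  exact ⟨x * z + d * y * w, x * w + y * z, by ring⟩

end IsQuadNorm

/-- `c` is a product of norms from the quadratic fields `ℚ(√(g h))`, `ℚ(√(g k))`,
`ℚ(√(h k))`. -/
def IsNormProduct (g h k : ℤ) (c : ℚ) : Prop :=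
  ∃ r s t : ℚ, IsQuadNorm (g * h) r ∧ IsQuadNorm (g * k) s ∧ IsQuadNorm (h * k) t ∧
    c = r * s * t

namespace IsNormProduct

variable {g h k : ℤ} {c c' : ℚ}

theorem swap_left (H : IsNormProduct g h k c) : IsNormProduct h g k c := by
  obtain ⟨r, s, t, hr, hs, ht, rfl⟩ := H
  exact ⟨r, t, s, by rwa [mul_comm], ht, hs, by ring⟩

theorem swap_right (H : IsNormProduct g h k c) : IsNormProduct g k h c := by
  obtain ⟨r, s, t, hr, hs, ht, rfl⟩ := H
  exact ⟨s, r, t, hs, hr, by rwa [mul_comm], by ring⟩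

theorem mul (H : IsNormProduct g h k c) (H' : IsNormProduct g h k c') :
    IsNormProduct g h k (c * c') := by
  obtain ⟨r, s, t, hr, hs, ht, rfl⟩ := H
  obtain ⟨r', s', t', hr', hs', ht', rfl⟩ := H'
  exact ⟨r * r', s * s', t * t', hr.mul hr', hs.mul hs', ht.mul ht', by ring⟩

theorem of_isQuadNorm (H : IsQuadNorm (g * h) c) : IsNormProduct g h k c :=
  ⟨c, 1, 1, H, by simpa using IsQuadNorm.sq (g * k) 1, by simpa using IsQuadNorm.sq (h * k) 1,
    by ring⟩

theorem sq (g h k : ℤ) (t : ℚ) : IsNormProduct g h k (t ^ 2) :=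
  of_isQuadNorm (IsQuadNorm.sq _ t)

theorem of_mul_left (H : IsNormProduct g h k (c * c')) (H' : IsNormProduct g h k c)
    (hc : c ≠ 0) : IsNormProduct g h k c' := by
  have := (H.mul H').mul (sq g h k c⁻¹)
  convert this using 1
  field_simp

end IsNormProduct

open NumberTheorySymbols in
theorem jacobiSym_eq_of_mod_four_eq_one {e : ℤ} (he : e % 4 = 1) {q : ℕ} (hq : Odd q) :
    J(e | q) = J(q | e.natAbs) := by
  rcases Int.natAbs_eq e with h | h
  · have h1 : e.natAbs % 4 = 1 := by omega
    conv_lhs => rw [h]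
    exact jacobiSym.quadratic_reciprocity_one_mod_four h1 hq
  · have h1 : e.natAbs % 4 = 3 := by omega
    have hodd : Odd e.natAbs := Nat.odd_iff.2 (by omega)
    conv_lhs => rw [h]
    rw [neg_eq_neg_one_mul, jacobiSym.mul_left, jacobiSym.at_neg_one hq]
    obtain h2 | h2 : q % 4 = 1 ∨ q % 4 = 3 := by
      have := Nat.odd_iff.1 hq
      omega
    · rw [jacobiSym.quadratic_reciprocity_one_mod_four' hodd h2, ZMod.χ₄_nat_one_mod_four h2,
        one_mul]
    · rw [jacobiSym.quadratic_reciprocity_three_mod_four h1 h2, ZMod.χ₄_nat_three_mod_four h2]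
      ring

/-- Primes splitting completely in the biquadratic field attached to `g, h, k` exist in every
residue class modulo the odd prime factors of `g h k`. -/
def HasSplitPrimes (g h k : ℤ) : Prop :=
  ∀ (N : ℕ) (s : ℕ → ℕ), (∀ p, p.Prime → (s p : ZMod p) ≠ 0) →
    ∃ q > N, q.Prime ∧ (∀ p : ℕ, p.Prime → p ≠ 2 → (p : ℤ) ∣ g * h * k →
      (q : ZMod p) = s p) ∧ jacobiSym (g * h) q = 1 ∧ jacobiSym (g * k) q = 1 ∧
        jacobiSym (h * k) q = 1

namespace HasSplitPrimes

variable {g h k : ℤ}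

theorem swap_left (H : HasSplitPrimes g h k) : HasSplitPrimes h g k := by
  intro N s hs
  obtain ⟨q, hN, hq, hp, h1, h2, h3⟩ := H N s hs
  exact ⟨q, hN, hq, by rwa [mul_comm h g], by rwa [mul_comm h g], h3, h2⟩

theorem swap_right (H : HasSplitPrimes g h k) : HasSplitPrimes g k h := by
  intro N s hs
  obtain ⟨q, hN, hq, hp, h1, h2, h3⟩ := H N s hs
  exact ⟨q, hN, hq, by rwa [mul_right_comm], h2, h1, by rwa [mul_comm k h]⟩

open NumberTheorySymbols in
theorem of_mod_four (hg : g % 4 = 1) (hh : h % 4 = 3) (hk : k % 4 = 2) :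
    HasSplitPrimes g h k := by
  intro N s hs
  obtain ⟨t, rfl⟩ : ∃ t, k = 2 * t := ⟨k / 2, by omega⟩
  have ht : t % 2 = 1 := by omega
  have hg0 : g ≠ 0 := by omega
  have hh0 : h ≠ 0 := by omega
  have ht0 : t ≠ 0 := by omega
  let S : Finset ℕ := (g * h * t).natAbs.primeFactors
  have hS : ∀ p ∈ S, p.Prime := fun p hp => Nat.prime_of_mem_primeFactors hp
  have hghtodd : (g * h * t) % 2 = 1 := by
    have : g * h % 2 = 1 := by
      rw [Int.mul_emod, show g % 2 = 1 by omega, show h % 2 = 1 by omega]; rfl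
    rw [Int.mul_emod, this, ht]; rfl
  obtain ⟨⟨c, hcmod⟩, -⟩ : ∃ c : {c : ℕ // ∀ p ∈ S, c ≡ s p [MOD p]}, True :=
    ⟨Nat.chineseRemainderOfFinset s id S (fun p hp => (hS p hp).ne_zero)
      (fun p hp q hq hpq => (Nat.coprime_primes (hS p hp) (hS q hq)).2 hpq), trivial⟩
  let M := (g * h * t).natAbs
  have hM0 : M ≠ 0 := Int.natAbs_ne_zero.2 (by positivity)
  have hMsub : ∀ p : ℕ, p.Prime → p ∣ M → p ∈ S := fun p hp hd =>
    Nat.mem_primeFactors.2 ⟨hp, hd, hM0⟩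
  have hcM : Nat.Coprime c M := by
    refine Nat.Coprime.symm (Nat.coprime_of_dvd fun p hp hd hdc => ?_)
    have h1 := (ZMod.natCast_eq_natCast_iff _ _ _).2 (hcmod p (hMsub p hp hd))
    apply hs p hp
    rw [← h1]
    exact (ZMod.natCast_eq_zero_iff _ _).2 hdc
  have hM2 : Nat.Coprime 8 M := by
    have : Odd M := Nat.odd_iff.2 (by omega)
    have := Nat.coprime_two_left.2 this
    exact Nat.Coprime.pow_left 3 this
  have hjac : ∀ e : ℤ, e.natAbs ∣ M → J(c | e.natAbs) = 1 ∨ J(c | e.natAbs) = -1 := by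
    intro e he
    exact jacobiSym.eq_one_or_neg_one (by
      rw [Int.gcd_natCast_natCast]
      exact hcM.coprime_dvd_right he)
  have hdiv1 : (g * h).natAbs ∣ M := Int.natAbs_dvd_natAbs.2 (dvd_mul_right _ _)
  have hdiv2 : (g * t).natAbs ∣ M := Int.natAbs_dvd_natAbs.2 ⟨h, by ring⟩
  obtain ⟨r, hr8, hr4, hr8'⟩ : ∃ r : ℕ, Nat.Coprime r 8 ∧ ZMod.χ₄ r = J(c | (g * h).natAbs) ∧
      (∀ q : ℕ, Odd q → ZMod.χ₄ q = ZMod.χ₄ r → ZMod.χ₈ q = ZMod.χ₈ r →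
        J(q | (g * t).natAbs) = J(c | (g * t).natAbs) → J(2 * (g * t) | q) = 1) := by
    have aux : ∀ A B : ℤ, (A = 1 ∨ A = -1) → (B = 1 ∨ B = -1) →
        ∃ r : ℕ, Nat.Coprime r 8 ∧ ZMod.χ₄ r = A ∧ ZMod.χ₈ r = B := by
      rintro A B (rfl | rfl) (rfl | rfl)
      exacts [⟨1, by decide, by decide, by decide⟩, ⟨5, by decide, by decide, by decide⟩,
        ⟨7, by decide, by decide, by decide⟩, ⟨3, by decide, by decide, by decide⟩]
    have hA := hjac _ hdiv1
    have hB := hjac _ hdiv2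
    have hgt : (g * t) % 4 = 1 ∨ (g * t) % 4 = 3 := by
      have : g * t % 2 = 1 := by
        rw [Int.mul_emod, show g % 2 = 1 by omega, ht]; rfl
      omega
    rcases hgt with hgt | hgt
    · obtain ⟨r, h1, h2, h3⟩ := aux _ _ hA hB
      refine ⟨r, h1, h2, fun q hq h4 h5 h6 => ?_⟩
      rw [jacobiSym.mul_left, jacobiSym.at_two hq, jacobiSym_eq_of_mod_four_eq_one hgt hq, h6, h5,
        h3]
      rcases hB with h | h <;> rw [h] <;> rfl
    · obtain ⟨r, h1, h2, h3⟩ := aux _ (J(c | (g * h).natAbs) * J(c | (g * t).natAbs)) hA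
        (by rcases hA with h | h <;> rcases hB with h' | h' <;> rw [h, h'] <;> decide)
      refine ⟨r, h1, h2, fun q hq h4 h5 h6 => ?_⟩
      rw [show 2 * (g * t) = 2 * (-1 * (-(g * t))) by ring, jacobiSym.mul_left,
        jacobiSym.mul_left, jacobiSym.at_two hq, jacobiSym.at_neg_one hq,
        jacobiSym_eq_of_mod_four_eq_one (by omega) hq, Int.natAbs_neg, h6, h5, h4, h3, h2]
      rcases hA with h | h <;> rcases hB with h' | h' <;> rw [h, h'] <;> rfl
  obtain ⟨c', hc8, hcM'⟩ := Nat.chineseRemainder hM2 r c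
  obtain ⟨q, hqN, hqp, hqc⟩ := Nat.forall_exists_prime_gt_and_modEq N (q := 8 * M) (a := c')
    (by positivity) (by
      refine Nat.Coprime.mul_right ?_ ?_
      · rw [Nat.Coprime, hc8.gcd_eq]; exact hr8
      · rw [Nat.Coprime, hcM'.gcd_eq]; exact hcM)
  have hq8 : q ≡ r [MOD 8] := (hqc.of_mul_right _).trans hc8
  have hqM : q ≡ c [MOD M] := (hqc.of_mul_left _).trans hcM'
  have hqodd : Odd q := by
    refine Nat.odd_iff.2 ?_
    have h1 : q % 2 = r % 2 := hq8.of_dvd (by norm_num)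
    have h2 := Nat.odd_iff.1 (Nat.coprime_two_right.1 (hr8.coprime_dvd_right (by norm_num : 2 ∣ 8)))
    omega
  have hq4 : ZMod.χ₄ q = ZMod.χ₄ r := by
    have : (q : ZMod 4) = r := (ZMod.natCast_eq_natCast_iff _ _ _).2 (hq8.of_dvd (by norm_num))
    rw [this]
  have hq8' : ZMod.χ₈ q = ZMod.χ₈ r := by
    have : (q : ZMod 8) = r := (ZMod.natCast_eq_natCast_iff _ _ _).2 hq8
    rw [this]
  have hJ : ∀ e : ℤ, e.natAbs ∣ M → J(q | e.natAbs) = J(c | e.natAbs) := fun e he =>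
    jacobiSym.mod_left' (by exact_mod_cast hqM.of_dvd he)
  have hgh4 : -(g * h) % 4 = 1 := by
    have : g * h % 4 = 3 := by rw [Int.mul_emod, hg, hh]; rfl
    omega
  have hJ1 : J(g * h | q) = 1 := by
    rw [show g * h = -1 * (-(g * h)) by ring, jacobiSym.mul_left, jacobiSym.at_neg_one hqodd,
      jacobiSym_eq_of_mod_four_eq_one hgh4 hqodd, Int.natAbs_neg, hJ _ hdiv1, hq4, hr4]
    rcases hjac _ hdiv1 with h | h <;> rw [h] <;> rfl
  have hJ2 : J(g * (2 * t) | q) = 1 := by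
    rw [show g * (2 * t) = 2 * (g * t) by ring]
    exact hr8' q hqodd hq4 hq8' (hJ _ hdiv2)
  refine ⟨q, hqN, hqp, ?_, hJ1, hJ2, ?_⟩
  · intro p hp hp2 hpd
    have hpM : p ∣ M := by
      rw [← Int.natCast_dvd]
      rw [show g * h * (2 * t) = 2 * (g * h * t) by ring] at hpd
      rcases (Nat.prime_iff_prime_int.1 hp).dvd_or_dvd hpd with h | h
      · have h' : p ∣ 2 := by exact_mod_cast h
        exact absurd ((Nat.prime_dvd_prime_iff_eq hp Nat.prime_two).1 h') hp2
      · exact h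
    exact (ZMod.natCast_eq_natCast_iff _ _ _).2
      ((hqM.of_dvd hpM).trans (hcmod p (hMsub p hp hpM)))
  · have hgq : g.gcd q = 1 := by
      by_contra hne
      have : J(g | q) = 0 := jacobiSym.eq_zero_iff.2 ⟨hqp.ne_zero, hne⟩
      rw [jacobiSym.mul_left, this] at hJ1
      simp at hJ1
    have h3 : J(g * h * (g * (2 * t)) | q) = 1 := by
      rw [jacobiSym.mul_left, hJ1, hJ2]; rfl
    rw [show g * h * (g * (2 * t)) = g ^ 2 * (h * (2 * t)) by ring, jacobiSym.mul_left,
      jacobiSym.sq_one' hgq, one_mul] at h3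
    exact h3

end HasSplitPrimes

/-- The arithmetic data from which every rational number is shown to be a product of norms from
the three quadratic subfields. -/
structure IsSplitTriple (g h k : ℤ) : Prop where
  squarefree : Squarefree (g * h * k)
  even : 2 ∣ g * h * k
  left : ¬ IsSquare ((g * h : ℤ) : ℚ)
  middle : ¬ IsSquare ((g * k : ℤ) : ℚ)
  right : ¬ IsSquare ((h * k : ℤ) : ℚ)
  split : HasSplitPrimes g h k

theorem ZMod.ne_zero_and_isSquare_of_jacobiSym {p : ℕ} (hp : p.Prime) {a : ℤ}
    (h : jacobiSym a p = 1) : (a : ZMod p) ≠ 0 ∧ IsSquare (a : ZMod p) := by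
  have : Fact p.Prime := ⟨hp⟩
  refine ⟨fun h0 => ?_, ZMod.isSquare_of_jacobiSym_eq_one h⟩
  rw [← jacobiSym.legendreSym.to_jacobiSym, (legendreSym.eq_zero_iff p a).2 h0] at h
  exact zero_ne_one h

/-- A positive integer can be found with prescribed prime factors among those of `D`. -/
theorem exists_dvd_iff_not_dvd (D : ℕ) (hD : D ≠ 0) (e : ℤ) :
    ∃ X : ℕ, ∀ p : ℕ, p.Prime → p ∣ D → (p ∣ X ↔ ¬ (p : ℤ) ∣ e) := by
  refine ⟨∏ p ∈ D.primeFactors with ¬ ((p : ℕ) : ℤ) ∣ e, p, fun p hp hpD => ?_⟩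
  rw [hp.prime.dvd_finsetProd_iff]
  constructor
  · rintro ⟨q, hq, hpq⟩
    rw [Finset.mem_filter] at hq
    rw [(Nat.prime_dvd_prime_iff_eq hp (Nat.prime_of_mem_primeFactors hq.1)).1 hpq]
    exact hq.2
  · intro h
    exact ⟨p, Finset.mem_filter.2 ⟨Nat.mem_primeFactors.2 ⟨hp, hpD, hD⟩, h⟩, dvd_rfl⟩

namespace IsSplitTriple

variable {g h k : ℤ}

theorem swap_left (H : IsSplitTriple g h k) : IsSplitTriple h g k :=
  ⟨by rw [mul_comm h g]; exact H.squarefree, by rw [mul_comm h g]; exact H.even,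
    by rw [mul_comm h g]; exact H.left, H.right, H.middle, H.split.swap_left⟩

theorem swap_right (H : IsSplitTriple g h k) : IsSplitTriple g k h :=
  ⟨by rw [mul_right_comm]; exact H.squarefree, by rw [mul_right_comm]; exact H.even,
    H.middle, H.left, by rw [mul_comm k h]; exact H.right, H.split.swap_right⟩

theorem left_mul_right_ne_zero (H : IsSplitTriple g h k) : h * k ≠ 0 := by
  have := H.squarefree.ne_zero
  rw [mul_assoc] at this
  exact right_ne_zero_of_mul this

theorem not_dvd_of_dvd (H : IsSplitTriple g h k) {p : ℕ} (hp : p.Prime) (hg : (p : ℤ) ∣ g) :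
    ¬ (p : ℤ) ∣ h := fun hh => by
  have := H.squarefree p ((mul_dvd_mul hg hh).mul_right k)
  rw [Int.isUnit_iff_natAbs_eq] at this
  exact hp.one_lt.ne' (by simpa using this)

theorem isNormProduct_prime_of_jacobiSym (H : IsSplitTriple g h k) {c : ℕ} (hc : c.Prime)
    (hcD : ¬ (c : ℤ) ∣ g * h * k) (hJ : jacobiSym (h * k) c = 1) : IsNormProduct g h k c := by
  have hne : ∀ p : ℕ, p.Prime → (p : ℤ) ∣ g * h * k → (c : ZMod p) ≠ 0 := by
    intro p hp hd h0
    rw [ZMod.natCast_eq_zero_iff, Nat.prime_dvd_prime_iff_eq hp hc] at h0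
    exact hcD (h0 ▸ hd)
  obtain ⟨q₁, -, hq₁, hmod₁, hgh₁, hgk₁, hhk₁⟩ := H.split 0
    (fun p => if (p : ℤ) ∣ k then c else 1) (fun p hp => by
      have : Fact p.Prime := ⟨hp⟩
      split_ifs with hd
      · exact hne p hp (hd.mul_left _)
      · simp)
  obtain ⟨q₂, -, hq₂, hmod₂, hgh₂, hgk₂, hhk₂⟩ := H.split 0
    (fun p => if (p : ℤ) ∣ h then c else 1) (fun p hp => by
      have : Fact p.Prime := ⟨hp⟩
      split_ifs with hd
      · exact hne p hp ((hd.mul_left _).mul_right _)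
      · simp)
  have hgk : ∀ p : ℕ, p.Prime → (p : ℤ) ∣ g → ¬ (p : ℤ) ∣ k := fun p hp =>
    H.swap_right.not_dvd_of_dvd hp
  have hgh : ∀ p : ℕ, p.Prime → (p : ℤ) ∣ g → ¬ (p : ℤ) ∣ h := fun p hp =>
    H.not_dvd_of_dvd hp
  have hhk : ∀ p : ℕ, p.Prime → (p : ℤ) ∣ h → ¬ (p : ℤ) ∣ k := fun p hp =>
    H.swap_left.swap_right.not_dvd_of_dvd hp
  have heq : ∀ p q : ℕ, p.Prime → q.Prime → (p : ℤ) ∣ q → p = q := fun p q hp hq hd =>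
    (Nat.prime_dvd_prime_iff_eq hp hq).1 (by exact_mod_cast hd)
  have N₁ : IsQuadNorm (g * h) q₁ := by
    have := (ternaryIsotropic_of_legendre (d := g * h) (n := q₁)
      H.swap_right.swap_left.left_mul_right_ne_zero (by exact_mod_cast hq₁.pos)
      (fun p hp _ hd => by
        rw [heq p q₁ hp hq₁ hd]
        exact ZMod.ne_zero_and_isSquare_of_jacobiSym hq₁ hgh₁)
      (fun p hp h2 hd => by
        have : Fact p.Prime := ⟨hp⟩
        have hk : ¬ (p : ℤ) ∣ k := by
          rcases (Nat.prime_iff_prime_int.1 hp).dvd_or_dvd hd with h | h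
          exacts [hgk p hp h, hhk p hp h]
        have := hmod₁ p hp h2 (hd.mul_right _)
        rw [if_neg hk] at this
        push_cast at this ⊢
        rw [this]
        exact ⟨one_ne_zero, IsSquare.one⟩)).exists_eq_sq_sub H.left
    push_cast at this
    exact this
  have N₂ : IsQuadNorm (g * k) q₂ := by
    have := (ternaryIsotropic_of_legendre (d := g * k) (n := q₂)
      H.swap_left.left_mul_right_ne_zero (by exact_mod_cast hq₂.pos)
      (fun p hp _ hd => by
        rw [heq p q₂ hp hq₂ hd]
        exact ZMod.ne_zero_and_isSquare_of_jacobiSym hq₂ hgk₂)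
      (fun p hp h2 hd => by
        have : Fact p.Prime := ⟨hp⟩
        have hk : ¬ (p : ℤ) ∣ h := by
          rcases (Nat.prime_iff_prime_int.1 hp).dvd_or_dvd hd with h | h
          exacts [hgh p hp h, fun h' => hhk p hp h' h]
        have := hmod₂ p hp h2 (by rw [mul_right_comm]; exact hd.mul_right _)
        rw [if_neg hk] at this
        push_cast at this ⊢
        rw [this]
        exact ⟨one_ne_zero, IsSquare.one⟩)).exists_eq_sq_sub H.middle
    push_cast at this
    exact this
  have N₃ : IsQuadNorm (h * k) (c * q₁ * q₂) := by
    have := (ternaryIsotropic_of_legendre (d := h * k) (n := c * q₁ * q₂)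
      H.left_mul_right_ne_zero
      (by have := hc.pos; have := hq₁.pos; have := hq₂.pos; positivity)
      (fun p hp _ hd => by
        rcases (Nat.prime_iff_prime_int.1 hp).dvd_or_dvd hd with hd | hd
        · rcases (Nat.prime_iff_prime_int.1 hp).dvd_or_dvd hd with hd | hd
          · rw [heq p c hp hc hd]
            exact ZMod.ne_zero_and_isSquare_of_jacobiSym hc hJ
          · rw [heq p q₁ hp hq₁ hd]
            exact ZMod.ne_zero_and_isSquare_of_jacobiSym hq₁ hhk₁
        · rw [heq p q₂ hp hq₂ hd]
          exact ZMod.ne_zero_and_isSquare_of_jacobiSym hq₂ hhk₂)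
      (fun p hp h2 hd => by
        have : Fact p.Prime := ⟨hp⟩
        have hdD : (p : ℤ) ∣ g * h * k := by rw [mul_assoc]; exact hd.mul_left _
        have h1 := hmod₁ p hp h2 hdD
        have h2 := hmod₂ p hp h2 hdD
        have hcc : ((c * q₁ * q₂ : ℤ) : ZMod p) = c ^ 2 := by
          push_cast
          rw [h1, h2]
          rcases (Nat.prime_iff_prime_int.1 hp).dvd_or_dvd hd with h | h
          · rw [if_pos h, if_neg (hhk p hp h)]
            push_cast
            ring
          · rw [if_pos h, if_neg fun h' => hhk p hp h' h]
            push_cast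
            ring
        rw [hcc]
        exact ⟨pow_ne_zero 2 (hne p hp hdD), IsSquare.sq _⟩)).exists_eq_sq_sub H.right
    push_cast at this
    exact this
  have hq₁0 : (q₁ : ℚ) ≠ 0 := by exact_mod_cast hq₁.ne_zero
  have hq₂0 : (q₂ : ℚ) ≠ 0 := by exact_mod_cast hq₂.ne_zero
  refine IsNormProduct.of_mul_left (c := ((q₁ : ℚ) * q₂) ^ 2) ⟨q₁, q₂, c * q₁ * q₂, N₁, N₂, N₃, ?_⟩
    (.sq _ _ _ _) (by positivity)
  ring

theorem isNormProduct_prime_of_not_dvd (H : IsSplitTriple g h k) {c : ℕ} (hc : c.Prime)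
    (hcD : ¬ (c : ℤ) ∣ g * h * k) : IsNormProduct g h k c := by
  have : Fact c.Prime := ⟨hc⟩
  have hg : g.gcd c = 1 := Int.isCoprime_iff_gcd_eq_one.1
    (((Nat.prime_iff_prime_int.1 hc).coprime_iff_not_dvd.2
      fun h => hcD ((h.mul_right _).mul_right _)).symm)
  have hh : h.gcd c = 1 := Int.isCoprime_iff_gcd_eq_one.1
    (((Nat.prime_iff_prime_int.1 hc).coprime_iff_not_dvd.2
      fun h => hcD ((h.mul_left _).mul_right _)).symm)
  have hk : k.gcd c = 1 := Int.isCoprime_iff_gcd_eq_one.1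
    (((Nat.prime_iff_prime_int.1 hc).coprime_iff_not_dvd.2
      fun h => hcD (h.mul_left _)).symm)
  have key : jacobiSym (h * k) c = 1 ∨ jacobiSym (g * k) c = 1 ∨ jacobiSym (h * g) c = 1 := by
    simp only [jacobiSym.mul_left]
    rcases jacobiSym.eq_one_or_neg_one hg with h1 | h1 <;>
    rcases jacobiSym.eq_one_or_neg_one hh with h2 | h2 <;>
    rcases jacobiSym.eq_one_or_neg_one hk with h3 | h3 <;>
    simp [h1, h2, h3]
  rcases key with hJ | hJ | hJ
  · exact H.isNormProduct_prime_of_jacobiSym hc hcD hJ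
  · exact (H.swap_left.isNormProduct_prime_of_jacobiSym hc
      (by rwa [mul_comm h g]) hJ).swap_left
  · exact (H.swap_right.swap_left.isNormProduct_prime_of_jacobiSym hc
      (by rwa [mul_comm k g, mul_right_comm]) (by rwa [mul_comm g h])).swap_left.swap_right

theorem isNormProduct_nat (H : IsSplitTriple g h k) {n : ℕ} (hn : n ≠ 0)
    (hnD : ∀ p : ℕ, p.Prime → (p : ℤ) ∣ g * h * k → ¬ p ∣ n) : IsNormProduct g h k n := by
  induction n using induction_on_primes with
  | zero => exact absurd rfl hn
  | one => simpa using IsNormProduct.sq g h k 1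
  | prime_mul p n hp ih =>
    rw [Nat.cast_mul]
    exact (H.isNormProduct_prime_of_not_dvd hp fun hd => hnD p hp hd (dvd_mul_right _ _)).mul
      (ih (right_ne_zero_of_mul hn) fun q hq hd hqn => hnD q hq hd (hqn.mul_left _))

theorem isNormProduct_neg_one_of_pos (H : IsSplitTriple g h k) (hpos : 0 < g * h) :
    IsNormProduct g h k (-1) := by
  have hD : (g * h * k).natAbs ≠ 0 := Int.natAbs_ne_zero.2 H.squarefree.ne_zero
  obtain ⟨X, hX⟩ := exists_dvd_iff_not_dvd _ hD (g * h)
  set Y : ℕ := X * (g * h * k).natAbs + 1 with hY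
  have hlt : X < Y := by
    have := Nat.pos_of_ne_zero hD
    nlinarith
  have hneg : (0 : ℤ) < g * h * Y ^ 2 - X ^ 2 := by
    have h1 : (X : ℤ) < Y := by exact_mod_cast hlt
    have h2 : (X : ℤ) ^ 2 < Y ^ 2 := by gcongr
    nlinarith [sq_nonneg (Y : ℤ)]
  obtain ⟨n, hn⟩ := Int.eq_ofNat_of_zero_le hneg.le
  have h1 : IsNormProduct g h k n := by
    refine H.isNormProduct_nat (by rintro rfl; rw [hn] at hneg; simp at hneg)
      fun p hp hd hpn => ?_
    have hp' := Nat.prime_iff_prime_int.1 hp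
    have hdD : p ∣ (g * h * k).natAbs := Int.natCast_dvd.1 hd
    have hpn' : (p : ℤ) ∣ g * h * Y ^ 2 - X ^ 2 := by rw [hn]; exact_mod_cast hpn
    by_cases hgh : (p : ℤ) ∣ g * h
    · refine ((hX p hp hdD).not.2 (not_not.2 hgh)) ?_
      have := (dvd_sub_right (hgh.mul_right _)).1 hpn'
      exact_mod_cast hp'.dvd_of_dvd_pow this
    · have hXp : (p : ℤ) ∣ X := by exact_mod_cast (hX p hp hdD).2 hgh
      have := (dvd_sub_left (dvd_pow hXp two_ne_zero)).1 hpn'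
      rcases hp'.dvd_or_dvd this with h | h
      · exact hgh h
      · have h' : p ∣ Y := by exact_mod_cast hp'.dvd_of_dvd_pow h
        exact hp.one_lt.ne' (Nat.dvd_one.1 ((Nat.dvd_add_right (hdD.mul_left X)).1 h'))
  have hnQ : (g : ℚ) * h * Y ^ 2 - X ^ 2 = n := by exact_mod_cast hn
  have h2 : IsNormProduct g h k (n * -1) :=
    .of_isQuadNorm ⟨X, Y, by rw [← hnQ]; ring⟩
  refine h2.of_mul_left h1 ?_
  rw [← hnQ]
  exact_mod_cast hneg.ne'

theorem isNormProduct_neg_one (H : IsSplitTriple g h k) : IsNormProduct g h k (-1) := by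
  have h1 := H.left_mul_right_ne_zero
  have h2 := H.swap_left.left_mul_right_ne_zero
  have key : 0 < g * h ∨ 0 < g * k ∨ 0 < h * k := by
    rcases lt_or_gt_of_ne (left_ne_zero_of_mul h1) with hh | hh <;>
    rcases lt_or_gt_of_ne (left_ne_zero_of_mul h2) with hg | hg <;>
    rcases lt_or_gt_of_ne (right_ne_zero_of_mul h2) with hk | hk <;>
    simp [mul_pos_iff, *]
  rcases key with h | h | h
  · exact H.isNormProduct_neg_one_of_pos h
  · exact (H.swap_right.isNormProduct_neg_one_of_pos h).swap_right
  · exact (H.swap_left.swap_right.isNormProduct_neg_one_of_pos h).swap_right.swap_left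

theorem isNormProduct_prime_of_dvd_left (H : IsSplitTriple g h k) {p : ℕ} (hp : p.Prime)
    (hpg : (p : ℤ) ∣ g) : IsNormProduct g h k p := by
  have hD : (g * h * k).natAbs ≠ 0 := Int.natAbs_ne_zero.2 H.squarefree.ne_zero
  obtain ⟨e, he⟩ : (p : ℤ) ∣ g * h := hpg.mul_right _
  have hpe : ¬ (p : ℤ) ∣ e := fun hd => by
    have := H.squarefree p (by rw [he]; exact (mul_dvd_mul_left _ hd).mul_right _)
    rw [Int.isUnit_iff_natAbs_eq] at this
    exact hp.one_lt.ne' (by simpa using this)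
  obtain ⟨X, hX⟩ := exists_dvd_iff_not_dvd _ hD e
  have hnD : ∀ q : ℕ, q.Prime → (q : ℤ) ∣ g * h * k → ¬ (q : ℤ) ∣ p * X ^ 2 - e := by
    intro q hq hd hqn
    have hq' := Nat.prime_iff_prime_int.1 hq
    have hdD : q ∣ (g * h * k).natAbs := Int.natCast_dvd.1 hd
    by_cases hqe : (q : ℤ) ∣ e
    · have := (dvd_sub_left hqe).1 hqn
      rcases hq'.dvd_or_dvd this with h | h
      · rw [(Nat.prime_dvd_prime_iff_eq hq hp).1 (by exact_mod_cast h)] at hqe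
        exact hpe hqe
      · have h' : q ∣ X := by exact_mod_cast hq'.dvd_of_dvd_pow h
        exact (hX q hq hdD).1 h' hqe
    · have hXq : (q : ℤ) ∣ X := by exact_mod_cast (hX q hq hdD).2 hqe
      exact hqe ((dvd_sub_right ((dvd_pow hXq two_ne_zero).mul_left _)).1 hqn)
  have hn0 : (p * X ^ 2 - e : ℤ) ≠ 0 := fun h0 =>
    hnD 2 Nat.prime_two (by exact_mod_cast H.even) (by rw [h0]; exact dvd_zero _)
  have hn : IsNormProduct g h k ((p * X ^ 2 - e : ℤ) : ℚ) := by
    have hnat : IsNormProduct g h k ((p * X ^ 2 - e : ℤ).natAbs : ℕ) :=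
      H.isNormProduct_nat (Int.natAbs_ne_zero.2 hn0) fun q hq hd hqn =>
        hnD q hq hd (Int.natCast_dvd.2 hqn)
    rcases Int.natAbs_eq (p * X ^ 2 - e : ℤ) with h | h
    · rw [h, Int.cast_natCast]
      exact hnat
    · rw [h]
      have := H.isNormProduct_neg_one.mul hnat
      rw [neg_one_mul] at this
      exact_mod_cast this
  have heQ : (g : ℚ) * h = p * e := by exact_mod_cast he
  refine IsNormProduct.of_mul_left (c := ((p * X ^ 2 - e : ℤ) : ℚ)) ?_ hn (by exact_mod_cast hn0)
  refine .of_isQuadNorm ⟨p * X, 1, ?_⟩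
  rw [heQ]
  push_cast
  ring

theorem isNormProduct_prime (H : IsSplitTriple g h k) {p : ℕ} (hp : p.Prime) :
    IsNormProduct g h k p := by
  by_cases hd : (p : ℤ) ∣ g * h * k
  · have hp' := Nat.prime_iff_prime_int.1 hp
    rcases hp'.dvd_or_dvd hd with hd | hd
    · rcases hp'.dvd_or_dvd hd with hd | hd
      · exact H.isNormProduct_prime_of_dvd_left hp hd
      · exact (H.swap_left.isNormProduct_prime_of_dvd_left hp hd).swap_left
    · exact (H.swap_right.swap_left.isNormProduct_prime_of_dvd_left hp hd).swap_left.swap_right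
  · exact H.isNormProduct_prime_of_not_dvd hp hd

/-- Every nonzero rational is a product of norms from the three quadratic subfields. -/
theorem isNormProduct (H : IsSplitTriple g h k) {c : ℚ} (hc : c ≠ 0) :
    IsNormProduct g h k c := by
  have hnat : ∀ n : ℕ, n ≠ 0 → IsNormProduct g h k n := by
    intro n hn
    induction n using induction_on_primes with
    | zero => exact absurd rfl hn
    | one => simpa using IsNormProduct.sq g h k 1
    | prime_mul p n hp ih =>
      rw [Nat.cast_mul]
      exact (H.isNormProduct_prime hp).mul (ih (right_ne_zero_of_mul hn))
  have h_int : ∀ n : ℤ, n ≠ 0 → IsNormProduct g h k n := by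
    intro n hn
    rcases Int.natAbs_eq n with h | h
    · rw [h, Int.cast_natCast]
      exact hnat _ (Int.natAbs_ne_zero.2 hn)
    · rw [h]
      have := H.isNormProduct_neg_one.mul (hnat _ (Int.natAbs_ne_zero.2 hn))
      rw [neg_one_mul] at this
      exact_mod_cast this
  have hden : (c.den : ℚ) ≠ 0 := by exact_mod_cast c.den_ne_zero
  have := ((h_int c.num (Rat.num_ne_zero.2 hc)).mul (hnat c.den c.den_ne_zero)).mul
    (.sq g h k (c.den : ℚ)⁻¹)
  convert this using 1
  conv_lhs => rw [← Rat.num_div_den c]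
  field_simp

theorem of_mod_four (hg : g % 4 = 1) (hh : h % 4 = 3) (hk : k % 4 = 2)
    (hsq : Squarefree (g * h * k)) : IsSplitTriple g h k := by
  have key : ∀ d : ℤ, d % 4 = 2 ∨ d % 4 = 3 → ¬ IsSquare (d : ℚ) := by
    intro d hd h
    rw [Rat.isSquare_intCast_iff] at h
    obtain ⟨t, rfl⟩ := h
    obtain h | h | h | h : t % 4 = 0 ∨ t % 4 = 1 ∨ t % 4 = 2 ∨ t % 4 = 3 := by omega
    all_goals rw [Int.mul_emod, h] at hd; omega
  refine ⟨hsq, (show (2 : ℤ) ∣ k by omega).mul_left _, key _ ?_, key _ ?_, key _ ?_,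
    .of_mod_four hg hh hk⟩
  · rw [Int.mul_emod, hg, hh]; decide
  · rw [Int.mul_emod, hg, hk]; decide
  · rw [Int.mul_emod, hh, hk]; decide

theorem of_mod_four_ne (hg : Squarefree g) (hh : Squarefree h) (hk : Squarefree k)
    (hgh : IsCoprime g h) (hgk : IsCoprime g k) (hhk : IsCoprime h k)
    (h₁ : g % 4 ≠ h % 4) (h₂ : g % 4 ≠ k % 4) (h₃ : h % 4 ≠ k % 4) : IsSplitTriple g h k := by
  have hsq : Squarefree (g * h * k) :=
    squarefree_mul_iff.2 ⟨(hgk.mul_left hhk).isRelPrime,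
      squarefree_mul_iff.2 ⟨hgh.isRelPrime, hg, hh⟩, hk⟩
  have key : ∀ d : ℤ, Squarefree d → d % 4 = 1 ∨ d % 4 = 2 ∨ d % 4 = 3 := by
    intro d hd
    have : d % 4 ≠ 0 := fun h0 => by
      have := hd 2 (by omega)
      rw [Int.isUnit_iff] at this
      omega
    omega
  have hsq₁ : Squarefree (h * g * k) := by rwa [mul_comm h g]
  have hsq₂ : Squarefree (g * k * h) := by rwa [mul_right_comm]
  have hsq₃ : Squarefree (h * k * g) := by rwa [mul_comm, ← mul_assoc]
  have hsq₄ : Squarefree (k * g * h) := by rwa [mul_assoc, mul_comm]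
  have hsq₅ : Squarefree (k * h * g) := by rwa [mul_comm k h]
  rcases key g hg with h1 | h1 | h1 <;> rcases key h hh with h2 | h2 | h2 <;>
    rcases key k hk with h3 | h3 | h3 <;> first | omega | skip
  · exact (of_mod_four h1 h3 h2 hsq₂).swap_right
  · exact of_mod_four h1 h2 h3 hsq
  · exact (of_mod_four h2 h3 h1 hsq₃).swap_right.swap_left
  · exact (of_mod_four h3 h2 h1 hsq₅).swap_right.swap_left.swap_right
  · exact (of_mod_four h2 h1 h3 hsq₁).swap_left
  · exact (of_mod_four h3 h1 h2 hsq₄).swap_left.swap_right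

end IsSplitTriple

/-- The norm form of a biquadratic algebra with basis `1, α, β, αβ`, where `α² = a`, `β² = b`. -/
theorem Algebra.norm_biquadratic {R S : Type*} [CommRing R] [CommRing S] [Algebra R S]
    (B : Module.Basis (Fin 4) R S) {a b : R} {α β : S} (hα : α ^ 2 = algebraMap R S a)
    (hβ : β ^ 2 = algebraMap R S b) (h0 : B 0 = 1) (h1 : B 1 = α) (h2 : B 2 = β)
    (h3 : B 3 = α * β) (c : Fin 4 → R) :
    Algebra.norm R (∑ i, c i • B i) =
      (c 0 ^ 2 + a * c 1 ^ 2 - b * c 2 ^ 2 - a * b * c 3 ^ 2) ^ 2 -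
        a * (2 * c 0 * c 1 - 2 * b * c 2 * c 3) ^ 2 := by
  have hM : Algebra.leftMulMatrix B (∑ i, c i • B i) =
      !![c 0, a * c 1, b * c 2, a * b * c 3;
         c 1, c 0, b * c 3, b * c 2;
         c 2, a * c 3, c 0, a * c 1;
         c 3, c 2, c 1, c 0] := by
    have hcol : ∀ (M : Matrix (Fin 4) (Fin 4) R) (s : S), (∀ j, s * B j = ∑ i, M i j • B i) →
        Algebra.leftMulMatrix B s = M := by
      intro M s h
      ext i j
      rw [Algebra.leftMulMatrix_eq_repr_mul, h j, B.repr_sum_self (fun i => M i j)]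
    apply hcol
    intro j
    simp only [Fin.sum_univ_four, h0, h1, h2, h3, Algebra.smul_def]
    fin_cases j
    · simp [h0]
    · simp [h1]
      linear_combination (algebraMap R S (c 1) + algebraMap R S (c 3) * β) * hα
    · simp [h2]
      linear_combination (algebraMap R S (c 2) + algebraMap R S (c 3) * α) * hβ
    · simp [h3]
      linear_combination (algebraMap R S (c 1) * β + algebraMap R S (c 3) * β ^ 2) * hα +
        (algebraMap R S (c 2) * α + algebraMap R S (c 3) * algebraMap R S a) * hβ
  rw [Algebra.norm_eq_matrix_det B, hM]
  simp [Matrix.det_succ_row_zero, Fin.sum_univ_succ, Fin.succAbove]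
  ring

/-- `K` has a `ℚ`-basis `1, α, β, αβ` with `α² = a` and `β² = b`. -/
structure BiquadraticBasis (K : Type*) [Field K] [Algebra ℚ K] (a b : ℤ) where
  α : K
  β : K
  basis : Module.Basis (Fin 4) ℚ K
  α_sq : α ^ 2 = algebraMap ℚ K a
  β_sq : β ^ 2 = algebraMap ℚ K b
  basis_zero : basis 0 = 1
  basis_one : basis 1 = α
  basis_two : basis 2 = β
  basis_three : basis 3 = α * β

namespace BiquadraticBasis

variable {K : Type*} [Field K] [Algebra ℚ K] {a b : ℤ}

theorem norm_eq (E : BiquadraticBasis K a b) (w x y z : ℚ) :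
    Algebra.norm ℚ (algebraMap ℚ K w + algebraMap ℚ K x * E.α + algebraMap ℚ K y * E.β +
      algebraMap ℚ K z * (E.α * E.β)) =
      (w ^ 2 + a * x ^ 2 - b * y ^ 2 - a * b * z ^ 2) ^ 2 -
        a * (2 * w * x - 2 * b * y * z) ^ 2 := by
  have := Algebra.norm_biquadratic E.basis E.α_sq E.β_sq E.basis_zero E.basis_one E.basis_two
    E.basis_three ![w, x, y, z]
  simpa [Fin.sum_univ_four, E.basis_zero, E.basis_one, E.basis_two, E.basis_three,
    Algebra.smul_def] using this

theorem exists_baseChange_norm_eq (E : BiquadraticBasis K a b) (F : Type*) [Field F]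
    [Algebra ℚ F] (s : F ⊗[ℚ] K) : ∃ w x y z : F, Algebra.norm F s =
      (w ^ 2 + a * x ^ 2 - b * y ^ 2 - a * b * z ^ 2) ^ 2 -
        a * (2 * w * x - 2 * b * y * z) ^ 2 := by
  let B := Algebra.TensorProduct.basis F E.basis
  have hB : ∀ i, B i = 1 ⊗ₜ E.basis i := Algebra.TensorProduct.basis_apply E.basis
  have hsq : ∀ (γ : K) (d : ℤ), γ ^ 2 = algebraMap ℚ K d →
      ((1 : F) ⊗ₜ[ℚ] γ) ^ 2 = algebraMap F (F ⊗[ℚ] K) d := by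
    intro γ d h
    rw [Algebra.TensorProduct.tmul_pow, h, one_pow]
    rw [map_intCast, map_intCast]
    exact map_intCast (Algebra.TensorProduct.includeRight : K →ₐ[ℚ] F ⊗[ℚ] K) d
  have := Algebra.norm_biquadratic B (hsq _ _ E.α_sq) (hsq _ _ E.β_sq)
    (by rw [hB, E.basis_zero]; rfl) (by rw [hB, E.basis_one]) (by rw [hB, E.basis_two])
    (by rw [hB, E.basis_three]; simp) (B.repr s)
  rw [B.sum_repr] at this
  exact ⟨_, _, _, _, this⟩

/-- A local norm `x` from the biquadratic algebra is a norm from both quadratic subalgebras. -/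
theorem ternaryIsotropic_of_norm (E : BiquadraticBasis K a b) {F : Type*} [Field F]
    [Algebra ℚ F] (s : F ⊗[ℚ] K) :
    TernaryIsotropic (a : F) (Algebra.norm F s) ∧ TernaryIsotropic (b : F) (Algebra.norm F s) := by
  obtain ⟨w, x, y, z, h⟩ := E.exists_baseChange_norm_eq F s
  rw [h]
  exact ⟨⟨w ^ 2 + a * x ^ 2 - b * y ^ 2 - a * b * z ^ 2, 2 * w * x - 2 * b * y * z, 1, by simp,
      by ring⟩,
    ⟨w ^ 2 - a * x ^ 2 + b * y ^ 2 - a * b * z ^ 2, 2 * w * y - 2 * a * x * z, 1, by simp,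
      by ring⟩⟩

theorem isQuadNorm_of_isotropic {d : ℤ} {x : ℚ} (hd : ¬ IsSquare (d : ℚ)) (hx : x ≠ 0)
    (hp : ∀ (p : ℕ) [Fact p.Prime], TernaryIsotropic (d : ℚ_[p]) (x : ℚ_[p]))
    (hr : TernaryIsotropic (d : ℝ) (x : ℝ)) : IsQuadNorm d x := by
  have hcast : ∀ (F : Type) [Field F] [CharZero F],
      (((x.num * x.den : ℤ) : F)) = (x : F) * (x.den : F) ^ 2 := by
    intro F _ _
    have : ((x.num * x.den : ℤ) : ℚ) = x * (x.den : ℚ) ^ 2 := by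
      push_cast
      rw [pow_two, ← mul_assoc, Rat.mul_den_eq_num]
    exact_mod_cast congrArg (Rat.cast : ℚ → F) this
  have hdenF : ∀ (F : Type) [Field F] [CharZero F], (x.den : F) ≠ 0 := fun F _ _ =>
    Nat.cast_ne_zero.2 x.den_ne_zero
  have hd0 : d ≠ 0 := by
    rintro rfl
    exact hd ⟨0, by simp⟩
  have := ternaryIsotropic_rat_of_local d (x.num * x.den) hd0
    (mul_ne_zero (Rat.num_ne_zero.2 hx) (by exact_mod_cast x.den_ne_zero))
    (fun p _ _ => by
      rw [hcast]
      exact (hp p).mul_sq (hdenF _))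
    (by
      rw [hcast]
      exact hr.mul_sq (hdenF _))
  rw [hcast] at this
  exact (this.of_mul_sq (hdenF _)).exists_eq_sq_sub hd

/-- The Hasse norm principle holds once every rational is a product of norms from the three
quadratic subfields. -/
theorem hasseNormPrinciple (E : BiquadraticBasis K a b) (ha : ¬ IsSquare (a : ℚ))
    (hb : ¬ IsSquare (b : ℚ)) (hab : ¬ IsSquare ((a * b : ℤ) : ℚ))
    (H : ∀ c : ℚ, c ≠ 0 → ∃ r s t : ℚ, IsQuadNorm a r ∧ IsQuadNorm b s ∧
      IsQuadNorm (a * b) t ∧ c = r * s * t) : HasseNormPrinciple K := by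
  rintro x hx ⟨hp, y, -, hy⟩
  have hiso : IsQuadNorm a x ∧ IsQuadNorm b x := by
    refine ⟨isQuadNorm_of_isotropic ha hx (fun p _ => ?_) ?_,
      isQuadNorm_of_isotropic hb hx (fun p _ => ?_) ?_⟩
    · obtain ⟨s, -, hs⟩ := hp p
      exact hs ▸ (E.ternaryIsotropic_of_norm s).1
    · exact hy ▸ (E.ternaryIsotropic_of_norm y).1
    · obtain ⟨s, -, hs⟩ := hp p
      exact hs ▸ (E.ternaryIsotropic_of_norm s).2
    · exact hy ▸ (E.ternaryIsotropic_of_norm y).2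
  obtain ⟨⟨u, v, huv⟩, w, z, hwz⟩ := hiso
  obtain ⟨u, huv, hc⟩ : ∃ u : ℚ, x = u ^ 2 - a * v ^ 2 ∧ u + w ≠ 0 := by
    by_cases hc : u + w = 0
    · refine ⟨-u, by rw [huv]; ring, fun hc' => ?_⟩
      have hw : w = 0 := by linarith
      have hu : u = 0 := by linarith
      subst hw hu
      have hz : z ≠ 0 := by
        rintro rfl
        exact hx (by rw [hwz]; ring)
      refine hab ⟨a * v / z, ?_⟩
      push_cast
      field_simp
      linear_combination (a : ℚ) * (hwz - huv)
    · exact ⟨u, huv, hc⟩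
  obtain ⟨r, s, t, ⟨r₁, r₂, hr⟩, ⟨s₁, s₂, hs⟩, ⟨t₁, t₂, ht⟩, hrst⟩ :=
    H (2 * (u + w)) (mul_ne_zero two_ne_zero hc)
  have N := E.norm_eq
  have n₀ := N (u + w) v z 0
  have n₁ := N r₁ r₂ 0 0
  have n₂ := N s₁ 0 s₂ 0
  have n₃ := N t₁ 0 0 t₂
  set η := algebraMap ℚ K (u + w) + algebraMap ℚ K v * E.α + algebraMap ℚ K z * E.β +
      algebraMap ℚ K 0 * (E.α * E.β)
  set η₁ := algebraMap ℚ K r₁ + algebraMap ℚ K r₂ * E.α + algebraMap ℚ K 0 * E.β +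
      algebraMap ℚ K 0 * (E.α * E.β)
  set η₂ := algebraMap ℚ K s₁ + algebraMap ℚ K 0 * E.α + algebraMap ℚ K s₂ * E.β +
      algebraMap ℚ K 0 * (E.α * E.β)
  set η₃ := algebraMap ℚ K t₁ + algebraMap ℚ K 0 * E.α + algebraMap ℚ K 0 * E.β +
      algebraMap ℚ K t₂ * (E.α * E.β)
  have m₀ : Algebra.norm ℚ η = x * (r * s * t) ^ 2 := by
    have hP : (u + w) ^ 2 + a * v ^ 2 - b * z ^ 2 - a * b * 0 ^ 2 = 2 * u * (u + w) := by
      linear_combination huv - hwz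
    rw [n₀, ← hrst, hP]
    linear_combination -4 * (u + w) ^ 2 * huv
  have m₁ : Algebra.norm ℚ η₁ = r ^ 2 := by rw [n₁, hr]; ring
  have m₂ : Algebra.norm ℚ η₂ = s ^ 2 := by rw [n₂, hs]; ring
  have m₃ : Algebra.norm ℚ η₃ = t ^ 2 := by rw [n₃, ht]; ring
  have h0 : r * s * t ≠ 0 := by
    rw [← hrst]
    exact mul_ne_zero two_ne_zero hc
  have : Module.Finite ℚ K := Module.Finite.of_basis E.basis
  have m : Algebra.norm ℚ (η₁ * η₂ * η₃) = (r * s * t) ^ 2 := by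
    rw [map_mul, map_mul, m₁, m₂, m₃]
    ring
  have hζ : η₁ * η₂ * η₃ ≠ 0 := by
    intro h
    rw [h, Algebra.norm_zero] at m
    exact pow_ne_zero 2 h0 m.symm
  have hnorm : Algebra.norm ℚ (η / (η₁ * η₂ * η₃)) = x := by
    apply mul_right_cancel₀ (pow_ne_zero 2 h0)
    rw [← m₀, ← m, ← map_mul, div_mul_cancel₀ _ hζ]
  refine ⟨_, fun h => hx ?_, hnorm⟩
  rw [← hnorm, h, Algebra.norm_zero]

/-- A degree-four algebra spanned by `1, α, β, αβ` has these elements as a basis when `a`, `b`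
and `a b` are not squares. -/
theorem nonempty_of_span (ha : ¬ IsSquare (a : ℚ))
    (hb : ¬ IsSquare (b : ℚ)) (hab : ¬ IsSquare ((a * b : ℤ) : ℚ)) {α β : K}
    (hα : α ^ 2 = (a : K)) (hβ : β ^ 2 = (b : K))
    (hspan : ∀ u : K, ∃ w x y z : ℚ, u = algebraMap ℚ K w + algebraMap ℚ K x * α +
      algebraMap ℚ K y * β + algebraMap ℚ K z * (α * β)) :
    Nonempty (BiquadraticBasis K a b) := by
  have : CharZero K := algebraRat.charZero K
  have hαQ : ∀ x y : ℚ, algebraMap ℚ K x + algebraMap ℚ K y * α = 0 → x = 0 ∧ y = 0 := by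
    intro x y h
    have hy : y = 0 := by
      by_contra hy
      refine ha ⟨x / y, ?_⟩
      field_simp
      apply (algebraMap ℚ K).injective
      simp only [map_mul, map_pow, map_intCast]
      linear_combination -algebraMap ℚ K y ^ 2 * hα -
        (algebraMap ℚ K x - algebraMap ℚ K y * α) * h
    subst hy
    exact ⟨by simpa using h, rfl⟩
  have hβQ : ∀ x y : ℚ, β ≠ algebraMap ℚ K x + algebraMap ℚ K y * α := by
    intro x y h
    have h1 : algebraMap ℚ K (x ^ 2 + a * y ^ 2 - b) + algebraMap ℚ K (2 * x * y) * α = 0 := by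
      simp only [map_mul, map_pow, map_add, map_sub, map_intCast, map_ofNat]
      rw [← hα, ← hβ, h]
      ring
    obtain ⟨h2, h3⟩ := hαQ _ _ h1
    have h4 : x = 0 ∨ y = 0 := by simpa using h3
    rcases h4 with rfl | rfl
    · exact hab ⟨a * y, by push_cast; linear_combination -(a : ℚ) * h2⟩
    · exact hb ⟨x, by linear_combination -h2⟩
  have hind : ∀ w x y z : ℚ, algebraMap ℚ K w + algebraMap ℚ K x * α + algebraMap ℚ K y * β +
      algebraMap ℚ K z * (α * β) = 0 → w = 0 ∧ x = 0 ∧ y = 0 ∧ z = 0 := by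
    intro w x y z h
    by_cases hyz : y ^ 2 - a * z ^ 2 = 0
    · have hz : z = 0 := by
        by_contra hz
        refine ha ⟨y / z, ?_⟩
        field_simp
        linear_combination -hyz
      subst hz
      have hy : y = 0 := by simpa using hyz
      subst hy
      have := hαQ w x (by simpa using h)
      simp [this]
    · exfalso
      have hyz' : algebraMap ℚ K (y ^ 2 - a * z ^ 2) ≠ 0 := (map_ne_zero _).2 hyz
      refine hβQ (-(w * y - a * x * z) / (y ^ 2 - a * z ^ 2))
        (-(x * y - w * z) / (y ^ 2 - a * z ^ 2)) ?_
      simp only [map_div₀]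
      field_simp
      simp only [map_mul, map_pow, map_sub, map_neg, map_intCast]
      linear_combination (algebraMap ℚ K y - algebraMap ℚ K z * α) * h +
        (algebraMap ℚ K x * algebraMap ℚ K z + algebraMap ℚ K z ^ 2 * β) * hα
  let f : Fin 4 → K := ![1, α, β, α * β]
  have hf : ∀ c : Fin 4 → ℚ, ∑ i, c i • f i = algebraMap ℚ K (c 0) +
      algebraMap ℚ K (c 1) * α + algebraMap ℚ K (c 2) * β + algebraMap ℚ K (c 3) * (α * β) := by
    intro c
    simp [Fin.sum_univ_four, f, Algebra.smul_def]
  have hli : LinearIndependent ℚ f := by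
    rw [Fintype.linearIndependent_iff]
    intro c hc
    rw [hf] at hc
    obtain ⟨h0, h1, h2, h3⟩ := hind _ _ _ _ hc
    intro i
    fin_cases i <;> assumption
  have hsp : ⊤ ≤ Submodule.span ℚ (Set.range f) := by
    rintro u -
    obtain ⟨w, x, y, z, h⟩ := hspan u
    rw [Submodule.mem_span_range_iff_exists_fun]
    exact ⟨![w, x, y, z], by rw [hf, h]; rfl⟩
  refine ⟨⟨α, β, Module.Basis.mk hli hsp, by simpa using hα, by simpa using hβ, ?_, ?_, ?_, ?_⟩⟩
  all_goals rw [Module.Basis.mk_apply]; rfl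

/-- Two square roots generating an extension of degree four give a biquadratic basis. -/
theorem nonempty_adjoin {L : Type*} [Field L] [Algebra ℚ L] (ha : ¬ IsSquare (a : ℚ))
    (hb : ¬ IsSquare (b : ℚ)) (hab : ¬ IsSquare ((a * b : ℤ) : ℚ)) {α β : L}
    (hα : α ^ 2 = (a : L)) (hβ : β ^ 2 = (b : L)) :
    Nonempty (BiquadraticBasis (IntermediateField.adjoin ℚ {α, β}) a b) := by
  have hαK : α ∈ IntermediateField.adjoin ℚ {α, β} := IntermediateField.subset_adjoin _ _ (by simp)
  have hβK : β ∈ IntermediateField.adjoin ℚ {α, β} := IntermediateField.subset_adjoin _ _ (by simp)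
  have hspan : ∀ u ∈ IntermediateField.adjoin ℚ {α, β}, ∃ w x y z : ℚ, u = algebraMap ℚ L w + algebraMap ℚ L x * α +
      algebraMap ℚ L y * β + algebraMap ℚ L z * (α * β) := by
    intro u hu
    have halg : ∀ v ∈ ({α, β} : Set L), IsAlgebraic ℚ v := by
      have : ∀ (v : L) (d : ℤ), v ^ 2 = d → IsAlgebraic ℚ v := fun v d h =>
        IsAlgebraic.of_pow two_pos (by rw [h]; exact isAlgebraic_intCast d)
      rintro v (rfl | rfl)
      exacts [this _ _ hα, this _ _ hβ]
    have hu' : u ∈ Algebra.adjoin ℚ {α, β} := by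
      rw [← IntermediateField.adjoin_toSubalgebra_of_isAlgebraic halg]
      exact hu
    clear hu
    induction hu' using Algebra.adjoin_induction with
    | mem v hv =>
      rcases hv with h | h
      · exact ⟨0, 1, 0, 0, by simp [h]⟩
      · exact ⟨0, 0, 1, 0, by simp [Set.mem_singleton_iff.1 h]⟩
    | algebraMap r => exact ⟨r, 0, 0, 0, by simp⟩
    | add u v _ _ hu hv =>
      obtain ⟨w, x, y, z, rfl⟩ := hu
      obtain ⟨w', x', y', z', rfl⟩ := hv
      exact ⟨w + w', x + x', y + y', z + z', by simp only [map_add]; ring⟩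
    | mul u v _ _ hu hv =>
      obtain ⟨w, x, y, z, rfl⟩ := hu
      obtain ⟨w', x', y', z', rfl⟩ := hv
      refine ⟨w * w' + a * x * x' + b * y * y' + a * b * z * z',
        w * x' + x * w' + b * y * z' + b * z * y', w * y' + y * w' + a * x * z' + a * z * x',
        w * z' + x * y' + y * x' + z * w', ?_⟩
      simp only [map_add, map_mul, map_intCast]
      rw [← hα, ← hβ]
      ring
  refine nonempty_of_span ha hb hab (α := ⟨α, hαK⟩) (β := ⟨β, hβK⟩) ?_ ?_ ?_
  · apply Subtype.ext
    simpa using hα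
  · apply Subtype.ext
    simpa using hβ
  · rintro ⟨u, hu⟩
    obtain ⟨w, x, y, z, h⟩ := hspan u hu
    exact ⟨w, x, y, z, Subtype.ext (by simpa using h)⟩

end BiquadraticBasis

/-- for pairwise coprime squarefree integers `m, a₁, b₁` (with the three
products `≠ 1`) whose residues mod 4 are pairwise distinct, the biquadratic field
`K = ℚ(√(m a₁), √(m b₁))` satisfies the Hasse norm principle. -/
theorem stmt_4 (m a₁ b₁ : ℤ)
    (hm : Squarefree m) (ha : Squarefree a₁) (hb : Squarefree b₁)
    (hma : IsCoprime m a₁) (hmb : IsCoprime m b₁) (hab : IsCoprime a₁ b₁)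
    (h₁ : m * a₁ ≠ 1) (h₂ : m * b₁ ≠ 1) (h₃ : a₁ * b₁ ≠ 1)
    (hmod₁ : m % 4 ≠ a₁ % 4) (hmod₂ : m % 4 ≠ b₁ % 4) (hmod₃ : a₁ % 4 ≠ b₁ % 4)
    (x y : AlgebraicClosure ℚ)
    (hx : x ^ 2 = ((m * a₁ : ℤ) : AlgebraicClosure ℚ))
    (hy : y ^ 2 = ((m * b₁ : ℤ) : AlgebraicClosure ℚ)) :
    HasseNormPrinciple (IntermediateField.adjoin ℚ {x, y}) := by
  have H : IsSplitTriple m a₁ b₁ :=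
    .of_mod_four_ne hm ha hb hma hmb hab hmod₁ hmod₂ hmod₃
  have hm0 : (m : ℚ) ≠ 0 := by exact_mod_cast hm.ne_zero
  have hright : ¬ IsSquare ((m * a₁ * (m * b₁) : ℤ) : ℚ) := by
    rintro ⟨r, hr⟩
    refine H.right ⟨r / m, ?_⟩
    push_cast at hr ⊢
    field_simp
    linear_combination hr
  obtain ⟨E⟩ := BiquadraticBasis.nonempty_adjoin H.left H.middle hright hx hy
  refine E.hasseNormPrinciple H.left H.middle hright fun c hc => ?_
  obtain ⟨r, s, t, hr, hs, ht, h⟩ := H.isNormProduct hc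
  refine ⟨r, s, t, by exact_mod_cast hr, by exact_mod_cast hs, ?_, h⟩
  obtain ⟨t₁, t₂, rfl⟩ := ht
  refine ⟨t₁, t₂ / m, ?_⟩
  push_cast
  field_simp
end
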